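/- Let ℓ ≥ 5, let A be an essential hyperplane arrangement in K^ℓ, and let H ∈ A. Assume that the Ziegler restriction (A^H, m^H) is tame (pd_{S̄} Ω^p(A^H,m^H) ≤ p for all 0 ≤ p ≤ ℓ−1, where S̄ = S/α_H S) and that A is locally free along H. Then A is tame. -/

import Mathlib

noncomputable section
open Classical MvPolynomial

/-- `pdLE R n M` : the `R`-module `M` has projective dimension at most `n`. -/
def pdLE (R : Type) [CommRing R] : ℕ → (M : Type) → [AddCommGroup M] → [Module R M] → Prop
  | 0, M, _, _ => Module.Projective R M
  | n + 1, M, _, _ => ∃ (ι : Type) (f : (ι →₀ R) →ₗ[R] M),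
      Function.Surjective f ∧ pdLE R n (LinearMap.ker f)

/-- Projective dimension as an element of `ℕ∞`. -/
def pdim (R : Type) [CommRing R] (M : Type) [AddCommGroup M] [Module R M] : ℕ∞ :=
  sInf {n : ℕ∞ | ∃ k : ℕ, pdLE R k M ∧ n = (k : ℕ∞)}

/-- The coordinate ring `S = K[x_1, …, x_ℓ]`. -/
abbrev PS (K : Type) [Field K] (ℓ : ℕ) : Type := MvPolynomial (Fin ℓ) K

/-- The free `S`-module of polynomial differential forms of all degrees, realized as the
exterior algebra over `S` on the free module `S^ℓ` (with `dx_i` the standard basis). -/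
abbrev ExtF (K : Type) [Field K] (ℓ : ℕ) : Type :=
  ExteriorAlgebra (PS K ℓ) (Fin ℓ → PS K ℓ)

variable {K : Type} [Field K] {ℓ : ℕ}

/-- The module `Ω^p_V` of polynomial differential `p`-forms. -/
def formsP (K : Type) [Field K] (ℓ : ℕ) (p : ℕ) : Submodule (PS K ℓ) (ExtF K ℓ) :=
  (LinearMap.range (ExteriorAlgebra.ι (PS K ℓ) :
      (Fin ℓ → PS K ℓ) →ₗ[PS K ℓ] ExtF K ℓ)) ^ p

/-- The defining linear form `α = ∑ c_i x_i` of the hyperplane with coefficient vector `c`. -/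
def linP (c : Fin ℓ → K) : PS K ℓ := ∑ i, MvPolynomial.C (c i) * MvPolynomial.X i

/-- The constant one-form `dα = ∑ c_i dx_i`. -/
def dP (c : Fin ℓ → K) : ExtF K ℓ :=
  ExteriorAlgebra.ι (PS K ℓ) (fun i => MvPolynomial.C (c i))

/-- A central hyperplane arrangement in `K^ℓ`: a finite set of (pairwise non-proportional,
nonzero) coefficient vectors of defining linear forms, each representing the hyperplane
`{x : ∑ c_i x_i = 0}`. -/
structure Arrangement (K : Type) [Field K] (ℓ : ℕ) : Type where
  hyps : Finset (Fin ℓ → K)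
  ne_zero : ∀ c ∈ hyps, c ≠ 0
  nonprop : ∀ c ∈ hyps, ∀ c' ∈ hyps, c ≠ c' → ∀ t : K, c ≠ t • c'

/-- The polynomial model of the module `Ω^p(A,m)` of logarithmic `p`-forms of the
multiarrangement `(A,m)`; it is `Q(A,m)·Ω^p(A,m)`, i.e. the image of `Ω^p(A,m)` under the
degree-shifting isomorphism given by multiplication with `Q(A,m)`, so that
`η = Q(A,m)·ω` ranges over polynomial `p`-forms with `dα_H ∧ η ∈ α_H^{m(H)} Ω^{p+1}_V`
for all `H ∈ A`. -/
def Omega (A : Arrangement K ℓ) (m : (Fin ℓ → K) → ℕ) (p : ℕ) :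
    Submodule (PS K ℓ) (ExtF K ℓ) :=
  formsP K ℓ p ⊓ ⨅ c ∈ A.hyps,
    Submodule.comap (LinearMap.mulLeft (PS K ℓ) (dP c))
      (Submodule.map (LinearMap.lsmul (PS K ℓ) (ExtF K ℓ) (linP c ^ m c))
        (formsP K ℓ (p + 1)))

/-- Tameness of a multiarrangement: `pd_S Ω^p(A,m) ≤ p` for all `0 ≤ p ≤ ℓ`. -/
def TameM (A : Arrangement K ℓ) (m : (Fin ℓ → K) → ℕ) : Prop :=
  ∀ p : ℕ, p ≤ ℓ → pdLE (PS K ℓ) p (Omega A m p)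

/-- Tameness of a simple arrangement (constant multiplicity `1`). -/
def Tame (A : Arrangement K ℓ) : Prop := TameM A (fun _ => 1)

/-- Freeness of a multiarrangement: `Ω^1(A,m)` is a free `S`-module. -/
def FreeM (A : Arrangement K ℓ) (m : (Fin ℓ → K) → ℕ) : Prop :=
  Module.Free (PS K ℓ) (Omega A m 1)

/-- An arrangement is essential when the intersection of its hyperplanes is `{0}`,
equivalently the defining forms span the dual space. -/
def Essential (A : Arrangement K ℓ) : Prop :=
  Submodule.span K (A.hyps : Set (Fin ℓ → K)) = ⊤

/-- The localization `A_x = {H ∈ A : x ∈ H}` of an arrangement at a point `x`. -/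
def locArr (A : Arrangement K ℓ) (x : Fin ℓ → K) : Arrangement K ℓ where
  hyps := A.hyps.filter (fun c => ∑ i, c i * x i = 0)
  ne_zero := fun c hc => A.ne_zero c (Finset.mem_filter.mp hc).1
  nonprop := fun c hc c' hc' =>
    A.nonprop c (Finset.mem_filter.mp hc).1 c' (Finset.mem_filter.mp hc').1

/-- `(A,m)` is locally free along the hyperplane `{x : ∑ (c0)_i x_i = 0}` :
`(A_x, m_x)` is free for every nonzero point `x` of this hyperplane. -/
def LocallyFreeAlong (A : Arrangement K ℓ) (m : (Fin ℓ → K) → ℕ) (c0 : Fin ℓ → K) : Prop :=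
  ∀ x : Fin ℓ → K, x ≠ 0 → (∑ i, c0 i * x i = 0) → FreeM (locArr A x) m

/-- The deletion `A ∖ {H}`. -/
def delArr (A : Arrangement K ℓ) (c0 : Fin ℓ → K) : Arrangement K ℓ where
  hyps := A.hyps.erase c0
  ne_zero := fun c hc => A.ne_zero c (Finset.mem_of_mem_erase hc)
  nonprop := fun c hc c' hc' =>
    A.nonprop c (Finset.mem_of_mem_erase hc) c' (Finset.mem_of_mem_erase hc')

/-- The coefficient vector of the restriction of the linear form `c` to the hyperplane `H`
along the linear identification `e : K^{ℓ-1} ≃ H`. -/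
def restrictForm (e : (Fin (ℓ - 1) → K) →ₗ[K] (Fin ℓ → K)) (c : Fin ℓ → K) :
    Fin (ℓ - 1) → K := fun i => ∑ j, c j * e (Pi.single i 1) j

/-- The linear form on `K^ℓ` with coefficient vector `c`. -/
def dotLin (c : Fin ℓ → K) : (Fin ℓ → K) →ₗ[K] K := ∑ i, c i • LinearMap.proj i

/-- `e` identifies `K^{ℓ-1}` with the hyperplane `ker(α_{c0})`. -/
def IsHypEmbedding (c0 : Fin ℓ → K) (e : (Fin (ℓ - 1) → K) →ₗ[K] (Fin ℓ → K)) : Prop :=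
  Function.Injective e ∧ LinearMap.range e = LinearMap.ker (dotLin c0)

/-- `B` (an arrangement in `K^{ℓ-1}`) represents the restriction `A^H` of `A` to the
hyperplane `H` determined by `c0 ∈ A`, via the identification `e : K^{ℓ-1} ≃ H`:
its hyperplanes are exactly the restrictions to `H` of the hyperplanes of `A ∖ {H}`. -/
def IsRestrictionOf (B : Arrangement K (ℓ - 1)) (A : Arrangement K ℓ) (c0 : Fin ℓ → K)
    (e : (Fin (ℓ - 1) → K) →ₗ[K] (Fin ℓ → K)) : Prop :=
  (∀ c ∈ A.hyps, c ≠ c0 → ∃ c' ∈ B.hyps, ∃ t : K, t ≠ 0 ∧ restrictForm e c = t • c') ∧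
  (∀ c' ∈ B.hyps, ∃ c ∈ A.hyps, c ≠ c0 ∧ ∃ t : K, t ≠ 0 ∧ restrictForm e c = t • c')
/-- The Ziegler multiplicity `m^H` on the restriction: `m^H(X) = #{L ∈ A∖{H} : L ∩ H = X}`. -/
def zieglerMult (A : Arrangement K ℓ) (c0 : Fin ℓ → K)
    (e : (Fin (ℓ - 1) → K) →ₗ[K] (Fin ℓ → K)) (c' : Fin (ℓ - 1) → K) : ℕ :=
  (A.hyps.filter (fun c => c ≠ c0 ∧ ∃ t : K, t ≠ 0 ∧ restrictForm e c = t • c')).card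

/-- The wedge `dx_{i_1} ∧ ⋯ ∧ dx_{i_p}` for a list of indices. -/
def wedgeList (l : List (Fin ℓ)) : ExtF K ℓ :=
  (l.map (fun i => ExteriorAlgebra.ι (PS K ℓ) (Pi.single i (1 : PS K ℓ)))).prod

/-- A polynomial `p`-form is homogeneous of (coefficient) degree `d` if it is a sum of
terms `f · dx_{i_1} ∧ ⋯ ∧ dx_{i_p}` with `f` homogeneous of degree `d`. -/
def IsHomogForm (p d : ℕ) (η : ExtF K ℓ) : Prop :=
  η ∈ AddSubgroup.closure {ξ : ExtF K ℓ | ∃ (f : PS K ℓ) (l : List (Fin ℓ)),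
    f.IsHomogeneous d ∧ l.length = p ∧ ξ = f • wedgeList l}

/-- `|m| = ∑_{H ∈ A} m(H)`. -/
def msum (A : Arrangement K ℓ) (m : (Fin ℓ → K) → ℕ) : ℕ := ∑ c ∈ A.hyps, m c

/-- The multiarrangement `(A,m)` is free with exponents `(d_1, …, d_ℓ)`: the polynomial
model of `Ω^1(A,m)` has a homogeneous basis whose `i`-th member has coefficient degree
`|m| - d_i`. -/
def FreeWithExp (A : Arrangement K ℓ) (m : (Fin ℓ → K) → ℕ) (d : Fin ℓ → ℕ) : Prop :=
  ∃ b : Fin ℓ → ExtF K ℓ,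
    (∀ i, b i ∈ Omega A m 1) ∧
    (∀ i, IsHomogForm 1 (msum A m - d i) (b i)) ∧
    LinearIndependent (PS K ℓ) b ∧
    Omega A m 1 ≤ Submodule.span (PS K ℓ) (Set.range b)

/-- The exponent vector `(d_1, d_2, 0, …, 0)`. -/
def expVec (d1 d2 : ℕ) : Fin ℓ → ℕ := fun i =>
  if (i : ℕ) = 0 then d1 else if (i : ℕ) = 1 then d2 else 0

/-- The localization `A_X` of `A` at the lattice element `X = H ∩ L` corresponding,
via the identification `e` of `H` with `K^{ℓ-1}`, to the hyperplane of `H`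
with coefficient vector `c'`. -/
def locOnRestr (A : Arrangement K ℓ) (e : (Fin (ℓ - 1) → K) →ₗ[K] (Fin ℓ → K))
    (c' : Fin (ℓ - 1) → K) : Arrangement K ℓ where
  hyps := A.hyps.filter (fun c => ∃ t : K, restrictForm e c = t • c')
  ne_zero := fun c hc => A.ne_zero c (Finset.mem_filter.mp hc).1
  nonprop := fun c hc c'' hc'' =>
    A.nonprop c (Finset.mem_filter.mp hc).1 c'' (Finset.mem_filter.mp hc'').1

/-- The multiplicity `m - δ_H`. -/
def mdel (m : (Fin ℓ → K) → ℕ) (c0 : Fin ℓ → K) : (Fin ℓ → K) → ℕ :=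
  fun c => if c = c0 then m c - 1 else m c

/-- `ms` is the Euler multiplicity `m^*` on the restriction `B = A^H` (presented via the
identification `e`): for each `X ∈ A^H` the rank-two localization `(A_X, m_X)` is free
with exponents `(d_1^X, d_2^X, 0, …, 0)` ordered so that `(A_X, m_X - δ_H)` is free with
exponents `(d_1^X - 1, d_2^X, 0, …, 0)`, and `m^*(X) = d_2^X`. -/
def IsEulerMult (A : Arrangement K ℓ) (m : (Fin ℓ → K) → ℕ) (c0 : Fin ℓ → K)
    (e : (Fin (ℓ - 1) → K) →ₗ[K] (Fin ℓ → K)) (B : Arrangement K (ℓ - 1))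
    (ms : (Fin (ℓ - 1) → K) → ℕ) : Prop :=
  ∀ c' ∈ B.hyps, ∃ d1 d2 : ℕ,
    FreeWithExp (locOnRestr A e c') m (expVec d1 d2) ∧
    FreeWithExp (locOnRestr A e c') (mdel m c0) (expVec (d1 - 1) d2) ∧
    ms c' = d2

/-- An arrangement is generic if any `k ≤ ℓ-1` of its hyperplanes intersect in
codimension `k`, i.e. any `≤ ℓ-1` of its defining forms are linearly independent. -/
def GenericArr (A : Arrangement K ℓ) : Prop :=
  ∀ s : Finset (Fin ℓ → K), s ⊆ A.hyps → s.card ≤ ℓ - 1 →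
    LinearIndependent K (fun x : {c // c ∈ s} => (x : Fin ℓ → K))

/-- An arrangement is irreducible if it is not a product of two lower-dimensional
arrangements, i.e. its defining forms cannot be split into two complementary proper
subspaces of the dual space. -/
def IrreducibleArr (A : Arrangement K ℓ) : Prop :=
  ¬ ∃ U1 U2 : Submodule K (Fin ℓ → K), U1 ≠ ⊥ ∧ U2 ≠ ⊥ ∧ U1 ⊓ U2 = ⊥ ∧ U1 ⊔ U2 = ⊤ ∧
      ∀ c ∈ A.hyps, c ∈ U1 ∨ c ∈ U2

/-- The defining polynomial `Q(A,m) = ∏_{H ∈ A} α_H^{m(H)}`. -/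
def Qpoly (A : Arrangement K ℓ) (m : (Fin ℓ → K) → ℕ) : PS K ℓ :=
  ∏ c ∈ A.hyps, linP c ^ m c

section Homological

open CategoryTheory Abelian

variable {R : Type} [CommRing R]

/-- Projective dimension at most `n`, through vanishing of `Ext`. -/
def PD (R : Type) [CommRing R] (n : ℕ) (M : Type) [AddCommGroup M] [Module R M] : Prop :=
  HasProjectiveDimensionLE (ModuleCat.of R M) n

variable {M N M₁ M₂ M₃ : Type} [AddCommGroup M] [Module R M] [AddCommGroup N] [Module R N]
  [AddCommGroup M₁] [Module R M₁] [AddCommGroup M₂] [Module R M₂] [AddCommGroup M₃] [Module R M₃]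

/-- The short complex of modules attached to an exact pair of linear maps. -/
abbrev linComplex (f : M₁ →ₗ[R] M₂) (g : M₂ →ₗ[R] M₃) (h : Function.Exact f g) :
    ShortComplex (ModuleCat R) :=
  ShortComplex.mk (ModuleCat.ofHom f) (ModuleCat.ofHom g)
    (by ext x; exact h.apply_apply_eq_zero x)

theorem linComplex_shortExact {f : M₁ →ₗ[R] M₂} {g : M₂ →ₗ[R] M₃} (hf : Function.Injective f)
    (h : Function.Exact f g) (hg : Function.Surjective g) : (linComplex f g h).ShortExact where
  exact := (ShortComplex.ShortExact.moduleCat_exact_iff_function_exact _).mpr h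
  mono_f := (ModuleCat.mono_iff_injective _).mpr hf
  epi_g := (ModuleCat.epi_iff_surjective _).mpr hg

theorem PD.mono {n m : ℕ} (h : PD R n M) (hnm : n ≤ m) : PD R m M :=
  have : HasProjectiveDimensionLT (ModuleCat.of R M) (n + 1) := h
  hasProjectiveDimensionLT_of_ge _ (n + 1) (m + 1) (by omega)

theorem PD.of_equiv {n : ℕ} (h : PD R n M) (e : M ≃ₗ[R] N) : PD R n N :=
  have : HasProjectiveDimensionLT (ModuleCat.of R M) (n + 1) := h
  hasProjectiveDimensionLT_of_iso e.toModuleIso (n + 1)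

theorem PD_zero_iff : PD R 0 M ↔ Module.Projective R M := by
  rw [IsProjective.iff_projective]
  exact (projective_iff_hasProjectiveDimensionLE_zero _).symm

theorem PD.of_projective [Module.Projective R M] (n : ℕ) : PD R n M :=
  (PD_zero_iff.mpr inferInstance).mono (Nat.zero_le n)

theorem PD.right {f : M₁ →ₗ[R] M₂} {g : M₂ →ₗ[R] M₃} (hf : Function.Injective f)
    (h : Function.Exact f g) (hg : Function.Surjective g) {n : ℕ} (h₁ : PD R n M₁)
    (h₂ : PD R (n + 1) M₂) : PD R (n + 1) M₃ :=
  (linComplex_shortExact hf h hg).hasProjectiveDimensionLT_X₃ _ h₁ h₂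

theorem PD.left {f : M₁ →ₗ[R] M₂} {g : M₂ →ₗ[R] M₃} (hf : Function.Injective f)
    (h : Function.Exact f g) (hg : Function.Surjective g) {n : ℕ} (h₂ : PD R n M₂)
    (h₃ : PD R (n + 1) M₃) : PD R n M₁ :=
  (linComplex_shortExact hf h hg).hasProjectiveDimensionLT_X₁ _ h₂ h₃

theorem exact_subtype_ker (f : M →ₗ[R] N) :
    Function.Exact (LinearMap.ker f).subtype f := by
  intro x; simp

theorem pdLE_iff_PD {n : ℕ} : ∀ {M : Type} [AddCommGroup M] [Module R M],
    pdLE R n M ↔ PD R n M := by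
  induction n with
  | zero => intro M _ _; exact PD_zero_iff.symm
  | succ n ih =>
    intro M _ _
    constructor
    · rintro ⟨ι, f, hf, hk⟩
      exact PD.right (Submodule.subtype_injective _) (exact_subtype_ker f) hf (ih.mp hk)
        (PD.of_projective _)
    · intro h
      refine ⟨M, Finsupp.linearCombination R id, Finsupp.linearCombination_id_surjective R M,
        ih.mpr ?_⟩
      exact PD.left (Submodule.subtype_injective _) (exact_subtype_ker _)
        (Finsupp.linearCombination_id_surjective R M) (PD.of_projective _) h

/-- `Ext^i(N, M) = 0` for all `i < n`. -/
def ExtVanish (R : Type) [CommRing R] (N M : Type) [AddCommGroup N] [Module R N]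
    [AddCommGroup M] [Module R M] (n : ℕ) : Prop :=
  ∀ i < n, Subsingleton (Ext (ModuleCat.of R N) (ModuleCat.of R M) i)

theorem ExtVanish.mono {n m : ℕ} (h : ExtVanish R N M n) (hmn : m ≤ n) : ExtVanish R N M m :=
  fun i hi => h i (hi.trans_le hmn)

theorem ExtVanish.hom_eq_zero {n : ℕ} (h : ExtVanish R N M (n + 1)) (f : N →ₗ[R] M) : f = 0 := by
  have := h 0 (Nat.succ_pos _)
  have : Subsingleton (N →ₗ[R] M) :=
    (Ext.addEquiv₀.trans (ModuleCat.homAddEquiv (M := ModuleCat.of R N)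
      (N := ModuleCat.of R M))).symm.subsingleton
  exact Subsingleton.elim _ _

theorem ExtVanish.right {f : M₁ →ₗ[R] M₂} {g : M₂ →ₗ[R] M₃} (hf : Function.Injective f)
    (h : Function.Exact f g) (hg : Function.Surjective g) {n : ℕ}
    (h₁ : ExtVanish R N M₁ (n + 1)) (h₂ : ExtVanish R N M₂ n) : ExtVanish R N M₃ n := by
  intro i hi
  have := h₂ i hi
  have := h₁ (i + 1) (by omega)
  refine ⟨fun a b => ?_⟩
  have key : ∀ a : Ext (ModuleCat.of R N) (ModuleCat.of R M₃) i, a = 0 := by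
    intro a
    obtain ⟨x, rfl⟩ := Ext.covariant_sequence_exact₃ (ModuleCat.of R N)
      (linComplex_shortExact hf h hg) a rfl (Subsingleton.elim _ _)
    rw [Subsingleton.elim x 0, Ext.zero_comp]
  rw [key a, key b]

theorem ExtVanish.left {f : M₁ →ₗ[R] M₂} {g : M₂ →ₗ[R] M₃} (hf : Function.Injective f)
    (h : Function.Exact f g) (hg : Function.Surjective g) {n : ℕ}
    (h₂ : ExtVanish R N M₂ (n + 1)) (h₃ : ExtVanish R N M₃ n) : ExtVanish R N M₁ (n + 1) := by
  intro i hi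
  have := h₂ i hi
  refine ⟨fun a b => ?_⟩
  have key : ∀ a : Ext (ModuleCat.of R N) (ModuleCat.of R M₁) i, a = 0 := by
    intro a
    cases i with
    | zero =>
      have := (linComplex_shortExact hf h hg).mono_f
      exact Ext.postcomp_mk₀_injective_of_mono (ModuleCat.of R N) (linComplex f g h).f
        (Subsingleton.elim (α := Ext (ModuleCat.of R N) (ModuleCat.of R M₂) 0) _ _)
    | succ i =>
      have := h₃ i (by omega)
      obtain ⟨x, rfl⟩ := Ext.covariant_sequence_exact₁ (ModuleCat.of R N)
        (linComplex_shortExact hf h hg) a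
        (Subsingleton.elim (α := Ext (ModuleCat.of R N) (ModuleCat.of R M₂) (i + 1)) _ _) rfl
      rw [Subsingleton.elim x 0, Ext.zero_comp]
  rw [key a, key b]

open RingTheory.Sequence ModuleCat in
theorem extVanish_of_isWeaklyRegular {rs : List R} :
    ∀ {M : Type} [AddCommGroup M] [Module R M], (∀ r ∈ rs, ∀ x : N, r • x = 0) →
      IsWeaklyRegular M rs → ExtVanish R N M rs.length := by
  induction rs with
  | nil => intro M _ _ _ _ i hi; simp at hi
  | cons a rs ih =>
    intro M _ _ hann hreg i hi
    rw [isWeaklyRegular_cons_iff] at hreg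
    have ha : a ∈ Module.annihilator R N := by
      rw [Module.mem_annihilator]; exact hann a List.mem_cons_self
    match i with
    | 0 =>
      have : Subsingleton (N →ₗ[R] M) := by
        refine ⟨fun f g => LinearMap.ext fun x => hreg.1 ?_⟩
        simp only [← map_smul, hann a List.mem_cons_self x, map_zero]
      exact (Ext.addEquiv₀.trans ModuleCat.homAddEquiv).subsingleton
    | i + 1 =>
      have := ih (M := QuotSMulTop a M) (fun r hr => hann r (List.mem_cons_of_mem _ hr)) hreg.2 i
        (by simpa using hi)
      have mono_g : Mono (AddCommGrpCat.ofHom ((Ext.mk₀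
          (smulShortComplex (ModuleCat.of R M) a).f).postcomp (ModuleCat.of R N)
          (add_zero (i + 1)))) := by
        apply (Ext.covariant_sequence_exact₁' (ModuleCat.of R N)
          (IsSMulRegular.smulShortComplex_shortExact (M := ModuleCat.of R M) hreg.1) i (i + 1)
          rfl).mono_g
        exact (AddCommGrpCat.isZero_of_iff_subsingleton.mpr this).eq_zero_of_src _
      have zero_g := Ext.postcomp_smul_id_eq_zero_of_mem_annihilator
        (M := ModuleCat.of R M) (N := ModuleCat.of R N) ha (i + 1)
      rw [smulShortComplex_f_eq_smul_id] at mono_g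
      exact AddCommGrpCat.subsingleton_of_isZero
        (@Limits.IsZero.of_mono_eq_zero _ _ _ _ _ _ mono_g zero_g)

end Homological

section Homological

open CategoryTheory Abelian RingTheory.Sequence

variable {R : Type} [CommRing R]
variable {M N M₁ M₂ M₃ : Type} [AddCommGroup M] [Module R M] [AddCommGroup N] [Module R N]
  [AddCommGroup M₁] [Module R M₁] [AddCommGroup M₂] [Module R M₂] [AddCommGroup M₃] [Module R M₃]

theorem isWeaklyRegular_of_flat {rs : List R} (h : IsWeaklyRegular R rs) [Module.Flat R M] :
    IsWeaklyRegular M rs :=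
  ((TensorProduct.rid R M).isWeaklyRegular_congr rs).mp (h.isWeaklyRegular_lTensor)

theorem PD.extVanish {rs : List R} (hreg : IsWeaklyRegular R rs)
    (hann : ∀ r ∈ rs, ∀ x : N, r • x = 0) {d : ℕ} :
    ∀ {M : Type} [AddCommGroup M] [Module R M], PD R d M → ∀ {n : ℕ}, n + d ≤ rs.length →
      ExtVanish R N M n := by
  induction d with
  | zero =>
    intro M _ _ h n hn
    have := PD_zero_iff.mp h
    exact (extVanish_of_isWeaklyRegular hann (isWeaklyRegular_of_flat hreg)).mono (by omega)
  | succ d ih =>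
    intro M _ _ h n hn
    refine ExtVanish.right (Submodule.subtype_injective _) (exact_subtype_ker _)
      (Finsupp.linearCombination_id_surjective R M) (ih ?_ (by omega)) ?_
    · exact PD.left (Submodule.subtype_injective _) (exact_subtype_ker _)
        (Finsupp.linearCombination_id_surjective R M) (PD.of_projective _) h
    · exact (extVanish_of_isWeaklyRegular hann (isWeaklyRegular_of_flat hreg)).mono (by omega)

theorem smul_quotient_ofList_eq_zero (rs : List R) :
    ∀ r ∈ rs, ∀ x : R ⧸ Ideal.ofList rs, r • x = 0 := by
  intro r hr x
  obtain ⟨x, rfl⟩ := Ideal.Quotient.mk_surjective x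
  rw [Algebra.smul_def, Ideal.Quotient.algebraMap_eq, ← map_mul, Ideal.Quotient.eq_zero_iff_mem]
  exact Ideal.mul_mem_right _ _ (Ideal.subset_span hr)

theorem ExtVanish.eq_zero_of_smul_eq_zero {rs : List R}
    (h : ExtVanish R (R ⧸ Ideal.ofList rs) M 1) {x : M} (hx : ∀ r ∈ rs, r • x = 0) : x = 0 := by
  let f : (R ⧸ Ideal.ofList rs) →ₗ[R] M :=
    Submodule.liftQ (Ideal.ofList rs) (LinearMap.toSpanSingleton R M x) (by
      rw [Ideal.ofList, Ideal.span, Submodule.span_le]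
      intro r hr
      simpa using hx r hr)
  have hf := h.hom_eq_zero f
  have : f (Submodule.Quotient.mk 1) = 0 := by rw [hf]; rfl
  rwa [Submodule.liftQ_apply, LinearMap.toSpanSingleton_apply, one_smul] at this

theorem PD.eq_zero_of_smul_eq_zero {rs : List R} (hreg : IsWeaklyRegular R rs) {d : ℕ}
    (hM : PD R d M) (hd : d + 1 ≤ rs.length) {x : M} (hx : ∀ r ∈ rs, r • x = 0) : x = 0 :=
  (hM.extVanish hreg (smul_quotient_ofList_eq_zero rs) (n := 1)
    (by omega)).eq_zero_of_smul_eq_zero hx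

theorem exists_extend (Q : Submodule R M) (h : ExtVanish R (M ⧸ Q) N 2) (f : Q →ₗ[R] N) :
    ∃ F : M →ₗ[R] N, ∀ x : Q, F x = f x := by
  have hse := linComplex_shortExact (f := Q.subtype) (g := Q.mkQ) (Submodule.subtype_injective _)
    (by intro x; simp) (Submodule.mkQ_surjective _)
  have := h 1 (by norm_num)
  obtain ⟨x, hx⟩ := Ext.contravariant_sequence_exact₁ hse (ModuleCat.of R N)
    (Ext.mk₀ (ModuleCat.ofHom f)) (n₁ := 1) rfl
    (Subsingleton.elim (α := Ext (ModuleCat.of R (M ⧸ Q)) (ModuleCat.of R N) 1) _ _)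
  obtain ⟨F, rfl⟩ := Ext.homEquiv₀.symm.surjective x
  refine ⟨ModuleCat.Hom.hom F, fun x => ?_⟩
  have h2 : ModuleCat.ofHom Q.subtype ≫ F = ModuleCat.ofHom f :=
    Ext.homEquiv₀.symm.injective (by simpa using hx)
  exact congrArg (fun g => (ModuleCat.Hom.hom g) x) h2

theorem smul_quotient_eq_zero {rs : List R} {Q : Submodule R M}
    (h : ∀ r ∈ rs, ∀ x : M, r • x ∈ Q) : ∀ r ∈ rs, ∀ x : M ⧸ Q, r • x = 0 := by
  intro r hr x
  obtain ⟨x, rfl⟩ := Submodule.Quotient.mk_surjective _ x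
  rw [← Submodule.Quotient.mk_smul, Submodule.Quotient.mk_eq_zero]
  exact h r hr x

theorem ExtVanish.eq_top {rs : List R} {Q : Submodule R M} (h : ExtVanish R (M ⧸ Q) Q 2)
    (hQ : ∀ r ∈ rs, ∀ x : M, r • x ∈ Q) (htf : ∀ x : M, (∀ r ∈ rs, r • x = 0) → x = 0) :
    Q = ⊤ := by
  obtain ⟨F, hF⟩ := exists_extend Q h LinearMap.id
  rw [eq_top_iff]
  intro x _
  have : (F x : M) - x = 0 := by
    refine htf _ fun r hr => ?_
    have := congrArg Subtype.val (hF ⟨r • x, hQ r hr x⟩)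
    simp only [map_smul, LinearMap.id_coe, id_eq, SetLike.val_smul] at this
    rw [smul_sub, this, sub_self]
  rw [← sub_eq_zero.mp this]
  exact (F x).2

theorem PD.eq_top {rs : List R} (hreg : IsWeaklyRegular R rs) {Q : Submodule R M} {d : ℕ}
    (h : PD R d Q) (hd : d + 2 ≤ rs.length)
    (hQ : ∀ r ∈ rs, ∀ x : M, r • x ∈ Q) (htf : ∀ x : M, (∀ r ∈ rs, r • x = 0) → x = 0) :
    Q = ⊤ :=
  (h.extVanish hreg (smul_quotient_eq_zero hQ) (n := 2) (by omega)).eq_top hQ htf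

end Homological

section HilbertSyzygy

open TensorProduct

theorem PD.baseChange {R : Type} [CommRing R] (S : Type) [CommRing S] [Algebra R S]
    [Module.Flat R S] {d : ℕ} :
    ∀ {M : Type} [AddCommGroup M] [Module R M], PD R d M → PD S d (S ⊗[R] M) := by
  induction d with
  | zero =>
    intro M _ _ h
    have := PD_zero_iff.mp h
    exact PD.of_projective _
  | succ d ih =>
    intro M _ _ h
    have hs := Finsupp.linearCombination_id_surjective R M
    have hk := PD.left (Submodule.subtype_injective _) (exact_subtype_ker _) hs
      (PD.of_projective _) h
    refine PD.right
      (f := (LinearMap.ker (Finsupp.linearCombination R (id : M → M))).subtype.baseChange S)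
      (g := (Finsupp.linearCombination R (id : M → M)).baseChange S) ?_ ?_ ?_ (ih hk)
      (PD.of_projective _)
    · exact Module.Flat.lTensor_preserves_injective_linearMap _ (Submodule.subtype_injective _)
    · exact Module.Flat.lTensor_exact S (exact_subtype_ker _)
    · exact LinearMap.lTensor_surjective S hs

open scoped Polynomial in
theorem PD_polynomial {R : Type} [CommRing R] {d : ℕ}
    (H : ∀ (M : Type) [AddCommGroup M] [Module R M], PD R d M)
    (M : Type) [AddCommGroup M] [Module R[X] M] : PD R[X] (d + 1) M := by
  let _ : Module R M := Module.compHom M (algebraMap R R[X])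
  have : IsScalarTower R R[X] M := ⟨fun a p m => by
    rw [Algebra.smul_def, mul_smul]; rfl⟩
  let φ : R[X] ⊗[R] M →ₗ[R[X]] M := LinearMap.liftBaseChange R[X] LinearMap.id
  let xM : M →ₗ[R] M := (LinearMap.lsmul R[X] M Polynomial.X).restrictScalars R
  let δ : R[X] ⊗[R] M →ₗ[R[X]] R[X] ⊗[R] M :=
    LinearMap.lsmul R[X] _ Polynomial.X - xM.baseChange R[X]
  have hφ : ∀ (p : R[X]) (m : M), φ (p ⊗ₜ m) = p • m := fun p m => by simp [φ]
  have hδ : ∀ (p : R[X]) (m : M), δ (p ⊗ₜ m) =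
      ((Polynomial.X : R[X]) * p) ⊗ₜ m - p ⊗ₜ ((Polynomial.X : R[X]) • m) :=
    fun p m => by simp [δ, xM, TensorProduct.smul_tmul']
  let κ (n : ℕ) : R[X] ⊗[R] M →ₗ[R] M :=
    (TensorProduct.lid R M).toLinearMap ∘ₗ (Polynomial.lcoeff R n).rTensor M
  have hκ : ∀ (n : ℕ) (p : R[X]) (m : M), κ n (p ⊗ₜ m) = p.coeff n • m :=
    fun n p m => by simp [κ]
  have hκδ : ∀ (n : ℕ) (x : R[X] ⊗[R] M),
      κ (n + 1) (δ x) = κ n x - (Polynomial.X : R[X]) • κ (n + 1) x := by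
    intro n x
    induction x with
    | zero => simp
    | add x y hx hy => rw [map_add, map_add, hx, hy, map_add, map_add, smul_add]; abel
    | tmul p m =>
      rw [hδ, map_sub, hκ, hκ, hκ, hκ, Polynomial.coeff_X_mul, smul_comm]
  have hsum : ∀ x : R[X] ⊗[R] M, ∃ N₀, ∀ N ≥ N₀, κ N x = 0 ∧
      x = ∑ i ∈ Finset.range N, (Polynomial.X ^ i : R[X]) ⊗ₜ κ i x := by
    intro x
    induction x with
    | zero => exact ⟨0, fun N _ => by simp⟩
    | add x y hx hy =>
      obtain ⟨a, ha⟩ := hx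
      obtain ⟨b, hb⟩ := hy
      refine ⟨max a b, fun N hN => ?_⟩
      obtain ⟨h1, h2⟩ := ha N (le_trans (le_max_left _ _) hN)
      obtain ⟨h3, h4⟩ := hb N (le_trans (le_max_right _ _) hN)
      refine ⟨by rw [map_add, h1, h3, add_zero], ?_⟩
      simp only [map_add, TensorProduct.tmul_add, Finset.sum_add_distrib]
      rw [← h2, ← h4]
    | tmul p m =>
      refine ⟨p.natDegree + 1, fun N hN => ⟨?_, ?_⟩⟩
      · rw [hκ, Polynomial.coeff_eq_zero_of_natDegree_lt (by omega), zero_smul]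
      · conv_lhs => rw [p.as_sum_range' N (by omega), TensorProduct.sum_tmul]
        refine Finset.sum_congr rfl fun i _ => ?_
        rw [hκ, ← Polynomial.smul_X_eq_monomial, TensorProduct.smul_tmul]
  have hinj : Function.Injective δ := by
    rw [injective_iff_map_eq_zero]
    intro x hx
    have h1 : ∀ n, κ n x = (Polynomial.X : R[X]) • κ (n + 1) x := fun n => by
      rw [← sub_eq_zero, ← hκδ, hx, map_zero]
    obtain ⟨N, hN⟩ := hsum x
    have h2 : ∀ k ≤ N, κ (N - k) x = 0 := by
      intro k hk
      induction k with
      | zero => exact (hN N le_rfl).1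
      | succ k ih =>
        rw [h1, show N - (k + 1) + 1 = N - k by omega, ih (by omega), smul_zero]
    rw [(hN N le_rfl).2]
    refine Finset.sum_eq_zero fun i hi => ?_
    have := h2 (N - i) (by omega)
    rw [show N - (N - i) = i by have := Finset.mem_range.mp hi; omega] at this
    rw [this, TensorProduct.tmul_zero]
  have hφδ : ∀ x, φ (δ x) = 0 := by
    intro x
    induction x with
    | zero => simp
    | add x y hx hy => rw [map_add, map_add, hx, hy, add_zero]
    | tmul p m =>
      rw [hδ, map_sub, hφ, hφ, smul_smul, mul_comm, sub_self]
  have hrange : ∀ x, x - (1 : R[X]) ⊗ₜ φ x ∈ LinearMap.range δ := by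
    intro x
    induction x with
    | zero => simp
    | add x y hx hy =>
      rw [map_add, TensorProduct.tmul_add]
      convert add_mem hx hy using 1
      abel
    | tmul p m =>
      rw [hφ]
      induction p using Polynomial.induction_on' with
      | add p q hp hq =>
        rw [TensorProduct.add_tmul, add_smul, TensorProduct.tmul_add]
        convert add_mem hp hq using 1
        abel
      | monomial n a =>
        induction n with
        | zero =>
          convert zero_mem (LinearMap.range δ) using 1
          have h1 : (Polynomial.monomial 0 a : R[X]) = a • 1 := by
            rw [Polynomial.smul_eq_C_mul, mul_one, Polynomial.monomial_zero_left]
          rw [h1, smul_assoc, one_smul, TensorProduct.smul_tmul, sub_self]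
        | succ n ih =>
          have h1 : (Polynomial.monomial (n + 1) a : R[X]) =
              Polynomial.X * Polynomial.monomial n a := by
            rw [Polynomial.X_mul_monomial]
          have h2 := add_mem (Submodule.smul_mem _ (Polynomial.X : R[X]) ih)
            (LinearMap.mem_range_self δ ((1 : R[X]) ⊗ₜ ((Polynomial.monomial n a : R[X]) • m)))
          convert h2 using 1
          rw [hδ, h1, smul_sub, TensorProduct.smul_tmul', TensorProduct.smul_tmul', smul_eq_mul,
            smul_eq_mul, mul_smul]
          abel
  refine PD.right (f := δ) (g := φ) hinj ?_ ?_ (PD.baseChange R[X] (H M))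
    ((PD.baseChange R[X] (H M)).mono (Nat.le_succ d))
  · intro x
    constructor
    · intro hx
      have := hrange x
      rw [hx, TensorProduct.tmul_zero, sub_zero] at this
      exact this
    · rintro ⟨y, rfl⟩
      exact hφδ y
  · intro m
    exact ⟨1 ⊗ₜ m, by rw [hφ, one_smul]⟩

theorem PD_of_ringEquiv {R S : Type} [CommRing R] [CommRing S] (e : R ≃+* S) {d : ℕ}
    (H : ∀ (M : Type) [AddCommGroup M] [Module R M], PD R d M)
    (M : Type) [AddCommGroup M] [Module S M] : PD S d M := by
  let _ : Module R M := Module.compHom M e.toRingHom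
  let _ := RingHomInvPair.of_ringEquiv e
  let _ := RingHomInvPair.symm (RingHomClass.toRingHom e : R →+* S) (RingHomClass.toRingHom e.symm)
  have : CategoryTheory.HasProjectiveDimensionLE (ModuleCat.of R M) d := H M
  let e' : M ≃ₛₗ[RingHomClass.toRingHom e] M := { AddEquiv.refl M with map_smul' := fun _ _ => rfl }
  exact ModuleCat.hasProjectiveDimensionLE_of_semiLinearEquiv (M := ModuleCat.of R M)
    (N := ModuleCat.of S M) e e' d

theorem PD_mvPolynomial (m : ℕ) : ∀ (M : Type) [AddCommGroup M]
    [Module (MvPolynomial (Fin m) K) M], PD (MvPolynomial (Fin m) K) m M := by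
  induction m with
  | zero =>
    refine PD_of_ringEquiv (MvPolynomial.isEmptyRingEquiv K (Fin 0)).symm ?_
    intro M _ _
    exact PD.of_projective _
  | succ m ih =>
    refine PD_of_ringEquiv (MvPolynomial.finSuccEquiv K m).toRingEquiv.symm ?_
    intro M _ _
    exact PD_polynomial ih M

end HilbertSyzygy

section RegularSequences

open RingTheory.Sequence

theorem isWeaklyRegular_ringEquiv {R S : Type} [CommRing R] [CommRing S] (e : R ≃+* S)
    {rs : List R} (h : IsWeaklyRegular R rs) : IsWeaklyRegular S (rs.map e) := by
  refine (e.toAddEquiv.isWeaklyRegular_congr ?_).mp h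
  rw [List.forall₂_map_right_iff, List.forall₂_same]
  intro r _ x
  simp

open scoped Polynomial in
theorem isWeaklyRegular_polynomial_cons {R : Type} [CommRing R] {F : R[X]} (hF : F.Monic)
    {rs : List R} (h : IsWeaklyRegular R rs) :
    IsWeaklyRegular R[X] (F :: rs.map Polynomial.C) := by
  rw [isWeaklyRegular_cons_iff]
  constructor
  · exact fun a b hab => hF.isRegular.left hab
  · have e : QuotSMulTop F R[X] ≃ₗ[R[X]] R[X] ⧸ Ideal.span {F} :=
      (QuotSMulTop.equivQuotTensor F R[X]).trans (TensorProduct.rid _ _)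
    have := hF.free_quotient
    have : Module.Flat R (QuotSMulTop F R[X]) :=
      Module.Flat.of_linearEquiv (e.restrictScalars R)
    exact (isWeaklyRegular_map_algebraMap_iff R[X] _ rs).mpr (isWeaklyRegular_of_flat h)

open scoped Polynomial in
theorem isWeaklyRegular_monic {R : Type} [CommRing R] (n : ℕ) (f : Fin n → R[X])
    (hf : ∀ i, (f i).Monic) :
    IsWeaklyRegular (MvPolynomial (Fin n) R)
      (List.ofFn fun i => Polynomial.aeval (X i : MvPolynomial (Fin n) R) (f i)) := by
  induction n with
  | zero => simp
  | succ n ih =>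
    have h1 := isWeaklyRegular_polynomial_cons (F := (f 0).map (MvPolynomial.C (σ := Fin n)))
      ((hf 0).map _) (ih (fun i => f i.succ) fun i => hf _)
    have h2 := isWeaklyRegular_ringEquiv (MvPolynomial.finSuccEquiv R n).symm.toRingEquiv h1
    rw [List.ofFn_succ]
    refine cast (congrArg _ (Eq.symm ?_)) h2
    rw [List.map_cons, List.map_map, List.map_ofFn]
    congr 1
    · change _ = (MvPolynomial.finSuccEquiv R n).symm _
      rw [AlgEquiv.eq_symm_apply, ← Polynomial.aeval_algHom_apply, MvPolynomial.finSuccEquiv_X_zero,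
        Polynomial.aeval_def]
      rfl
    · congr 1
      funext i
      change _ = (MvPolynomial.finSuccEquiv R n).symm _
      rw [AlgEquiv.eq_symm_apply, ← Polynomial.aeval_algHom_apply, MvPolynomial.finSuccEquiv_X_succ]
      exact Polynomial.aeval_algebraMap_apply _ (X i : MvPolynomial (Fin n) R) _

open scoped Polynomial in
theorem isWeaklyRegular_monic_two (n : ℕ) (f : Fin n → K[X][X]) (hf : ∀ i, (f i).Monic) :
    IsWeaklyRegular (MvPolynomial (Fin (n + 1)) K) (List.ofFn fun i => Polynomial.eval₂
      (Polynomial.aeval (X 0 : MvPolynomial (Fin (n + 1)) K)).toRingHom (X i.succ) (f i)) := by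
  let E : MvPolynomial (Fin (n + 1)) K ≃ₐ[K] MvPolynomial (Fin n) K[X] :=
    (MvPolynomial.renameEquiv K (finSuccEquiv n)).trans (MvPolynomial.optionEquivRight K (Fin n))
  have h2 := isWeaklyRegular_ringEquiv E.symm.toRingEquiv (isWeaklyRegular_monic n f hf)
  refine cast (congrArg _ (Eq.symm ?_)) h2
  rw [List.map_ofFn]
  congr 1
  funext i
  change _ = E.symm _
  rw [AlgEquiv.eq_symm_apply]
  change E.toRingEquiv.toRingHom _ = _
  rw [Polynomial.hom_eval₂]
  simp only [Polynomial.aeval_def]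
  congr 1
  · refine Polynomial.ringHom_ext ?_ ?_
    · intro a
      simp [E]
    · simp [E]
  · simp [E]

end RegularSequences

section Copresentation

variable {S : Type} [CommRing S] {M : Type} [AddCommGroup M] [Module S M]

theorem exists_dual_pi_of_span {n : ℕ} {V : Type} [AddCommGroup V] [Module S V]
    {s : Fin n → Module.Dual S V} {φ : Module.Dual S V}
    (h : φ ∈ Submodule.span S (Set.range s)) :
    ∃ ψ : Module.Dual S (Fin n → S), ∀ v, ψ (LinearMap.pi s v) = φ v := by
  obtain ⟨c, hc⟩ := (Submodule.mem_span_range_iff_exists_fun S).mp h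
  refine ⟨∑ j, c j • LinearMap.proj j, fun v => ?_⟩
  rw [← hc]
  simp

theorem exists_copresentation [IsNoetherianRing S] [Module.Finite S M] [Module.IsReflexive S M] :
    ∃ (a b : ℕ) (i : M →ₗ[S] (Fin a → S)) (δ : (Fin a → S) →ₗ[S] (Fin b → S)),
      Function.Injective i ∧ LinearMap.range i = LinearMap.ker δ ∧
      (∀ φ : Module.Dual S M, ∃ ψ : Module.Dual S (Fin a → S), ∀ m, ψ (i m) = φ m) ∧
      (∀ φ : Module.Dual S (Fin a → S), (∀ m, φ (i m) = 0) →
        ∃ ψ : Module.Dual S (Fin b → S), ∀ u, ψ (δ u) = φ u) := by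
  obtain ⟨a, s, hs⟩ := Module.Finite.exists_fin (R := S) (M := Module.Dual S M)
  let i : M →ₗ[S] (Fin a → S) := LinearMap.pi s
  have hext : ∀ φ : Module.Dual S M, ∃ ψ : Module.Dual S (Fin a → S), ∀ m, ψ (i m) = φ m :=
    fun φ => exists_dual_pi_of_span (by rw [hs]; trivial)
  let W : Submodule S (Module.Dual S (Fin a → S)) := LinearMap.ker (Module.Dual.transpose i)
  obtain ⟨b, t, ht⟩ := Submodule.fg_iff_exists_fin_generating_family.mp (IsNoetherian.noetherian W)
  have hW : ∀ φ, φ ∈ W ↔ ∀ m, φ (i m) = 0 := fun φ => by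
    rw [LinearMap.mem_ker, LinearMap.ext_iff]; rfl
  let δ : (Fin a → S) →ₗ[S] (Fin b → S) := LinearMap.pi t
  have hδ : ∀ φ : Module.Dual S (Fin a → S), (∀ m, φ (i m) = 0) →
      ∃ ψ : Module.Dual S (Fin b → S), ∀ u, ψ (δ u) = φ u :=
    fun φ hφ => exists_dual_pi_of_span (by rw [ht]; exact (hW φ).mpr hφ)
  refine ⟨a, b, i, δ, ?_, ?_, hext, hδ⟩
  · rw [injective_iff_map_eq_zero]
    intro m hm
    refine (Module.bijective_dual_eval S M).1 ?_
    ext φ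
    obtain ⟨ψ, hψ⟩ := hext φ
    rw [Module.Dual.eval_apply, ← hψ, hm, map_zero, map_zero, LinearMap.zero_apply]
  · ext u
    constructor
    · rintro ⟨m, rfl⟩
      rw [LinearMap.mem_ker]
      funext k
      exact (hW (t k)).mp (by rw [← ht]; exact Submodule.subset_span ⟨k, rfl⟩) m
    · intro hu
      rw [LinearMap.mem_ker] at hu
      have hsurj : Function.Surjective (Module.Dual.transpose (R := S) i) := fun φ => by
        obtain ⟨ψ, hψ⟩ := hext φ
        exact ⟨ψ, LinearMap.ext hψ⟩
      let E : Module.Dual S (Module.Dual S M) :=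
        (W.liftQ (Module.Dual.eval S _ u) (by
          intro φ hφ
          obtain ⟨ψ, hψ⟩ := hδ φ ((hW φ).mp hφ)
          rw [LinearMap.mem_ker, Module.Dual.eval_apply, ← hψ, hu, map_zero])) ∘ₗ
          ((Module.Dual.transpose (R := S) i).quotKerEquivOfSurjective hsurj).symm.toLinearMap
      have hE : ∀ ψ : Module.Dual S (Fin a → S), E (Module.Dual.transpose (R := S) i ψ) = ψ u := by
        intro ψ
        simp only [E, LinearMap.comp_apply, LinearEquiv.coe_coe]
        rw [LinearMap.quotKerEquivOfSurjective_symm_apply]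
        rfl
      obtain ⟨m, hm⟩ := (Module.bijective_dual_eval S M).2 E
      refine ⟨m, funext fun j => ?_⟩
      have := hE (LinearMap.proj j)
      rw [← hm] at this
      exact this

theorem exists_lift_smul {a b r : ℕ} {i : M →ₗ[S] (Fin a → S)}
    {δ : (Fin a → S) →ₗ[S] (Fin b → S)} (hi : LinearMap.range i = LinearMap.ker δ)
    (hext : ∀ φ : Module.Dual S M, ∃ ψ : Module.Dual S (Fin a → S), ∀ m, ψ (i m) = φ m)
    (hδ : ∀ φ : Module.Dual S (Fin a → S), (∀ m, φ (i m) = 0) →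
        ∃ ψ : Module.Dual S (Fin b → S), ∀ u, ψ (δ u) = φ u)
    {h : S} (f : M →ₗ[S] (Fin r → S)) (g : (Fin r → S) →ₗ[S] M) (hgf : ∀ m, g (f m) = h • m) :
    ∃ τ : (Fin b → S) →ₗ[S] (Fin a → S), ∀ u, δ (τ (δ u)) = h • δ u := by
  choose F hF using fun k => hext (LinearMap.proj k ∘ₗ f)
  let ε : (Fin a → S) →ₗ[S] (Fin a → S) := i ∘ₗ g ∘ₗ LinearMap.pi F
  have hε : ∀ m, ε (i m) = h • i m := fun m => by
    have : LinearMap.pi F (i m) = f m := funext fun k => hF k m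
    simp [ε, this, hgf]
  have hδε : ∀ u, δ (ε u) = 0 := fun u => by
    rw [← LinearMap.mem_ker, ← hi]
    exact ⟨_, rfl⟩
  choose T hT using fun k => hδ (LinearMap.proj k ∘ₗ (h • LinearMap.id - ε))
    (fun m => by simp [hε])
  refine ⟨LinearMap.pi T, fun u => ?_⟩
  have : LinearMap.pi T (δ u) = h • u - ε u := funext fun k => hT k u
  rw [this, map_sub, map_smul, hδε, sub_zero]

end Copresentation

open RingTheory.Sequence in
theorem exists_extension_onto_ker {R : Type} [CommRing R] {N : Type} [AddCommGroup N] [Module R N]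
    {a b : ℕ} (d : (Fin a → R) →ₗ[R] (Fin b → R)) {rs : List R} (hreg : IsWeaklyRegular R rs)
    (hlen : 4 ≤ rs.length) (hN : PD R 1 N) (N₁ : Submodule R N) (j : N₁ →ₗ[R] (Fin a → R))
    (hj : Function.Injective j) (hjd : ∀ x, d (j x) = 0)
    (hker : ∀ r ∈ rs, ∀ u, d u = 0 → ∃ x, j x = r • u) (hN₁ : ∀ r ∈ rs, ∀ ν : N, r • ν ∈ N₁) :
    ∃ Θ : N →ₗ[R] (Fin a → R), Function.Injective Θ ∧ LinearMap.range Θ = LinearMap.ker d ∧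
      (∀ x : N₁, Θ x = j x) ∧
      ∀ t, (∀ r ∈ rs, r • t ∈ LinearMap.range d) → t ∈ LinearMap.range d := by
  have hexact : Function.Exact (LinearMap.ker d).subtype d.rangeRestrict := by
    intro u
    constructor
    · intro hu
      exact ⟨⟨u, congrArg Subtype.val hu⟩, rfl⟩
    · rintro ⟨x, rfl⟩
      exact Subtype.ext x.2
  have hV : ExtVanish R (N ⧸ N₁) (LinearMap.ker d) 2 := by
    have hquot := smul_quotient_eq_zero hN₁
    have hfree : ∀ k, ExtVanish R (N ⧸ N₁) (Fin k → R) 4 := fun k =>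
      (PD.of_projective (R := R) (M := Fin k → R) 0).extVanish hreg hquot (by omega)
    have h1 : ExtVanish R (N ⧸ N₁) (LinearMap.range d) 1 :=
      ExtVanish.left (LinearMap.range d).subtype_injective
        (by intro x; simp) (LinearMap.range d).mkQ_surjective ((hfree b).mono (by omega))
        (fun i hi => absurd hi (by omega))
    exact ExtVanish.left (LinearMap.ker d).subtype_injective hexact
      (LinearMap.surjective_rangeRestrict _) ((hfree a).mono (by omega)) h1
  obtain ⟨F, hF⟩ := exists_extend N₁ hV (j.codRestrict (LinearMap.ker d) hjd)
  have hFj : ∀ x : N₁, (F x : Fin a → R) = j x := fun x => by rw [hF]; rfl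
  have hinj : Function.Injective F := by
    rw [injective_iff_map_eq_zero]
    intro ν hν
    refine hN.eq_zero_of_smul_eq_zero hreg (by omega) fun r hr => ?_
    have : j ⟨r • ν, hN₁ r hr ν⟩ = 0 := by
      rw [← hFj]
      simp [hν]
    exact congrArg Subtype.val (hj (this.trans (map_zero j).symm))
  let e : N ≃ₗ[R] LinearMap.range F := LinearEquiv.ofInjective F hinj
  have htop : LinearMap.range F = ⊤ := by
    refine (hN.of_equiv e).eq_top hreg (by omega) (fun r hr u => ?_) fun u hu => ?_
    · obtain ⟨x, hx⟩ := hker r hr u u.2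
      exact ⟨x, Subtype.ext ((hFj x).trans hx)⟩
    · refine Subtype.ext ((PD.of_projective (R := R) (M := Fin a → R) 0).eq_zero_of_smul_eq_zero
        hreg (by omega) fun r hr => congrArg Subtype.val (hu r hr))
  have hk : PD R 1 (LinearMap.ker d) :=
    hN.of_equiv (e.trans (LinearEquiv.ofTop _ htop))
  have hr : PD R 2 (LinearMap.range d) :=
    PD.right (LinearMap.ker d).subtype_injective hexact
      (LinearMap.surjective_rangeRestrict _) hk (PD.of_projective 2)
  have hq : PD R 3 ((Fin b → R) ⧸ LinearMap.range d) :=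
    PD.right (LinearMap.range d).subtype_injective (by intro x; simp)
      (LinearMap.range d).mkQ_surjective hr (PD.of_projective 3)
  refine ⟨(LinearMap.ker d).subtype ∘ₗ F, (LinearMap.ker d).subtype_injective.comp hinj, ?_, hFj,
    fun t ht => ?_⟩
  · rw [LinearMap.range_comp, htop, Submodule.map_subtype_top]
  · rw [← Submodule.Quotient.mk_eq_zero]
    refine hq.eq_zero_of_smul_eq_zero hreg (by omega) fun r hr => ?_
    rw [← Submodule.Quotient.mk_smul, Submodule.Quotient.mk_eq_zero]
    exact ht r hr

theorem mem_range_of_forall_exists_smul {S : Type} [CommRing S] [IsNoetherianRing S] {F : Type}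
    [AddCommGroup F] [Module S F] [Module.Finite S F] (I : Submodule S F) (z : S)
    (h : ∀ t : F, (∃ k : ℕ, z ^ k • t ∈ I) → ∃ u ∈ I, ∃ t', t = u + z • t') {t : F}
    (ht : z • t ∈ I) : t ∈ I := by
  let T : Submodule S F :=
    { carrier := {t | ∃ k : ℕ, z ^ k • t ∈ I}
      zero_mem' := ⟨0, by simp⟩
      add_mem' := by
        rintro x y ⟨k, hk⟩ ⟨l, hl⟩
        refine ⟨k + l, ?_⟩
        rw [smul_add]
        refine I.add_mem ?_ ?_
        · rw [add_comm, pow_add, mul_smul]; exact I.smul_mem _ hk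
        · rw [pow_add, mul_smul]; exact I.smul_mem _ hl
      smul_mem' := by
        rintro c x ⟨k, hk⟩
        exact ⟨k, by rw [smul_comm]; exact I.smul_mem _ hk⟩ }
  have hstep : ∀ k : ℕ, ∀ t ∈ T, ∃ u ∈ I, ∃ t' ∈ T, t = u + z ^ k • t' := by
    intro k
    induction k with
    | zero => exact fun t ht => ⟨0, I.zero_mem, t, ht, by simp⟩
    | succ k ih =>
      intro t ht
      obtain ⟨u, hu, t', ht', rfl⟩ := ih t ht
      obtain ⟨u', hu', t'', rfl⟩ := h t' ht'
      obtain ⟨k', hk'⟩ := ht'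
      refine ⟨u + z ^ k • u', I.add_mem hu (I.smul_mem _ hu'), t'', ⟨k' + 1, ?_⟩, ?_⟩
      · rw [smul_add] at hk'
        rw [pow_succ, mul_smul]
        simpa using I.sub_mem hk' (I.smul_mem (z ^ k') hu')
      · rw [smul_add, ← mul_smul, ← pow_succ, add_assoc]
  obtain ⟨m, s, hs⟩ := Submodule.fg_iff_exists_fin_generating_family.mp (IsNoetherian.noetherian T)
  have hsT : ∀ j, s j ∈ T := fun j => hs ▸ Submodule.subset_span ⟨j, rfl⟩
  choose e he using hsT
  have hpow : ∀ t ∈ T, z ^ (∑ j, e j) • t ∈ I := by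
    intro t ht
    rw [← hs] at ht
    induction ht using Submodule.span_induction with
    | mem x hx =>
      obtain ⟨j, rfl⟩ := hx
      have : e j ≤ ∑ j, e j := Finset.single_le_sum (fun _ _ => Nat.zero_le _) (Finset.mem_univ j)
      obtain ⟨d, hd⟩ := Nat.exists_eq_add_of_le this
      rw [hd, add_comm, pow_add, mul_smul]
      exact I.smul_mem _ (he j)
    | zero => simp
    | add x y _ _ hx hy => rw [smul_add]; exact I.add_mem hx hy
    | smul c x _ hx => rw [smul_comm]; exact I.smul_mem _ hx
  obtain ⟨u, hu, t', ht', rfl⟩ := hstep (∑ j, e j) t ⟨1, by simpa using ht⟩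
  exact I.add_mem hu (hpow t' ht')

open RingTheory.Sequence in
theorem surjective_of_depth {S Sb : Type} [CommRing S] [IsDomain S] [IsNoetherianRing S]
    [CommRing Sb] (σ : S →+* Sb) (hσ : Function.Surjective σ) (z : S) (hz : z ≠ 0)
    (hzσ : ∀ x, σ x = 0 ↔ z ∣ x)
    {M : Type} [AddCommGroup M] [Module S M] [Module.Finite S M] [Module.IsReflexive S M]
    {N : Type} [AddCommGroup N] [Module Sb N] (hN : PD Sb 1 N)
    (ρ : M →ₛₗ[σ] N) (hρ : ∀ m, ρ m = 0 → ∃ m', m = z • m')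
    {rs : List S} (hreg : IsWeaklyRegular Sb (rs.map σ)) (hlen : 4 ≤ rs.length)
    (hcoker : ∀ r ∈ rs, ∀ ν : N, ∃ m, ρ m = σ r • ν)
    (hfac : ∀ r ∈ rs, ∃ (k : ℕ) (f : M →ₗ[S] (Fin k → S)) (g : (Fin k → S) →ₗ[S] M),
      ∀ m, g (f m) = r • m) :
    Function.Surjective ρ := by
  have : RingHomSurjective σ := ⟨hσ⟩
  obtain ⟨a, b, i, δ, hi, hiδ, hext, hδ⟩ := exists_copresentation (S := S) (M := M)
  let red : ∀ k, (Fin k → S) →ₛₗ[σ] (Fin k → Sb) := fun k =>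
    { toFun := fun u j => σ (u j)
      map_add' := fun u v => by ext; simp
      map_smul' := fun c v => by ext; simp }
  have hred_surj : ∀ k, Function.Surjective (red k) := fun k v => by
    choose u hu using fun j => hσ (v j)
    exact ⟨u, funext hu⟩
  have hred_zero : ∀ k u, red k u = 0 → ∃ u', u = z • u' := fun k u hu => by
    choose u' hu' using fun j => (hzσ (u j)).mp (congrFun hu j)
    exact ⟨u', funext hu'⟩
  have hσz : σ z = 0 := (hzσ z).mpr dvd_rfl
  let d : (Fin a → Sb) →ₗ[Sb] (Fin b → Sb) := Matrix.mulVecLin ((LinearMap.toMatrix' δ).map σ)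
  have hd : ∀ u, d (red a u) = red b (δ u) := fun u => by
    funext k
    have := RingHom.map_mulVec σ (LinearMap.toMatrix' δ) u k
    rw [LinearMap.toMatrix'_mulVec] at this
    exact this.symm
  have hcancel : ∀ k (u v : Fin k → S), z • u = z • v → u = v := fun k u v h => by
    funext j
    exact mul_left_cancel₀ hz (congrFun h j)
  have hik : ∀ m, δ (i m) = 0 := fun m => by
    rw [← LinearMap.mem_ker, ← hiδ]; exact ⟨m, rfl⟩
  have hki : ∀ u, δ u = 0 → ∃ m, i m = u := fun u hu => by
    rw [← LinearMap.mem_ker, ← hiδ] at hu; exact hu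
  have hρz : ∀ m, ρ (z • m) = 0 := fun m => by rw [map_smulₛₗ, hσz, zero_smul]
  let q : M →ₛₗ[σ] (Fin a → Sb) := (red a).comp i
  have hker_le : ∀ m, ρ m = 0 ↔ q m = 0 := by
    intro m
    constructor
    · intro h
      obtain ⟨m', rfl⟩ := hρ m h
      rw [map_smulₛₗ, hσz, zero_smul]
    · intro h
      obtain ⟨u, hu⟩ := hred_zero _ _ h
      have : δ u = 0 := hcancel _ _ _ (by rw [← map_smul, ← hu, hik, smul_zero])
      obtain ⟨m', rfl⟩ := hki u this
      rw [← map_smul] at hu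
      rw [hi hu, hρz]
  have hqd : ∀ m m', ρ m = ρ m' → q m = q m' := fun m m' h => by
    rw [← sub_eq_zero, ← map_sub, ← hker_le, map_sub, h, sub_self]
  let N₁ : Submodule Sb N := LinearMap.range ρ
  choose pre hpre using fun x : N₁ => LinearMap.mem_range.mp x.2
  let j : N₁ →ₗ[Sb] (Fin a → Sb) :=
    { toFun := fun x => q (pre x)
      map_add' := fun x y => by
        rw [← map_add]
        exact hqd _ _ (by rw [map_add, hpre, hpre, hpre]; rfl)
      map_smul' := fun c x => by
        obtain ⟨c, rfl⟩ := hσ c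
        rw [RingHom.id_apply, ← map_smulₛₗ]
        exact hqd _ _ (by rw [map_smulₛₗ, hpre, hpre]; rfl) }
  have hjρ : ∀ m, j ⟨ρ m, m, rfl⟩ = q m := fun m => hqd _ _ (hpre _)
  have hlift : ∀ r ∈ rs, ∃ τ : (Fin b → S) →ₗ[S] (Fin a → S), ∀ u, δ (τ (δ u)) = r • δ u :=
    fun r hr => by
      obtain ⟨k, f, g, hfg⟩ := hfac r hr
      exact exists_lift_smul hiδ hext hδ f g hfg
  have hsat : ∀ r ∈ rs, ∃ τ : (Fin b → S) →ₗ[S] (Fin a → S),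
      ∀ t (k : ℕ), z ^ k • t ∈ LinearMap.range δ → δ (τ t) = r • t := fun r hr => by
    obtain ⟨τ, hτ⟩ := hlift r hr
    refine ⟨τ, fun t k ht => ?_⟩
    obtain ⟨u, hu⟩ := ht
    have h := hτ u
    rw [hu, map_smul, map_smul, smul_comm] at h
    funext l
    exact mul_left_cancel₀ (pow_ne_zero k hz) (congrFun h l)
  obtain ⟨Θ, hΘ, hΘr, hΘj, hΘt⟩ := exists_extension_onto_ker d hreg (by simpa using hlen) hN N₁ j
    (by
      rw [injective_iff_map_eq_zero]
      intro x hx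
      refine Subtype.ext ?_
      rw [← hpre x]
      exact (hker_le _).mpr hx)
    (fun x => by
      change d (red a (i (pre x))) = 0
      rw [hd, hik, map_zero])
    (by
      intro r hr u hu
      obtain ⟨r, hr', rfl⟩ := List.mem_map.mp hr
      obtain ⟨u, rfl⟩ := hred_surj _ u
      rw [hd] at hu
      obtain ⟨t, ht⟩ := hred_zero _ _ hu
      obtain ⟨τ, hτ⟩ := hsat r hr'
      have h1 := hτ t 1 ⟨u, by rw [ht, pow_one]⟩
      obtain ⟨m, hm⟩ := hki (r • u - z • τ t) (by
        rw [map_sub, map_smul, map_smul, h1, ht, smul_comm, sub_self])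
      refine ⟨⟨ρ m, m, rfl⟩, ?_⟩
      rw [hjρ]
      change red a (i m) = _
      rw [hm, map_sub, map_smulₛₗ, map_smulₛₗ, hσz, zero_smul, sub_zero])
    (by
      intro r hr ν
      obtain ⟨r, hr', rfl⟩ := List.mem_map.mp hr
      exact hcoker r hr' ν)
  have hzsat : ∀ t, z • t ∈ LinearMap.range δ → t ∈ LinearMap.range δ := by
    intro t ht
    refine mem_range_of_forall_exists_smul (LinearMap.range δ) z (fun t ⟨k, hk⟩ => ?_) ht
    obtain ⟨u, hu⟩ := hΘt (red b t) (fun r hr => by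
      obtain ⟨r, hr', rfl⟩ := List.mem_map.mp hr
      obtain ⟨τ, hτ⟩ := hsat r hr'
      exact ⟨red a (τ t), by rw [hd, hτ t k hk, map_smulₛₗ]⟩)
    obtain ⟨u, rfl⟩ := hred_surj _ u
    rw [hd] at hu
    obtain ⟨t', ht'⟩ := hred_zero _ (t - δ u) (by rw [map_sub, hu, sub_self])
    exact ⟨δ u, ⟨u, rfl⟩, t', by rw [← ht']; abel⟩
  intro ν
  have hν : d (Θ ν) = 0 := by
    rw [← LinearMap.mem_ker, ← hΘr]; exact ⟨ν, rfl⟩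
  obtain ⟨u, hu⟩ := hred_surj _ (Θ ν)
  rw [← hu, hd] at hν
  obtain ⟨t, ht⟩ := hred_zero _ _ hν
  obtain ⟨w, rfl⟩ := hzsat t ⟨u, ht⟩
  obtain ⟨m, hm⟩ := hki (u - z • w) (by rw [map_sub, map_smul, ht, sub_self])
  refine ⟨m, hΘ ?_⟩
  have h1 := hΘj ⟨ρ m, m, rfl⟩
  rw [hjρ] at h1
  rw [h1, ← hu]
  change red a (i m) = _
  rw [hm, map_sub, map_smulₛₗ, hσz, zero_smul, sub_zero]

section Graded

attribute [local instance] MvPolynomial.gradedAlgebra in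
theorem homogeneousComponent_mul_isHomogeneous {σ : Type} (a g : MvPolynomial σ K) {q : ℕ}
    (hg : g.IsHomogeneous q) (m : ℕ) :
    homogeneousComponent m (a * g) = if q ≤ m then homogeneousComponent (m - q) a * g else 0 := by
  have h := DirectSum.coe_decompose_mul_of_right_mem (homogeneousSubmodule σ K) (a := a) m
    ((mem_homogeneousSubmodule q g).mpr hg)
  rw [← decomposition.decompose'_apply, ← decomposition.decompose'_apply]
  exact h

variable {r : ℕ} (w : Fin r → ℕ)

/-- The degree `e` component of a vector of polynomials, where the `i`-th standard basis vector
has degree `w i`. -/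
def vecComponent (e : ℕ) : (Fin r → PS K ℓ) →+ (Fin r → PS K ℓ) where
  toFun a i := if w i ≤ e then homogeneousComponent (e - w i) (a i) else 0
  map_zero' := by ext i; simp
  map_add' a b := by
    funext i
    simp only [Pi.add_apply]
    split_ifs <;> simp

theorem vecComponent_apply (e : ℕ) (a : Fin r → PS K ℓ) (i : Fin r) :
    vecComponent w e a i = if w i ≤ e then homogeneousComponent (e - w i) (a i) else 0 := rfl

theorem vecComponent_idem (e : ℕ) (a : Fin r → PS K ℓ) :
    vecComponent w e (vecComponent w e a) = vecComponent w e a := by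
  funext i
  simp only [vecComponent_apply]
  split_ifs
  · exact homogeneousComponent_eq_self (homogeneousComponent_isHomogeneous _ _)
  · rfl

theorem exists_sum_vecComponent (a : Fin r → PS K ℓ) :
    ∃ D, a = ∑ e ∈ Finset.range D, vecComponent w e a := by
  refine ⟨∑ i, (w i + (a i).totalDegree + 1), funext fun i => ?_⟩
  rw [Finset.sum_apply]
  simp only [vecComponent_apply]
  rw [← Finset.sum_filter]
  conv_lhs => rw [← sum_homogeneousComponent (a i)]
  have hle : w i + (a i).totalDegree + 1 ≤ ∑ i, (w i + (a i).totalDegree + 1) :=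
    Finset.single_le_sum (f := fun i => w i + (a i).totalDegree + 1)
      (fun _ _ => Nat.zero_le _) (Finset.mem_univ i)
  refine Finset.sum_of_injOn (fun d => d + w i) (fun x _ y _ h => by simpa using h) ?_ ?_ ?_
  · intro d hd
    simp only [Finset.coe_range, Set.mem_Iio, Finset.coe_filter, Finset.mem_range,
      Set.mem_ofPred_eq] at hd ⊢
    omega
  · intro e he hne
    simp only [Finset.mem_filter, Finset.mem_range, Finset.coe_range, Set.mem_image,
      Set.mem_Iio, not_exists, not_and] at he hne
    refine homogeneousComponent_eq_zero _ _ ?_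
    by_contra hlt
    exact hne (e - w i) (by omega) (by omega)
  · intro d _
    simp

theorem vecComponent_smul (e f : ℕ) (a : PS K ℓ) {g : Fin r → PS K ℓ}
    (hg : vecComponent w f g = g) :
    vecComponent w e (a • g) = if f ≤ e then homogeneousComponent (e - f) a • g else 0 := by
  funext i
  rw [vecComponent_apply]
  have hgi := congrFun hg i
  rw [vecComponent_apply] at hgi
  by_cases hwf : w i ≤ f
  · rw [if_pos hwf] at hgi
    have hh : (g i).IsHomogeneous (f - w i) := hgi ▸ homogeneousComponent_isHomogeneous _ _
    by_cases hfe : f ≤ e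
    · rw [if_pos hfe, if_pos (by omega), Pi.smul_apply, smul_eq_mul,
        homogeneousComponent_mul_isHomogeneous _ _ hh, if_pos (by omega),
        show e - w i - (f - w i) = e - f by omega]
      rfl
    · rw [if_neg hfe]
      split_ifs with h
      · rw [Pi.smul_apply, smul_eq_mul, homogeneousComponent_mul_isHomogeneous _ _ hh,
          if_neg (by omega)]
        rfl
      · rfl
  · rw [if_neg hwf] at hgi
    have h0 : (a • g) i = 0 := by rw [Pi.smul_apply, ← hgi, smul_zero]
    rw [h0, map_zero, ite_self]
    split_ifs
    · rw [Pi.smul_apply, ← hgi, smul_zero]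
    · rfl

/-- A submodule of a graded free module that is generated by homogeneous elements. -/
def IsHomogSub (Z : Submodule (PS K ℓ) (Fin r → PS K ℓ)) : Prop :=
  ∀ e, ∀ a ∈ Z, vecComponent w e a ∈ Z

/-- `Z` has a family of `s` homogeneous generators. -/
def HasHomogGens (Z : Submodule (PS K ℓ) (Fin r → PS K ℓ)) (s : ℕ) : Prop :=
  ∃ (g : Fin s → Fin r → PS K ℓ) (d : Fin s → ℕ),
    (∀ j, vecComponent w (d j) (g j) = g j) ∧ Submodule.span (PS K ℓ) (Set.range g) = Z

variable {w}

theorem IsHomogSub.exists_gens {Z : Submodule (PS K ℓ) (Fin r → PS K ℓ)} (hZ : IsHomogSub w Z) :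
    ∃ s, HasHomogGens w Z s := by
  let T : Set (Fin r → PS K ℓ) := {x | x ∈ Z ∧ ∃ e, vecComponent w e x = x}
  have hT : Submodule.span (PS K ℓ) T = Z := by
    refine le_antisymm (Submodule.span_le.mpr fun x hx => hx.1) fun a ha => ?_
    obtain ⟨D, hD⟩ := exists_sum_vecComponent w a
    rw [hD]
    exact Submodule.sum_mem _ fun e _ =>
      Submodule.subset_span ⟨hZ e a ha, e, vecComponent_idem w e a⟩
  obtain ⟨t, htT, ht⟩ := (Submodule.fg_span_iff_fg_span_finset_subset (R := PS K ℓ) T).mp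
    (IsNoetherian.noetherian _)
  refine ⟨t.card, fun j => (t.equivFin.symm j : Fin r → PS K ℓ),
    fun j => (htT (t.equivFin.symm j).2).2.choose,
    fun j => (htT (t.equivFin.symm j).2).2.choose_spec, ?_⟩
  rw [← hT, ht]
  congr 1
  ext x
  constructor
  · rintro ⟨j, rfl⟩
    exact (t.equivFin.symm j).2
  · intro hx
    exact ⟨t.equivFin ⟨x, hx⟩, by simp⟩

/-- A submodule with homogeneous generators has homogeneous generators all of whose relations
have coefficients in the irrelevant ideal. -/
theorem IsHomogSub.exists_minimal_gens {Z : Submodule (PS K ℓ) (Fin r → PS K ℓ)}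
    (hZ : IsHomogSub w Z) :
    ∃ (s : ℕ) (g : Fin s → Fin r → PS K ℓ), Submodule.span (PS K ℓ) (Set.range g) = Z ∧
      ∀ a : Fin s → PS K ℓ, ∑ j, a j • g j = 0 → ∀ j, constantCoeff (a j) = 0 := by
  have hex := hZ.exists_gens
  obtain ⟨g, d, hgd, hspan⟩ := Nat.find_spec hex
  refine ⟨_, g, hspan, fun a ha j => ?_⟩
  by_contra hj
  obtain ⟨s, hs⟩ : ∃ s, Nat.find hex = s + 1 := ⟨Nat.find hex - 1, by have := j.pos; omega⟩
  have hmin := Nat.find_min hex (m := s) (by omega)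
  revert g d a j
  rw [hs]
  intro g d hgd hspan a ha j hj
  have h1 := congrArg (vecComponent w (d j)) ha
  rw [map_sum, map_zero, Fin.sum_univ_succAbove _ j] at h1
  rw [vecComponent_smul w _ _ _ (hgd j), if_pos le_rfl, Nat.sub_self, homogeneousComponent_zero]
    at h1
  have hmem : g j ∈ Submodule.span (PS K ℓ) (Set.range fun k => g (j.succAbove k)) := by
    have h2 : (C (constantCoeff (a j)) : PS K ℓ) • g j ∈
        Submodule.span (PS K ℓ) (Set.range fun k => g (j.succAbove k)) := by
      rw [constantCoeff_eq, eq_neg_of_add_eq_zero_left h1]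
      refine Submodule.neg_mem _ (Submodule.sum_mem _ fun k _ => ?_)
      rw [vecComponent_smul w _ _ _ (hgd _)]
      split_ifs
      · exact Submodule.smul_mem _ _ (Submodule.subset_span ⟨k, rfl⟩)
      · exact Submodule.zero_mem _
    have h3 := Submodule.smul_mem _ (C (constantCoeff (a j))⁻¹) h2
    rwa [← mul_smul, ← C_mul, inv_mul_cancel₀ hj, C_1, one_smul] at h3
  refine hmin ⟨fun k => g (j.succAbove k), fun k => d (j.succAbove k), fun k => hgd _, ?_⟩
  rw [← hspan]
  refine le_antisymm (Submodule.span_mono ?_) (Submodule.span_le.mpr ?_)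
  · rintro _ ⟨k, rfl⟩
    exact ⟨_, rfl⟩
  · rintro _ ⟨k, rfl⟩
    rcases Fin.eq_self_or_eq_succAbove j k with rfl | ⟨i, rfl⟩
    · exact hmem
    · exact Submodule.subset_span ⟨i, rfl⟩

end Graded

theorem matrix_eq_zero_of_idempotent {R : Type} [CommRing R] [IsDomain R] {s : ℕ}
    (ε : R →+* K) (E : Matrix (Fin s) (Fin s) R) (hE : E * E = E) (h0 : ∀ i j, ε (E i j) = 0) :
    E = 0 := by
  have h1 : E * (1 - E) = 0 := by rw [mul_sub, mul_one, hE, sub_self]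
  have hdet : (1 - E).det ≠ 0 := by
    intro h
    have h2 := congrArg ε h
    rw [RingHom.map_det, map_zero, map_sub, map_one] at h2
    have : ε.mapMatrix E = 0 := by ext i j; exact h0 i j
    rw [this, sub_zero, Matrix.det_one] at h2
    exact one_ne_zero h2
  have h3 : (1 - E).det • E = 0 := by
    have := congrArg (· * (1 - E).adjugate) h1
    simp only [Matrix.mul_assoc, Matrix.mul_adjugate, zero_mul] at this
    simpa using this
  ext i j
  have := congrFun (congrFun h3 i) j
  simpa [hdet] using this

/-- Reduction of vectors modulo the kernel of a ring homomorphism. -/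
def vecRed {S Sb : Type} [CommRing S] [CommRing Sb] (σ : S →+* Sb) (k : ℕ) :
    (Fin k → S) →ₛₗ[σ] (Fin k → Sb) where
  toFun u j := σ (u j)
  map_add' u v := by ext; simp
  map_smul' c v := by ext; simp

section

variable {S Sb : Type} [CommRing S] [CommRing Sb] (σ : S →+* Sb)

theorem vecRed_surjective (hσ : Function.Surjective σ) (k : ℕ) :
    Function.Surjective (vecRed σ k) := fun v => by
  choose u hu using fun j => hσ (v j)
  exact ⟨u, funext hu⟩

variable {σ} in
theorem exists_smul_of_vecRed_eq_zero {z : S} (hzσ : ∀ x, σ x = 0 ↔ z ∣ x) {k : ℕ}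
    {u : Fin k → S} (hu : vecRed σ k u = 0) : ∃ u', u = z • u' := by
  choose u' hu' using fun j => (hzσ (u j)).mp (congrFun hu j)
  exact ⟨u', funext hu'⟩

theorem linearIndependent_of_projective_reduction [IsDomain S] [IsNoetherianRing S] [IsDomain Sb]
    (hσ : Function.Surjective σ) (z : S) (hz : z ≠ 0) (hzσ : ∀ x, σ x = 0 ↔ z ∣ x)
    (ε : Sb →+* K) {r s : ℕ} (g : Fin s → Fin r → S)
    (hrel : ∀ a : Fin s → S, ∑ j, a j • g j = 0 → ∀ j, ε (σ (a j)) = 0)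
    (hsat : ∀ x, z • x ∈ Submodule.span S (Set.range g) → x ∈ Submodule.span S (Set.range g))
    (hproj : Module.Projective Sb
      (Submodule.span Sb (Set.range fun j => vecRed σ r (g j)))) :
    LinearIndependent S g := by
  let P := Submodule.span Sb (Set.range fun j => vecRed σ r (g j))
  let gb : (Fin s → Sb) →ₗ[Sb] P := (Fintype.linearCombination Sb fun j =>
    (⟨vecRed σ r (g j), Submodule.subset_span ⟨j, rfl⟩⟩ : P))
  have hgb : ∀ a, (gb a : Fin r → Sb) = ∑ j, a j • vecRed σ r (g j) := fun a => by
    simp [gb, Fintype.linearCombination_apply]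
  have hgbr : ∀ a, (gb (vecRed σ s a) : Fin r → Sb) = vecRed σ r (∑ j, a j • g j) := fun a => by
    rw [hgb, map_sum]
    exact Finset.sum_congr rfl fun j _ => (map_smulₛₗ (vecRed σ r) (a j) (g j)).symm
  have hgbs : Function.Surjective gb := by
    rintro ⟨x, hx⟩
    obtain ⟨c, hc⟩ := (Submodule.mem_span_range_iff_exists_fun Sb).mp hx
    exact ⟨c, Subtype.ext (by rw [hgb, hc])⟩
  have hmod : ∀ a : Fin s → S, gb (vecRed σ s a) = 0 →
      ∃ b : Fin s → S, ∑ j, (a - z • b) j • g j = 0 := fun a ha => by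
    have h1 : vecRed σ r (∑ j, a j • g j) = 0 := by rw [← hgbr, ha]; rfl
    obtain ⟨x, hx⟩ := exists_smul_of_vecRed_eq_zero hzσ h1
    have hx' : x ∈ Submodule.span S (Set.range g) := hsat x (by
      rw [← hx]
      exact (Submodule.mem_span_range_iff_exists_fun S).mpr ⟨a, rfl⟩)
    obtain ⟨b, rfl⟩ := (Submodule.mem_span_range_iff_exists_fun S).mp hx'
    refine ⟨b, ?_⟩
    simp only [Pi.sub_apply, Pi.smul_apply, sub_smul, Finset.sum_sub_distrib, smul_assoc]
    rw [hx, Finset.smul_sum, sub_self]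
  have hσz : σ z = 0 := (hzσ z).mpr dvd_rfl
  have hkerε : ∀ a : Fin s → Sb, gb a = 0 → ∀ j, ε (a j) = 0 := fun a ha j => by
    obtain ⟨a, rfl⟩ := vecRed_surjective σ hσ s a
    obtain ⟨b, hb⟩ := hmod a ha
    have := hrel _ hb j
    rw [Pi.sub_apply, map_sub, Pi.smul_apply, smul_eq_mul, map_mul, hσz, zero_mul,
      sub_zero] at this
    exact this
  obtain ⟨t, ht⟩ := Module.projective_lifting_property gb LinearMap.id hgbs
  let E : (Fin s → Sb) →ₗ[Sb] (Fin s → Sb) := LinearMap.id - t ∘ₗ gb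
  have hgt : ∀ x, gb (t x) = x := fun x => LinearMap.congr_fun ht x
  have hgE : ∀ x, gb (E x) = 0 := fun x => by simp [E, hgt]
  have hEE : E * E = E := by
    refine LinearMap.ext fun x => ?_
    change E x - t (gb (E x)) = E x
    rw [hgE, map_zero, sub_zero]
  have hE0 : E = 0 := by
    have := matrix_eq_zero_of_idempotent ε (LinearMap.toMatrix' E)
      (by rw [← LinearMap.toMatrix'_mul, hEE])
      (fun i j => by
        rw [LinearMap.toMatrix'_apply]
        exact hkerε _ (hgE _) i)
    simpa using this
  have hgb0 : ∀ a, gb a = 0 → a = 0 := fun a ha => by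
    have : E a = 0 := by rw [hE0]; rfl
    simpa [E, ha] using this
  let W : Submodule S (Fin s → S) := LinearMap.ker (Fintype.linearCombination S g)
  have hW : ∀ a, a ∈ W ↔ ∑ j, a j • g j = 0 := fun a => by
    rw [LinearMap.mem_ker, Fintype.linearCombination_apply]
  have hWz : W ≤ Ideal.span {z} • W := fun a ha => by
    rw [hW] at ha
    have : gb (vecRed σ s a) = 0 := Subtype.ext (by rw [hgbr, ha, map_zero]; rfl)
    obtain ⟨b, rfl⟩ := exists_smul_of_vecRed_eq_zero hzσ (hgb0 _ this)
    refine Submodule.smul_mem_smul (Ideal.mem_span_singleton_self z) ((hW b).mpr ?_)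
    simp only [Pi.smul_apply, smul_assoc, ← Finset.smul_sum] at ha
    exact (smul_eq_zero.mp ha).resolve_left hz
  obtain ⟨c, hc, hcW⟩ := Submodule.exists_sub_one_mem_and_smul_eq_zero_of_fg_of_le_smul _ W
    (IsNoetherian.noetherian W) hWz
  have hc0 : c ≠ 0 := by
    rintro rfl
    obtain ⟨u, hu⟩ := Ideal.mem_span_singleton.mp hc
    have := congrArg σ hu
    rw [map_mul, hσz, zero_mul, map_sub, map_zero, map_one, zero_sub, neg_eq_zero] at this
    exact one_ne_zero this
  rw [Fintype.linearIndependent_iff]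
  intro a ha
  have := hcW a ((hW a).mpr ha)
  rw [smul_eq_zero] at this
  exact congrFun (this.resolve_left hc0)

end

/-- A finite free resolution of length one. -/
def HasShortFreeRes (S : Type) [CommRing S] (M : Type) [AddCommGroup M] [Module S M] : Prop :=
  ∃ (r s : ℕ) (φ : (Fin s → S) →ₗ[S] (Fin r → S)) (π : (Fin r → S) →ₗ[S] M),
    Function.Injective φ ∧ Function.Exact φ π ∧ Function.Surjective π

theorem hasShortFreeRes_of_graded {n k : ℕ} (σ : PS K ℓ →+* PS K n) (hσ : Function.Surjective σ)
    (z : PS K ℓ) (hz : z ≠ 0) (hzσ : ∀ x, σ x = 0 ↔ z ∣ x)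
    (hε : ∀ x, constantCoeff (σ x) = constantCoeff x)
    (M : Submodule (PS K ℓ) (Fin k → PS K ℓ)) (hM : IsHomogSub (fun _ => 0) M)
    {N : Type} [AddCommGroup N] [Module (PS K n) N] (hN : PD (PS K n) 1 N)
    (ρ : M →ₛₗ[σ] N) (hρs : Function.Surjective ρ) (hρ : ∀ m, ρ m = 0 → ∃ m', m = z • m') :
    HasShortFreeRes (PS K ℓ) M := by
  have hσz : σ z = 0 := (hzσ z).mpr dvd_rfl
  obtain ⟨r, m, w, hm, hspan⟩ := hM.exists_gens
  have hmM : ∀ j, m j ∈ M := fun j => hspan ▸ Submodule.subset_span ⟨j, rfl⟩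
  let π : (Fin r → PS K ℓ) →ₗ[PS K ℓ] M :=
    Fintype.linearCombination (PS K ℓ) fun j => (⟨m j, hmM j⟩ : M)
  have hπ : ∀ a, (π a : Fin k → PS K ℓ) = ∑ j, a j • m j := fun a => by
    simp [π, Fintype.linearCombination_apply]
  have hπs : Function.Surjective π := by
    rintro ⟨x, hx⟩
    rw [← hspan] at hx
    obtain ⟨c, hc⟩ := (Submodule.mem_span_range_iff_exists_fun _).mp hx
    exact ⟨c, Subtype.ext (by rw [hπ, hc])⟩
  have hZ : IsHomogSub w (LinearMap.ker π) := by
    intro e a ha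
    rw [LinearMap.mem_ker, Subtype.ext_iff, hπ] at ha ⊢
    have h1 := congrArg (vecComponent (fun _ => 0) e) ha
    rw [map_sum] at h1
    refine Eq.trans (Finset.sum_congr rfl fun j _ => ?_) (h1.trans (map_zero _))
    rw [vecComponent_smul _ _ _ _ (hm j), vecComponent_apply]
    split_ifs <;> simp
  obtain ⟨s, g, hg, hrel⟩ := hZ.exists_minimal_gens
  have hMz : ∀ x : M, z • x = 0 → x = 0 := fun x hx => (smul_eq_zero.mp hx).resolve_left hz
  let πb : (Fin r → PS K n) →ₗ[PS K n] N :=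
    Fintype.linearCombination (PS K n) fun j => ρ ⟨m j, hmM j⟩
  have hπb : ∀ a, πb (vecRed σ r a) = ρ (π a) := fun a => by
    simp only [πb, π, Fintype.linearCombination_apply, map_sum, map_smulₛₗ]
    rfl
  have hπbs : Function.Surjective πb := fun ν => by
    obtain ⟨x, rfl⟩ := hρs ν
    obtain ⟨a, rfl⟩ := hπs x
    exact ⟨_, hπb a⟩
  have hker : Submodule.span (PS K n) (Set.range fun j => vecRed σ r (g j)) =
      LinearMap.ker πb := by
    apply le_antisymm
    · rw [Submodule.span_le]
      rintro _ ⟨j, rfl⟩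
      have : π (g j) = 0 := by
        rw [← LinearMap.mem_ker, ← hg]; exact Submodule.subset_span ⟨j, rfl⟩
      simp [hπb, this]
    · intro a ha
      obtain ⟨a, rfl⟩ := vecRed_surjective σ hσ r a
      rw [LinearMap.mem_ker, hπb] at ha
      obtain ⟨x, hx⟩ := hρ _ ha
      obtain ⟨b, rfl⟩ := hπs x
      have h1 : a - z • b ∈ LinearMap.ker π := by
        rw [LinearMap.mem_ker, map_sub, map_smul, hx, sub_self]
      rw [← hg] at h1
      obtain ⟨c, hc⟩ := (Submodule.mem_span_range_iff_exists_fun _).mp h1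
      have h2 := congrArg (vecRed σ r) hc
      rw [map_sub, map_smulₛₗ, hσz, zero_smul, sub_zero, map_sum] at h2
      rw [← h2]
      refine Submodule.sum_mem _ fun j _ => ?_
      rw [map_smulₛₗ]
      exact Submodule.smul_mem _ _ (Submodule.subset_span ⟨j, rfl⟩)
  have hli : LinearIndependent (PS K ℓ) g := by
    refine linearIndependent_of_projective_reduction σ hσ z hz hzσ
      (constantCoeff : PS K n →+* K) g (fun a ha j => by rw [hε]; exact hrel a ha j) ?_ ?_
    · intro x hx
      rw [hg, LinearMap.mem_ker] at hx ⊢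
      rw [map_smul] at hx
      exact hMz _ hx
    · rw [hker, ← PD_zero_iff]
      exact PD.left (LinearMap.ker πb).subtype_injective (exact_subtype_ker πb) hπbs
        (PD.of_projective 0) hN
  refine ⟨r, s, Fintype.linearCombination (PS K ℓ) g, π, ?_, ?_, hπs⟩
  · exact linearIndependent_iff_injective_fintypeLinearCombination.mp hli
  · intro a
    rw [← LinearMap.mem_ker, ← hg, Submodule.mem_span_range_iff_exists_fun]
    simp [Fintype.linearCombination_apply]

section ExteriorQuotient

open ExteriorAlgebra

variable {R : Type} [CommRing R] {V : Type} [AddCommGroup V] [Module R V]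

theorem ι_mul_mem_exteriorPower (v : V) {p : ℕ} {x : ExteriorAlgebra R V} (hx : x ∈ ⋀[R]^p V) :
    ι R v * x ∈ ⋀[R]^(p + 1) V := by
  rw [exteriorPower, pow_succ']
  exact Submodule.mul_mem_mul ⟨v, rfl⟩ hx

theorem exteriorPower_succ_induction {p : ℕ} {C : ExteriorAlgebra R V → Prop}
    (hadd : ∀ x y, C x → C y → C (x + y)) (hmul : ∀ v, ∀ x ∈ ⋀[R]^p V, C (ι R v * x))
    {x : ExteriorAlgebra R V} (hx : x ∈ ⋀[R]^(p + 1) V) : C x := by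
  rw [exteriorPower, pow_succ'] at hx
  refine Submodule.mul_induction_on hx ?_ hadd
  rintro _ ⟨v, rfl⟩ x hx
  exact hmul v x hx

theorem mem_exteriorPower_zero {x : ExteriorAlgebra R V} :
    x ∈ ⋀[R]^0 V ↔ ∃ c : R, algebraMap R _ c = x := by
  rw [exteriorPower, pow_zero, Submodule.mem_one]

theorem contractLeft_exteriorPower_zero (d : Module.Dual R V) {x : ExteriorAlgebra R V}
    (hx : x ∈ ⋀[R]^0 V) : CliffordAlgebra.contractLeft d x = 0 := by
  obtain ⟨c, rfl⟩ := mem_exteriorPower_zero.mp hx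
  exact CliffordAlgebra.contractLeft_algebraMap _ _ _

theorem contractLeft_ι_mul' (d : Module.Dual R V) (v : V) (x : ExteriorAlgebra R V) :
    CliffordAlgebra.contractLeft d (ι R v * x) =
      d v • x - ι R v * CliffordAlgebra.contractLeft d x :=
  CliffordAlgebra.contractLeft_ι_mul d v x

theorem contractLeft_mem_exteriorPower (d : Module.Dual R V) :
    ∀ {p : ℕ} {x : ExteriorAlgebra R V}, x ∈ ⋀[R]^(p + 1) V →
      CliffordAlgebra.contractLeft d x ∈ ⋀[R]^p V
  | 0, x, hx => by
    refine exteriorPower_succ_induction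
      (C := fun x => CliffordAlgebra.contractLeft d x ∈ ⋀[R]^0 V)
      (fun x y hx hy => by rw [map_add]; exact Submodule.add_mem _ hx hy) (fun v x hx => ?_) hx
    rw [contractLeft_ι_mul', contractLeft_exteriorPower_zero d hx, mul_zero, sub_zero]
    exact Submodule.smul_mem _ _ hx
  | p + 1, x, hx => by
    refine exteriorPower_succ_induction
      (C := fun x => CliffordAlgebra.contractLeft d x ∈ ⋀[R]^(p + 1) V)
      (fun x y hx hy => by rw [map_add]; exact Submodule.add_mem _ hx hy) (fun v x hx => ?_) hx
    rw [contractLeft_ι_mul']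
    exact Submodule.sub_mem _ (Submodule.smul_mem _ _ hx)
      (ι_mul_mem_exteriorPower v (contractLeft_mem_exteriorPower d hx))

/-- The degree `p` part of the ideal generated by `f 0, …, f (k - 1)` in the exterior algebra. -/
def extJ (f : ℕ → V) : ℕ → ℕ → Submodule R (ExteriorAlgebra R V)
  | 0, _ => ⊥
  | _ + 1, 0 => ⊥
  | k + 1, p + 1 => extJ f k (p + 1) ⊔ Submodule.map (LinearMap.mulLeft R (ι R (f k))) (⋀[R]^p V)

variable (f : ℕ → V)

theorem extJ_zero_right (k : ℕ) : extJ (R := R) f k 0 = ⊥ := by cases k <;> rfl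

theorem mem_extJ_succ {k p : ℕ} {x : ExteriorAlgebra R V} :
    x ∈ extJ f (k + 1) (p + 1) ↔
      ∃ y ∈ extJ f k (p + 1), ∃ w ∈ ⋀[R]^p V, y + ι R (f k) * w = x := by
  simp only [extJ, Submodule.mem_sup, Submodule.mem_map]
  constructor
  · rintro ⟨y, hy, _, ⟨w, hw, rfl⟩, rfl⟩
    exact ⟨y, hy, w, hw, rfl⟩
  · rintro ⟨y, hy, w, hw, rfl⟩
    exact ⟨y, hy, _, ⟨w, hw, rfl⟩, rfl⟩

theorem extJ_le_succ (k p : ℕ) : extJ (R := R) f k p ≤ extJ f (k + 1) p := by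
  cases p with
  | zero => rw [extJ_zero_right]; exact bot_le
  | succ p => exact le_sup_left

theorem extJ_le_exteriorPower (k p : ℕ) : extJ (R := R) f k p ≤ ⋀[R]^p V := by
  induction k with
  | zero => exact bot_le
  | succ k ih =>
    cases p with
    | zero => exact bot_le
    | succ p =>
      refine sup_le ih ?_
      rintro _ ⟨w, hw, rfl⟩
      exact ι_mul_mem_exteriorPower _ hw

theorem ι_mul_mem_extJ_of_lt {k p i : ℕ} (hi : i < k) {w : ExteriorAlgebra R V}
    (hw : w ∈ ⋀[R]^p V) : ι R (f i) * w ∈ extJ f k (p + 1) := by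
  induction k with
  | zero => omega
  | succ k ih =>
    rcases Nat.lt_succ_iff_lt_or_eq.mp hi with h | rfl
    · exact extJ_le_succ f _ _ (ih h)
    · exact (mem_extJ_succ f).mpr ⟨0, Submodule.zero_mem _, w, hw, zero_add _⟩

/-- The ideal is spanned by the products `f i ∧ w`. -/
theorem extJ_succ_le {k p : ℕ} {N : Submodule R (ExteriorAlgebra R V)}
    (h : ∀ i < k, ∀ w ∈ ⋀[R]^p V, ι R (f i) * w ∈ N) : extJ f k (p + 1) ≤ N := by
  induction k with
  | zero => exact bot_le
  | succ k ih =>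
    refine sup_le (ih fun i hi => h i (by omega)) ?_
    rintro _ ⟨w, hw, rfl⟩
    exact h k (by omega) w hw

theorem ι_mul_swap (u v : V) (x : ExteriorAlgebra R V) :
    ι R u * (ι R v * x) = -(ι R v * (ι R u * x)) := by
  rw [eq_neg_iff_add_eq_zero, ← mul_assoc, ← mul_assoc, ← add_mul, ι_add_mul_swap, zero_mul]

theorem ι_mul_ι_mul_self (u : V) (x : ExteriorAlgebra R V) : ι R u * (ι R u * x) = 0 := by
  rw [← mul_assoc, ι_sq_zero, zero_mul]

theorem ι_mul_mem_extJ (v : V) {k p : ℕ} {x : ExteriorAlgebra R V} (hx : x ∈ extJ f k p) :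
    ι R v * x ∈ extJ f k (p + 1) := by
  cases p with
  | zero =>
    rw [extJ_zero_right] at hx
    rw [(Submodule.mem_bot R).mp hx, mul_zero]
    exact Submodule.zero_mem _
  | succ p =>
    refine extJ_succ_le f (N := Submodule.comap (LinearMap.mulLeft R (ι R v)) _)
      (fun i hi w hw => ?_) hx
    rw [Submodule.mem_comap, LinearMap.mulLeft_apply, ι_mul_swap]
    exact Submodule.neg_mem _ (ι_mul_mem_extJ_of_lt f hi (ι_mul_mem_exteriorPower v hw))

theorem contractLeft_mem_extJ (d : Module.Dual R V) {k p : ℕ} (hd : ∀ i < k, d (f i) = 0)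
    {x : ExteriorAlgebra R V} (hx : x ∈ extJ f k (p + 1)) :
    CliffordAlgebra.contractLeft d x ∈ extJ f k p := by
  refine extJ_succ_le f (N := Submodule.comap (CliffordAlgebra.contractLeft d) (extJ f k p))
    (fun i hi w hw => ?_) hx
  rw [Submodule.mem_comap, contractLeft_ι_mul', hd i hi, zero_smul, zero_sub]
  refine Submodule.neg_mem _ ?_
  cases p with
  | zero =>
    rw [contractLeft_exteriorPower_zero d hw, mul_zero]
    exact Submodule.zero_mem _
  | succ p => exact ι_mul_mem_extJ_of_lt f hi (contractLeft_mem_exteriorPower d hw)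

/-- The degree `p` part of the quotient of the exterior algebra by `f 0, …, f (k - 1)`. -/
abbrev ExtQuot (k p : ℕ) : Type :=
  (⋀[R]^p V) ⧸ (extJ (R := R) f k p).submoduleOf (⋀[R]^p V)

theorem smul_mem_extJ_succ (d : Module.Dual R V) {k p : ℕ} (hd : ∀ i < k, d (f i) = 0)
    {x : ExteriorAlgebra R V} (hx : x ∈ ⋀[R]^p V) (hfx : ι R (f k) * x ∈ extJ f k (p + 1)) :
    d (f k) • x ∈ extJ f (k + 1) p := by
  have h := contractLeft_mem_extJ f d hd hfx
  rw [contractLeft_ι_mul'] at h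
  rw [← sub_add_cancel (d (f k) • x) (ι R (f k) * CliffordAlgebra.contractLeft d x)]
  refine Submodule.add_mem _ (extJ_le_succ f _ _ h) ?_
  cases p with
  | zero =>
    rw [contractLeft_exteriorPower_zero d hx, mul_zero]
    exact Submodule.zero_mem _
  | succ p => exact ι_mul_mem_extJ_of_lt f (by omega) (contractLeft_mem_exteriorPower d hx)

theorem PD_extQuot_step [Module.Free R V] {rs : List R}
    (hreg : RingTheory.Sequence.IsWeaklyRegular R rs) {k p : ℕ} (hp : p + 1 ≤ rs.length)
    (hd : ∀ h ∈ rs, ∃ d : Module.Dual R V, d (f k) = h ∧ ∀ i < k, d (f i) = 0)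
    (h₁ : PD R p (ExtQuot (R := R) f (k + 1) p))
    (h₂ : PD R (p + 1) (ExtQuot (R := R) f k (p + 1))) :
    PD R (p + 1) (ExtQuot (R := R) f (k + 1) (p + 1)) := by
  let μ : (⋀[R]^p V) →ₗ[R] (⋀[R]^(p + 1) V) :=
    (LinearMap.mulLeft R (ι R (f k))).restrict fun x hx => ι_mul_mem_exteriorPower (f k) hx
  have hμ : (extJ (R := R) f (k + 1) p).submoduleOf (⋀[R]^p V) ≤
      ((extJ (R := R) f k (p + 1)).submoduleOf (⋀[R]^(p + 1) V)).comap μ := by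
    rintro ⟨x, hx'⟩ hx
    change ι R (f k) * x ∈ extJ f k (p + 1)
    change x ∈ extJ f (k + 1) p at hx
    cases p with
    | zero =>
      rw [extJ_zero_right] at hx
      rw [(Submodule.mem_bot R).mp hx, mul_zero]
      exact Submodule.zero_mem _
    | succ p =>
      obtain ⟨y, hy, w, hw, rfl⟩ := (mem_extJ_succ f).mp hx
      rw [mul_add, ι_mul_ι_mul_self, add_zero]
      exact ι_mul_mem_extJ f _ hy
  have hid : (extJ (R := R) f k (p + 1)).submoduleOf (⋀[R]^(p + 1) V) ≤
      ((extJ (R := R) f (k + 1) (p + 1)).submoduleOf (⋀[R]^(p + 1) V)).comap LinearMap.id :=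
    fun x hx => extJ_le_succ f k (p + 1) hx
  refine PD.right (f := Submodule.mapQ _ _ μ hμ)
    (g := Submodule.mapQ _ _ LinearMap.id hid) ?_ ?_ ?_ h₁ h₂
  · rw [injective_iff_map_eq_zero]
    intro x
    obtain ⟨⟨x, hx⟩, rfl⟩ := Submodule.Quotient.mk_surjective _ x
    intro h0
    rw [Submodule.mapQ_apply, Submodule.Quotient.mk_eq_zero] at h0
    change ι R (f k) * x ∈ extJ f k (p + 1) at h0
    refine h₁.eq_zero_of_smul_eq_zero hreg hp fun h hh => ?_
    obtain ⟨d, rfl, hd⟩ := hd h hh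
    rw [← Submodule.Quotient.mk_smul, Submodule.Quotient.mk_eq_zero]
    exact smul_mem_extJ_succ f d hd hx h0
  · intro x
    obtain ⟨⟨x, hx⟩, rfl⟩ := Submodule.Quotient.mk_surjective _ x
    rw [Submodule.mapQ_apply, Submodule.Quotient.mk_eq_zero]
    constructor
    · intro h
      obtain ⟨y, hy, w, hw, h⟩ := (mem_extJ_succ f).mp h
      refine ⟨Submodule.Quotient.mk ⟨w, hw⟩, ?_⟩
      rw [Submodule.mapQ_apply, Submodule.Quotient.eq]
      change ι R (f k) * w - x ∈ extJ f k (p + 1)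
      have h' : y + ι R (f k) * w = x := h
      rw [← h', sub_add_cancel_right]
      exact Submodule.neg_mem _ hy
    · rintro ⟨w, hw⟩
      obtain ⟨⟨w, hw'⟩, rfl⟩ := Submodule.Quotient.mk_surjective _ w
      rw [Submodule.mapQ_apply, Submodule.Quotient.eq] at hw
      change ι R (f k) * w - x ∈ extJ f k (p + 1) at hw
      change x ∈ extJ f (k + 1) (p + 1)
      exact (mem_extJ_succ f).mpr ⟨_, Submodule.neg_mem _ hw, w, hw', by abel⟩
  · intro x
    obtain ⟨x, rfl⟩ := Submodule.Quotient.mk_surjective _ x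
    exact ⟨Submodule.Quotient.mk x, rfl⟩

theorem PD_extQuot [Module.Free R V] {rs : List R}
    (hreg : RingTheory.Sequence.IsWeaklyRegular R rs) {s : ℕ}
    (hd : ∀ h ∈ rs, ∀ k < s, ∃ d : Module.Dual R V, d (f k) = h ∧ ∀ i < k, d (f i) = 0)
    (p : ℕ) (hp : p ≤ rs.length) (k : ℕ) (hk : k ≤ s) : PD R p (ExtQuot (R := R) f k p) := by
  have hbot : ∀ p k, extJ (R := R) f k p = ⊥ → PD R p (ExtQuot (R := R) f k p) := fun p k h => by
    refine (PD.of_projective (R := R) (M := ⋀[R]^p V) p).of_equiv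
      (Submodule.quotEquivOfEqBot _ ?_).symm
    rw [h, Submodule.submoduleOf, Submodule.comap_bot, Submodule.ker_subtype]
  induction p generalizing k with
  | zero => exact hbot _ _ (extJ_zero_right f k)
  | succ p ihp =>
    induction k with
    | zero => exact hbot _ _ rfl
    | succ k ihk =>
      exact PD_extQuot_step f hreg hp (fun h hh => hd h hh k (by omega))
        (ihp (by omega) (k + 1) hk) (ihk (by omega))

end ExteriorQuotient

section FactorsFree

/-- Multiplication by `h` on `M` factors through a finite free module. -/
def FactorsFree (S : Type) [CommRing S] (M : Type) [AddCommGroup M] [Module S M] (h : S) : Prop :=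
  ∃ (k : ℕ) (f : M →ₗ[S] (Fin k → S)) (g : (Fin k → S) →ₗ[S] M), ∀ m, g (f m) = h • m

variable {S : Type} [CommRing S]

theorem FactorsFree.of_free {M F : Type} [AddCommGroup M] [Module S M] [AddCommGroup F] [Module S F]
    [Module.Free S F] [Module.Finite S F] {h : S} (f : M →ₗ[S] F) (g : F →ₗ[S] M)
    (hgf : ∀ m, g (f m) = h • m) : FactorsFree S M h := by
  cases subsingleton_or_nontrivial S
  · have := Module.subsingleton S M
    exact ⟨0, 0, 0, fun m => Subsingleton.elim _ _⟩
  · let e := (Module.finBasis S F).equivFun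
    exact ⟨_, e.toLinearMap ∘ₗ f, g ∘ₗ e.symm.toLinearMap, fun m => by simp [hgf]⟩

theorem dvd_of_forall_dvd_mul [IsDomain S] [UniqueFactorizationMonoid S] {I : Type} (q : I → S)
    (hq : ∀ p, Prime p → ∃ c, ¬ p ∣ q c) {d : S} (hd : d ≠ 0) :
    ∀ {a : S}, (∀ c, d ∣ q c * a) → d ∣ a := by
  induction d using UniqueFactorizationMonoid.induction_on_prime with
  | h₁ => exact absurd rfl hd
  | h₂ x hx => exact fun _ => hx.dvd
  | h₃ b p hb hp ih =>
    intro a ha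
    obtain ⟨a', rfl⟩ := ih hb fun c => (Dvd.intro_left p rfl).trans (ha c)
    obtain ⟨c, hc⟩ := hq p hp
    rw [mul_comm p b]
    refine mul_dvd_mul_left b ?_
    have h1 := ha c
    rw [mul_comm p b, mul_left_comm] at h1
    exact (hp.dvd_or_dvd ((mul_dvd_mul_iff_left hb).mp h1)).resolve_left hc

theorem FactorsFree.smul_mem [IsDomain S] [UniqueFactorizationMonoid S] {W : Type} [AddCommGroup W]
    [Module S W] [Module.IsTorsionFree S W] {M : Submodule S W} {h : S} (hM : FactorsFree S M h)
    {I : Type} [Nonempty I] (q : I → S) (hq0 : ∀ c, q c ≠ 0)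
    (hq : ∀ p, Prime p → ∃ c, ¬ p ∣ q c) {y : W} (hy : ∀ c, q c • y ∈ M) : h • y ∈ M := by
  obtain ⟨k, f, g, hfg⟩ := hM
  have c₀ : I := Classical.arbitrary I
  have hcomm : ∀ c, q c • f ⟨_, hy c₀⟩ = q c₀ • f ⟨_, hy c⟩ := fun c => by
    rw [← map_smul, ← map_smul]
    congr 1
    exact Subtype.ext (smul_comm _ _ _)
  have hdvd : ∀ i, q c₀ ∣ f ⟨_, hy c₀⟩ i := fun i =>
    dvd_of_forall_dvd_mul q hq (hq0 c₀) fun c => ⟨_, congrFun (hcomm c) i⟩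
  choose v hv using hdvd
  have hv' : f ⟨_, hy c₀⟩ = q c₀ • v := funext hv
  have h1 := hfg ⟨_, hy c₀⟩
  rw [hv', map_smul, Subtype.ext_iff] at h1
  have h2 : q c₀ • ((g v : W) - h • y) = 0 := by
    rw [smul_sub, smul_comm _ h, sub_eq_zero]
    exact h1
  rw [← sub_eq_zero.mp ((smul_eq_zero.mp h2).resolve_left (hq0 c₀))]
  exact (g v).2

end FactorsFree

section WedgeSub

open ExteriorAlgebra

theorem map_sub_pow_smul_mem_extJ {R V : Type} [CommRing R] [AddCommGroup V] [Module R V]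
    (f : ℕ → V) (k : ℕ) (T : V →ₗ[R] V) (h : R)
    (hT : ∀ v, ∃ j ∈ Submodule.span R (f '' Set.Iio k), T v = h • v + j) :
    ∀ (p : ℕ) {x : ExteriorAlgebra R V}, x ∈ ⋀[R]^p V →
      ExteriorAlgebra.map T x - h ^ p • x ∈ extJ f k p
  | 0, x, hx => by
    obtain ⟨c, rfl⟩ := mem_exteriorPower_zero.mp hx
    rw [AlgHom.commutes, pow_zero, one_smul, sub_self]
    exact Submodule.zero_mem _
  | p + 1, x, hx => by
    refine exteriorPower_succ_induction
      (C := fun x => ExteriorAlgebra.map T x - h ^ (p + 1) • x ∈ extJ f k (p + 1))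
      (fun x y hx hy => ?_) (fun v x hx => ?_) hx
    · rw [map_add, smul_add, add_sub_add_comm]
      exact Submodule.add_mem _ hx hy
    · have ih := map_sub_pow_smul_mem_extJ f k T h hT p hx
      obtain ⟨j, hj, hTv⟩ := hT v
      have hmem : ExteriorAlgebra.map T x ∈ ⋀[R]^p V := by
        rw [← sub_add_cancel (ExteriorAlgebra.map T x) (h ^ p • x)]
        exact Submodule.add_mem _ (extJ_le_exteriorPower f k p ih) (Submodule.smul_mem _ _ hx)
      have hj' : ι R j * ExteriorAlgebra.map T x ∈ extJ f k (p + 1) := by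
        have hle : Submodule.span R (f '' Set.Iio k) ≤ (extJ f k (p + 1)).comap
            (LinearMap.mulRight R (ExteriorAlgebra.map T x) ∘ₗ ι R) := by
          rw [Submodule.span_le]
          rintro _ ⟨i, hi, rfl⟩
          exact ι_mul_mem_extJ_of_lt f hi hmem
        exact hle hj
      have : ExteriorAlgebra.map T (ι R v * x) - h ^ (p + 1) • (ι R v * x) =
          h • (ι R v * (ExteriorAlgebra.map T x - h ^ p • x)) +
            ι R j * ExteriorAlgebra.map T x := by
        rw [map_mul, map_apply_ι, hTv, map_add, map_smul, add_mul, mul_sub, smul_sub,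
          smul_mul_assoc, mul_smul_comm, ← mul_smul, ← pow_succ']
        abel
      rw [this]
      exact Submodule.add_mem _ (Submodule.smul_mem _ _ (ι_mul_mem_extJ f v ih)) hj'

theorem map_mem_exteriorPower {R V W : Type} [CommRing R] [AddCommGroup V] [Module R V]
    [AddCommGroup W] [Module R W] (T : V →ₗ[R] W) {p : ℕ} {x : ExteriorAlgebra R V}
    (hx : x ∈ ⋀[R]^p V) : ExteriorAlgebra.map T x ∈ ⋀[R]^p W := by
  have h := Submodule.mem_map_of_mem (f := (ExteriorAlgebra.map T).toLinearMap) hx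
  rw [exteriorPower, Submodule.map_pow] at h
  refine (pow_le_pow_left' ?_ p : _ ≤ LinearMap.range (ι R) ^ p) h
  rintro _ ⟨_, ⟨v, rfl⟩, rfl⟩
  exact ⟨T v, (map_apply_ι T v).symm⟩

theorem map_eq_zero_of_mem_extJ {R V W : Type} [CommRing R] [AddCommGroup V] [Module R V]
    [AddCommGroup W] [Module R W] (T : V →ₗ[R] W) {f : ℕ → V} {k : ℕ} (hT : ∀ i < k, T (f i) = 0)
    {p : ℕ} {x : ExteriorAlgebra R V} (hx : x ∈ extJ f k p) : ExteriorAlgebra.map T x = 0 := by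
  cases p with
  | zero =>
    rw [extJ_zero_right] at hx
    rw [(Submodule.mem_bot R).mp hx, map_zero]
  | succ p =>
    refine extJ_succ_le f (N := LinearMap.ker (ExteriorAlgebra.map T).toLinearMap)
      (fun i hi w _ => ?_) hx
    rw [LinearMap.mem_ker]
    change ExteriorAlgebra.map T _ = 0
    rw [map_mul, map_apply_ι, hT i hi, map_zero, zero_mul]

/-- The span of the `p`-fold wedge products of elements of `U`. -/
def wedgeSub {S L : Type} [CommRing S] [AddCommGroup L] [Module S L] (U : Submodule S L) (p : ℕ) :
    Submodule S (ExteriorAlgebra S L) :=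
  (Submodule.map (ι S) U) ^ p

theorem map_exteriorPower_range {S V L : Type} [CommRing S] [AddCommGroup V] [Module S V]
    [AddCommGroup L] [Module S L] (T : V →ₗ[S] L) (p : ℕ) :
    Submodule.map (ExteriorAlgebra.map T).toLinearMap (⋀[S]^p V) =
      wedgeSub (LinearMap.range T) p := by
  rw [exteriorPower, Submodule.map_pow, wedgeSub]
  congr 1
  rw [← LinearMap.range_comp, map_comp_ι, LinearMap.range_comp]

variable {S L : Type} [CommRing S] [IsDomain S] [AddCommGroup L] [Module S L]

open RingTheory.Sequence in
theorem PD_wedgeSub {U : Submodule S L} (hres : HasShortFreeRes S U) {Q : S} (hQ : Q ≠ 0)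
    (hQU : ∀ u : L, Q • u ∈ U) [Module.Free S L] {H : List S}
    (hreg : ∀ N : ℕ, 0 < N → IsWeaklyRegular S (H.map (· ^ N)))
    (hfac : ∀ h ∈ H, FactorsFree S U h) {p : ℕ} (hp : p + 1 ≤ H.length) :
    PD S p (wedgeSub U p) ∧ ∀ h ∈ H, FactorsFree S (wedgeSub U p) (h ^ p) := by
  obtain ⟨r, s, φ, π, hφ, hφπ, hπ⟩ := hres
  let π' : (Fin r → S) →ₗ[S] L := U.subtype ∘ₗ π
  have hπ'r : LinearMap.range π' = U := by
    rw [LinearMap.range_comp, LinearMap.range_eq_top.mpr hπ, Submodule.map_subtype_top]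
  let f : ℕ → (Fin r → S) := fun i => if hi : i < s then φ (Pi.single ⟨i, hi⟩ 1) else 0
  have hf : ∀ i : Fin s, f i = φ (Pi.single i 1) := fun i => dif_pos i.2
  have hfπ : ∀ i, π (f i) = 0 := fun i => by
    by_cases hi : i < s
    · rw [hf ⟨i, hi⟩]; exact hφπ.apply_apply_eq_zero _
    · simp [f, hi]
  have hspan : ∀ v, π v = 0 → v ∈ Submodule.span S (f '' Set.Iio s) := fun v hv => by
    obtain ⟨a, rfl⟩ := (hφπ v).mp hv
    rw [← Finset.univ_sum_single a, map_sum]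
    refine Submodule.sum_mem _ fun i _ => ?_
    have : Pi.single i (a i) = a i • Pi.single (M := fun _ => S) i 1 := by
      rw [← Pi.single_smul, smul_eq_mul, mul_one]
    rw [this, map_smul, ← hf]
    exact Submodule.smul_mem _ _ (Submodule.subset_span ⟨i, i.2, rfl⟩)
  have hT : ∀ (T : (Fin r → S) →ₗ[S] (Fin r → S)) (h : S), (∀ v, π (T v) = h • π v) →
      ∀ (p : ℕ) {x}, x ∈ ⋀[S]^p (Fin r → S) → ExteriorAlgebra.map T x - h ^ p • x ∈ extJ f s p :=
    fun T h hTh => map_sub_pow_smul_mem_extJ f s T h fun v =>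
      ⟨T v - h • v, hspan _ (by rw [map_sub, hTh, map_smul, sub_self]), by abel⟩
  have hlift : ∀ h ∈ H, ∃ (k : ℕ) (a : (Fin r → S) →ₗ[S] (Fin k → S))
      (b : (Fin k → S) →ₗ[S] (Fin r → S)), (∀ i, a (f i) = 0) ∧ ∀ v, π (b (a v)) = h • π v :=
    fun h hh => by
      obtain ⟨k, a, b, hab⟩ := hfac h hh
      obtain ⟨b', hb'⟩ := Module.projective_lifting_property π b hπ
      refine ⟨k, a ∘ₗ π, b', fun i => by simp [hfπ], fun v => ?_⟩
      rw [← LinearMap.comp_apply π, hb']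
      exact hab _
  have hd : ∀ N : ℕ, 0 < N → ∀ h ∈ H.map (· ^ N), ∀ k < s,
      ∃ d : Module.Dual S (Fin r → S), d (f k) = h ∧ ∀ i < k, d (f i) = 0 := by
    intro N hN h hh k hk
    obtain ⟨h, hH, rfl⟩ := List.mem_map.mp hh
    obtain ⟨l, a, b, ha, hab⟩ := hlift h hH
    let e := LinearEquiv.ofInjective φ hφ
    have hmem : ∀ v, (h • LinearMap.id - b ∘ₗ a : (Fin r → S) →ₗ[S] (Fin r → S)) v ∈
        LinearMap.range φ := fun v => (hφπ _).mp (by simp [hab])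
    let ψ : (Fin r → S) →ₗ[S] (Fin s → S) :=
      e.symm.toLinearMap ∘ₗ LinearMap.codRestrict _ _ hmem
    have hψ : ∀ i : Fin s, ψ (f i) = h • Pi.single i 1 := fun i => by
      apply hφ
      have : φ (ψ (f i)) = _ := congrArg Subtype.val (e.apply_symm_apply ⟨_, hmem (f i)⟩)
      refine this.trans ?_
      change (h • LinearMap.id - b ∘ₗ a : (Fin r → S) →ₗ[S] (Fin r → S)) (f i) = _
      rw [LinearMap.sub_apply, LinearMap.comp_apply, ha, map_zero, sub_zero,
        LinearMap.smul_apply, LinearMap.id_apply, hf, map_smul]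
    refine ⟨h ^ (N - 1) • LinearMap.proj ⟨k, hk⟩ ∘ₗ ψ, ?_, fun i hi => ?_⟩
    · have := hψ ⟨k, hk⟩
      simp only [LinearMap.smul_apply, LinearMap.comp_apply, this]
      simp [← pow_succ, Nat.sub_add_cancel hN]
    · have := hψ ⟨i, by omega⟩
      simp only [LinearMap.smul_apply, LinearMap.comp_apply, this]
      simp [Fin.ext_iff, hi.ne']
  have hPD : PD S p (ExtQuot (R := S) f s p) :=
    PD_extQuot f (hreg 1 one_pos) (hd 1 one_pos) p (by simp; omega) s le_rfl
  obtain ⟨χ, hχ⟩ : ∃ χ : L →ₗ[S] (Fin r → S), ∀ u, π' (χ u) = Q • u := by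
    let q : L →ₗ[S] U := LinearMap.codRestrict U (Q • LinearMap.id) hQU
    obtain ⟨χ, hχ⟩ := Module.projective_lifting_property π q hπ
    exact ⟨χ, fun u => congrArg Subtype.val (LinearMap.congr_fun hχ u)⟩
  have hker : ∀ x ∈ ⋀[S]^p (Fin r → S), ExteriorAlgebra.map π' x = 0 ↔ x ∈ extJ f s p := by
    intro x hx
    refine ⟨fun h0 => ?_, fun h => map_eq_zero_of_mem_extJ π' (fun i _ => by simp [π', hfπ]) h⟩
    have h1 := hT (χ ∘ₗ π') Q (fun v => Subtype.ext (hχ _)) p hx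
    rw [← map_comp_map, AlgHom.comp_apply, h0, map_zero, zero_sub] at h1
    have h2 : Q ^ p • x ∈ extJ f s p := by simpa using Submodule.neg_mem _ h1
    have h3 : ∀ h ∈ H, h ^ p • x ∈ extJ f s p := fun h hh => by
      obtain ⟨k, a, b, ha, hab⟩ := hlift h hh
      have h4 : ExteriorAlgebra.map a x = 0 := by
        have h5 := map_eq_zero_of_mem_extJ a (fun i _ => ha i) h2
        rw [map_smul] at h5
        have h6 : Q ^ p •
            (⟨ExteriorAlgebra.map a x, map_mem_exteriorPower a hx⟩ : ⋀[S]^p (Fin k → S)) = 0 :=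
          Subtype.ext h5
        exact congrArg Subtype.val ((smul_eq_zero.mp h6).resolve_left (pow_ne_zero p hQ))
      have h7 := hT (b ∘ₗ a) h hab p hx
      rw [← map_comp_map, AlgHom.comp_apply, h4, map_zero, zero_sub] at h7
      simpa using Submodule.neg_mem _ h7
    have h8 : (Submodule.Quotient.mk ⟨x, hx⟩ : ExtQuot (R := S) f s p) = 0 := by
      refine hPD.eq_zero_of_smul_eq_zero (hreg (p + 1) (by omega)) (by simpa using hp)
        fun h hh => ?_
      obtain ⟨h, hH, rfl⟩ := List.mem_map.mp hh
      rw [← Submodule.Quotient.mk_smul, Submodule.Quotient.mk_eq_zero]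
      change h ^ (p + 1) • x ∈ extJ f s p
      rw [pow_succ', mul_smul]
      exact Submodule.smul_mem _ _ (h3 h hH)
    rwa [Submodule.Quotient.mk_eq_zero] at h8
  have hrange : Submodule.map (ExteriorAlgebra.map π').toLinearMap (⋀[S]^p (Fin r → S)) =
      wedgeSub U p := by
    rw [map_exteriorPower_range, hπ'r]
  let Ψ : (⋀[S]^p (Fin r → S)) →ₗ[S] wedgeSub U p :=
    ((ExteriorAlgebra.map π').toLinearMap.domRestrict _).codRestrict _ fun x =>
      hrange ▸ ⟨x, x.2, rfl⟩
  have hΨ : Function.Surjective Ψ := by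
    rintro ⟨y, hy⟩
    rw [← hrange] at hy
    obtain ⟨x, hx, rfl⟩ := hy
    exact ⟨⟨x, hx⟩, rfl⟩
  have hΨk : (extJ (R := S) f s p).submoduleOf (⋀[S]^p (Fin r → S)) = LinearMap.ker Ψ := by
    ext ⟨x, hx⟩
    rw [LinearMap.mem_ker, Subtype.ext_iff]
    exact (hker x hx).symm
  let e := (Submodule.quotEquivOfEq _ _ hΨk).trans (Ψ.quotKerEquivOfSurjective hΨ)
  refine ⟨hPD.of_equiv e, fun h hh => ?_⟩
  obtain ⟨k, a, b, ha, hab⟩ := hlift h hh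
  let a' : ExtQuot (R := S) f s p →ₗ[S] ⋀[S]^p (Fin k → S) :=
    Submodule.liftQ _ ((ExteriorAlgebra.map a).toLinearMap.restrict fun x hx =>
      map_mem_exteriorPower a hx)
      (fun x hx => Subtype.ext (map_eq_zero_of_mem_extJ a (fun i _ => ha i) hx))
  let b' : ⋀[S]^p (Fin k → S) →ₗ[S] wedgeSub U p :=
    Ψ ∘ₗ ((ExteriorAlgebra.map b).toLinearMap.restrict fun x hx => map_mem_exteriorPower b hx)
  refine FactorsFree.of_free (a' ∘ₗ e.symm.toLinearMap) b' fun y => ?_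
  obtain ⟨⟨x, hx⟩, rfl⟩ := hΨ y
  have he : e.symm (Ψ ⟨x, hx⟩) = Submodule.Quotient.mk ⟨x, hx⟩ := by
    rw [LinearEquiv.symm_apply_eq]; rfl
  have he' : (a' ∘ₗ e.symm.toLinearMap) (Ψ ⟨x, hx⟩) = a' (Submodule.Quotient.mk ⟨x, hx⟩) :=
    congrArg a' he
  rw [he']
  refine Subtype.ext ?_
  change ExteriorAlgebra.map π' (ExteriorAlgebra.map b (ExteriorAlgebra.map a x)) =
    h ^ p • ExteriorAlgebra.map π' x
  have h7 := (hker _ (extJ_le_exteriorPower f s p (hT (b ∘ₗ a) h hab p hx))).mpr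
    (hT (b ∘ₗ a) h hab p hx)
  have h8 : ExteriorAlgebra.map π' (ExteriorAlgebra.map (b ∘ₗ a) x) =
      h ^ p • ExteriorAlgebra.map π' x := by
    rw [← sub_eq_zero, ← map_smul, ← map_sub]
    exact h7
  exact (congrArg _ (DFunLike.congr_fun (map_comp_map a b) x)).trans h8

end WedgeSub

section LogForms

open ExteriorAlgebra RingTheory.Sequence

variable {S V J : Type} [CommRing S] [AddCommGroup V] [Module S V]

/-- Forms `η` of degree `p` such that `γ c ∧ η` is divisible by `α c` for all `c ∈ I`. -/
def wedgeLog (I : Finset J) (γ : J → V) (α : J → S) (p : ℕ) : Submodule S (ExteriorAlgebra S V) :=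
  ⋀[S]^p V ⊓ ⨅ c ∈ I, Submodule.comap (LinearMap.mulLeft S (ι S (γ c)))
    (Submodule.map (LinearMap.lsmul S (ExteriorAlgebra S V) (α c)) (⋀[S]^(p + 1) V))

/-- Elements that are multiples of `γ c` modulo `α c` for all `c ∈ I`. -/
def oneLog (I : Finset J) (γ : J → V) (α : J → S) : Submodule S V :=
  ⨅ c ∈ I, Submodule.span S {γ c} ⊔ Submodule.map (LinearMap.lsmul S V (α c)) ⊤

variable {I : Finset J} {γ : J → V} {α : J → S}

theorem mem_wedgeLog {p : ℕ} {η : ExteriorAlgebra S V} :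
    η ∈ wedgeLog I γ α p ↔ η ∈ ⋀[S]^p V ∧
      ∀ c ∈ I, ∃ ζ ∈ ⋀[S]^(p + 1) V, α c • ζ = ι S (γ c) * η := by
  simp [wedgeLog, Submodule.mem_iInf, Submodule.mem_map]

theorem mem_oneLog {u : V} :
    u ∈ oneLog I γ α ↔ ∀ c ∈ I, ∃ (a : S) (w : V), a • γ c + α c • w = u := by
  simp [oneLog, Submodule.mem_iInf, Submodule.mem_sup, Submodule.mem_span_singleton]

theorem exists_eq_of_ι_mul_eq_smul {g : V} {d : Module.Dual S V} (hd : d g = 1) {r : S} {p : ℕ}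
    {η ζ : ExteriorAlgebra S V} (hη : η ∈ ⋀[S]^(p + 1) V) (hζ : ζ ∈ ⋀[S]^(p + 2) V)
    (h : r • ζ = ι S g * η) :
    ∃ a ∈ ⋀[S]^p V, ∃ b ∈ ⋀[S]^(p + 1) V, η = ι S g * a + r • b := by
  refine ⟨_, contractLeft_mem_exteriorPower d hη, _, contractLeft_mem_exteriorPower d hζ, ?_⟩
  rw [← map_smul, h, contractLeft_ι_mul', hd, one_smul]
  abel

theorem exteriorPower_one : ⋀[S]^1 V = LinearMap.range (ι S : V →ₗ[S] ExteriorAlgebra S V) :=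
  pow_one _

theorem wedgeLog_one (hd : ∀ c ∈ I, ∃ d : Module.Dual S V, d (γ c) = 1) :
    wedgeLog I γ α 1 = Submodule.map (ι S) (oneLog I γ α) := by
  ext η
  rw [mem_wedgeLog, Submodule.mem_map]
  constructor
  · rintro ⟨hη, h⟩
    have hη' := hη
    rw [exteriorPower_one] at hη'
    obtain ⟨u, rfl⟩ := hη'
    refine ⟨u, mem_oneLog.mpr fun c hc => ?_, rfl⟩
    obtain ⟨d, hd⟩ := hd c hc
    obtain ⟨ζ, hζ, h⟩ := h c hc
    obtain ⟨a, ha, b, hb, hab⟩ := exists_eq_of_ι_mul_eq_smul hd hη hζ h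
    obtain ⟨a, rfl⟩ := mem_exteriorPower_zero.mp ha
    rw [exteriorPower_one] at hb
    obtain ⟨b, rfl⟩ := hb
    refine ⟨a, b, (ι_leftInverse (R := S) (M := V)).injective ?_⟩
    rw [hab, map_add, map_smul, map_smul, Algebra.smul_def a, Algebra.commutes]
  · rintro ⟨u, hu, rfl⟩
    refine ⟨exteriorPower_one.ge ⟨u, rfl⟩, fun c hc => ?_⟩
    obtain ⟨a, w, rfl⟩ := mem_oneLog.mp hu c hc
    refine ⟨ι S (γ c) * ι S w, ι_mul_mem_exteriorPower _ (exteriorPower_one.ge ⟨w, rfl⟩), ?_⟩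
    rw [map_add, map_smul, map_smul, mul_add, mul_smul_comm, mul_smul_comm, ι_sq_zero, smul_zero,
      zero_add]

/-- Logarithmic one-forms as vectors. -/
def wedgeLogOneEquiv (hd : ∀ c ∈ I, ∃ d : Module.Dual S V, d (γ c) = 1) :
    oneLog I γ α ≃ₗ[S] wedgeLog I γ α 1 :=
  (Submodule.equivMapOfInjective (ι S) ι_leftInverse.injective _).trans
    (LinearEquiv.ofEq _ _ (wedgeLog_one hd).symm)

theorem wedgeSub_succ (U : Submodule S V) (p : ℕ) :
    wedgeSub U (p + 1) = Submodule.map (ι S) U * wedgeSub U p :=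
  pow_succ' _ _

theorem wedgeSub_le (U : Submodule S V) (p : ℕ) : wedgeSub U p ≤ ⋀[S]^p V :=
  pow_le_pow_left' (by rintro _ ⟨v, -, rfl⟩; exact ⟨v, rfl⟩) p

theorem smul_mem_wedgeSub {U : Submodule S V} {Q : S} (hQ : ∀ v : V, Q • v ∈ U) :
    ∀ {p : ℕ} {x : ExteriorAlgebra S V}, x ∈ ⋀[S]^p V → Q ^ p • x ∈ wedgeSub U p
  | 0, x, hx => by rwa [pow_zero, one_smul]
  | p + 1, x, hx => by
    refine exteriorPower_succ_induction (C := fun x => Q ^ (p + 1) • x ∈ wedgeSub U (p + 1))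
      (fun x y hx hy => by rw [smul_add]; exact Submodule.add_mem _ hx hy) (fun v x hx => ?_) hx
    have : Q ^ (p + 1) • (ι S v * x) = ι S (Q • v) * (Q ^ p • x) := by
      rw [map_smul, smul_mul_smul_comm, pow_succ']
    rw [this, wedgeSub_succ]
    exact Submodule.mul_mem_mul ⟨_, hQ v, rfl⟩ (smul_mem_wedgeSub hQ hx)

theorem exists_eq_of_mem_wedgeSub {c : J} (hc : c ∈ I) :
    ∀ {p : ℕ} {x : ExteriorAlgebra S V}, x ∈ wedgeSub (oneLog I γ α) (p + 1) →
      ∃ a ∈ ⋀[S]^p V, ∃ b ∈ ⋀[S]^(p + 1) V, x = α c ^ p • (ι S (γ c) * a) + α c ^ (p + 1) • b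
  | 0, x, hx => by
    rw [wedgeSub, pow_one] at hx
    obtain ⟨u, hu, rfl⟩ := hx
    obtain ⟨a, w, rfl⟩ := mem_oneLog.mp hu c hc
    refine ⟨algebraMap S _ a, mem_exteriorPower_zero.mpr ⟨a, rfl⟩, ι S w,
      exteriorPower_one.ge ⟨w, rfl⟩, ?_⟩
    rw [map_add, map_smul, map_smul, Algebra.smul_def a, Algebra.commutes, pow_zero, one_smul,
      zero_add, pow_one]
  | p + 1, x, hx => by
    rw [wedgeSub_succ] at hx
    refine Submodule.mul_induction_on hx ?_ ?_
    · rintro _ ⟨u, hu, rfl⟩ y hy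
      obtain ⟨s, w, rfl⟩ := mem_oneLog.mp hu c hc
      obtain ⟨a, ha, b, hb, rfl⟩ := exists_eq_of_mem_wedgeSub hc hy
      refine ⟨s • b - ι S w * a, Submodule.sub_mem _ (Submodule.smul_mem _ _ hb)
        (ι_mul_mem_exteriorPower w ha), ι S w * b, ι_mul_mem_exteriorPower w hb, ?_⟩
      rw [map_add, map_smul, map_smul, add_mul, mul_add, mul_add, smul_mul_smul_comm,
        ι_mul_ι_mul_self, smul_zero, zero_add, smul_mul_smul_comm, smul_mul_smul_comm,
        smul_mul_smul_comm, ι_mul_swap w, mul_sub, mul_smul_comm, smul_sub, smul_smul, smul_neg]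
      ring_nf
      abel
    · rintro _ _ ⟨a, ha, b, hb, rfl⟩ ⟨a', ha', b', hb', rfl⟩
      refine ⟨a + a', Submodule.add_mem _ ha ha', b + b', Submodule.add_mem _ hb hb', ?_⟩
      rw [mul_add, smul_add, smul_add]
      abel

theorem exists_eq_smul_iff {W : Type} [AddCommGroup W] [Module S W] [Module.Free S W] {d : S}
    {x : W} : (∃ y, x = d • y) ↔ ∀ i, d ∣ (Module.Free.chooseBasis S W).repr x i := by
  constructor
  · rintro ⟨y, rfl⟩ i
    exact ⟨_, by rw [map_smul, Finsupp.smul_apply, smul_eq_mul]⟩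
  · intro h
    choose q hq using fun i => h i
    let b := Module.Free.chooseBasis S W
    refine ⟨∑ i ∈ (b.repr x).support, q i • b i, ?_⟩
    conv_lhs => rw [← b.linearCombination_repr x, Finsupp.linearCombination_apply, Finsupp.sum]
    rw [Finset.smul_sum]
    exact Finset.sum_congr rfl fun i _ => by rw [hq i, mul_smul]

theorem exists_eq_smul_of_isRelPrime [DecompositionMonoid S] {W : Type} [AddCommGroup W]
    [Module S W] [Module.Free S W] {d q : S} (hdq : IsRelPrime d q) {x : W}
    (h : ∃ y, q • x = d • y) : ∃ y, x = d • y := by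
  rw [exists_eq_smul_iff] at h ⊢
  intro i
  have := h i
  rw [map_smul, Finsupp.smul_apply, smul_eq_mul] at this
  exact hdq.dvd_of_dvd_mul_left this

theorem exists_eq_prod_smul [DecompositionMonoid S] {W : Type} [AddCommGroup W]
    [Module S W] [Module.Free S W] {q : J → S}
    (hq : (I : Set J).Pairwise (Function.onFun IsRelPrime q)) {x : W}
    (h : ∀ c ∈ I, ∃ y, x = q c • y) : ∃ y, x = (∏ c ∈ I, q c) • y := by
  rw [exists_eq_smul_iff]
  exact fun i => Finset.prod_dvd_of_isRelPrime hq fun c hc => exists_eq_smul_iff.mp (h c hc) i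

theorem exists_not_dvd_prod_erase [IsDomain S] [DecompositionMonoid S] (hI : I.Nonempty)
    (hα : (I : Set J).Pairwise (Function.onFun IsRelPrime α)) (p : S) (hp : Prime p) :
    ∃ c : I, ¬ p ∣ ∏ c' ∈ I.erase c, α c' := by
  by_cases h : ∃ c ∈ I, p ∣ α c
  · obtain ⟨c, hc, hpc⟩ := h
    refine ⟨⟨c, hc⟩, fun hd => ?_⟩
    obtain ⟨c', hc', hpc'⟩ := (hp.dvd_finsetProd_iff _).mp hd
    rw [Finset.mem_erase] at hc'
    exact hp.not_isUnit (hα hc'.2 hc hc'.1 hpc' hpc)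
  · push Not at h
    obtain ⟨c, hc⟩ := hI
    refine ⟨⟨c, hc⟩, fun hd => ?_⟩
    obtain ⟨c', hc', hpc'⟩ := (hp.dvd_finsetProd_iff _).mp hd
    exact h c' (Finset.mem_of_mem_erase hc') hpc'

variable [IsDomain S] [UniqueFactorizationMonoid S]

theorem PD.mem_of_smul_mem {W : Type} [AddCommGroup W] [Module S W] [Module.IsTorsionFree S W]
    {M : Submodule S W} {p : ℕ} (hM : PD S p M) {rs : List S} (hreg : IsWeaklyRegular S rs)
    (hp : p + 2 ≤ rs.length) (hrs : ∃ r ∈ rs, r ≠ 0) (hfac : ∀ r ∈ rs, FactorsFree S M r)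
    {X : Type} [Nonempty X]
    (q : X → S) (hq0 : ∀ c, q c ≠ 0) (hq : ∀ p, Prime p → ∃ c, ¬ p ∣ q c) {y : W}
    (hy : ∀ c, q c • y ∈ M) : y ∈ M := by
  let T : Submodule S W := M ⊔ Submodule.span S {y}
  have hT : ∀ x ∈ T, ∀ c, q c • x ∈ M := by
    intro x hx c
    obtain ⟨m, hm, z, hz, rfl⟩ := Submodule.mem_sup.mp hx
    obtain ⟨a, rfl⟩ := Submodule.mem_span_singleton.mp hz
    rw [smul_add, smul_comm]
    exact M.add_mem (M.smul_mem _ hm) (M.smul_mem _ (hy c))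
  have h := PD.eq_top (M := T) (Q := M.submoduleOf T) hreg
    (hM.of_equiv (Submodule.submoduleOfEquivOfLe le_sup_left).symm) hp
    (fun r hr x => (hfac r hr).smul_mem q hq0 hq (hT x x.2))
    (fun x hx => by
      obtain ⟨r, hr, hr0⟩ := hrs
      exact (smul_eq_zero.mp (hx r hr)).resolve_left hr0)
  have hyT : y ∈ T := Submodule.mem_sup_right (Submodule.mem_span_singleton_self y)
  have : (⟨y, hyT⟩ : T) ∈ M.submoduleOf T := h ▸ Submodule.mem_top
  exact this

theorem PD_wedgeLog [Module.Free S V] [Module.Finite S V] (hI : I.Nonempty)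
    (hα0 : ∀ c ∈ I, α c ≠ 0)
    (hα : (I : Set J).Pairwise (Function.onFun IsRelPrime α))
    (hd : ∀ c ∈ I, ∃ d : Module.Dual S V, d (γ c) = 1)
    (hres : HasShortFreeRes S (oneLog I γ α)) {H : List S}
    (hreg : ∀ N : ℕ, 0 < N → IsWeaklyRegular S (H.map (· ^ N))) (hH0 : ∀ h ∈ H, h ≠ 0)
    (hfac : ∀ h ∈ H, FactorsFree S (oneLog I γ α) h) {p : ℕ} (hp0 : 1 ≤ p)
    (hp : p + 2 ≤ H.length) : PD S p (wedgeLog I γ α p) := by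
  obtain ⟨k, rfl⟩ := Nat.exists_eq_add_of_le' hp0
  set U := oneLog I γ α with hU
  let Q : S := ∏ c ∈ I, α c
  let q : I → S := fun c => ∏ c' ∈ I.erase c, α c'
  have hQ0 : Q ≠ 0 := Finset.prod_ne_zero_iff.mpr hα0
  have hqQ : ∀ c : I, α c * q c = Q := fun c => Finset.mul_prod_erase I α c.2
  have hq0 : ∀ c, q c ≠ 0 := fun c h => hQ0 (by rw [← hqQ c, h, mul_zero])
  have hQU : ∀ u : V, Q • u ∈ U := fun u => mem_oneLog.mpr fun c hc =>
    ⟨0, q ⟨c, hc⟩ • u, by rw [zero_smul, zero_add, smul_smul, hqQ ⟨c, hc⟩]⟩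
  have hqU : ∀ c : I, q c • γ c ∈ U := fun c => mem_oneLog.mpr fun c' hc' => by
    by_cases h : c' = c
    · subst h; exact ⟨q c, 0, by rw [smul_zero, add_zero]⟩
    · obtain ⟨t, ht⟩ : α c' ∣ q c :=
        Finset.dvd_prod_of_mem α (Finset.mem_erase.mpr ⟨h, hc'⟩)
      exact ⟨0, t • γ c, by rw [zero_smul, zero_add, smul_smul, ht]⟩
  obtain ⟨hPD, hΛfac⟩ := PD_wedgeSub hres hQ0 hQU hreg hfac (p := k + 1) (by omega)
  let W := ⋀[S]^(k + 1) V
  let Λ : Submodule S W := (wedgeSub U (k + 1)).submoduleOf (⋀[S]^(k + 1) V)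
  have eΛ : Λ ≃ₗ[S] wedgeSub U (k + 1) := Submodule.submoduleOfEquivOfLe (wedgeSub_le U (k + 1))
  have hmem : ∀ η ∈ wedgeLog I γ α (k + 1), Q ^ k • η ∈ wedgeSub U (k + 1) := by
    intro η hη
    obtain ⟨hηW, hη⟩ := mem_wedgeLog.mp hη
    have := hI.to_subtype
    refine PD.mem_of_smul_mem (M := Λ) (y := Q ^ k • (⟨η, hηW⟩ : W)) (hPD.of_equiv eΛ.symm)
      (hreg (k + 1) k.succ_pos) (by simpa using hp) ?_ ?_ q hq0
      (exists_not_dvd_prod_erase hI hα) fun c => ?_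
    · obtain ⟨h, hh⟩ : ∃ h, h ∈ H := List.exists_mem_of_length_pos (by omega)
      exact ⟨_, List.mem_map.mpr ⟨h, hh, rfl⟩, pow_ne_zero _ (hH0 h hh)⟩
    · intro r hr
      obtain ⟨h, hh, rfl⟩ := List.mem_map.mp hr
      obtain ⟨m, f, g, hfg⟩ := hΛfac h hh
      exact ⟨m, f ∘ₗ eΛ.toLinearMap, eΛ.symm.toLinearMap ∘ₗ g, fun m => by simp [hfg]⟩
    · obtain ⟨d, hd⟩ := hd c c.2
      obtain ⟨ζ, hζ, h⟩ := hη c c.2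
      obtain ⟨a, ha, b, hb, rfl⟩ := exists_eq_of_ι_mul_eq_smul hd hηW hζ h
      change q c • Q ^ k • (ι S (γ c) * a + α c • b) ∈ wedgeSub U (k + 1)
      have : q c • Q ^ k • (ι S (γ c) * a + α c • b) =
          ι S (q c • γ c) * (Q ^ k • a) + Q ^ (k + 1) • b := by
        rw [map_smul, smul_mul_smul_comm, pow_succ, ← hqQ c, smul_smul, smul_add, smul_smul]
        ring_nf
      rw [this]
      refine Submodule.add_mem _ ?_ (smul_mem_wedgeSub hQU hb)
      rw [wedgeSub_succ]
      exact Submodule.mul_mem_mul ⟨_, hqU c, rfl⟩ (smul_mem_wedgeSub hQU ha)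
  let θ : wedgeLog I γ α (k + 1) →ₗ[S] wedgeSub U (k + 1) :=
    ((Q ^ k • LinearMap.id : ExteriorAlgebra S V →ₗ[S] _).restrict hmem)
  have hrel : ∀ c ∈ I, IsRelPrime (α c) (∏ c' ∈ I.erase c, α c') := fun c hc =>
    IsRelPrime.prod_right fun c' hc' =>
      hα hc (Finset.mem_of_mem_erase hc') (Finset.ne_of_mem_erase hc').symm
  refine hPD.of_equiv (LinearEquiv.ofBijective θ ⟨?_, ?_⟩).symm
  · refine (injective_iff_map_eq_zero θ).mpr fun x hx => ?_
    have h1 : Q ^ k • (⟨x, (mem_wedgeLog.mp x.2).1⟩ : W) = 0 :=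
      Subtype.ext (congrArg (fun y : wedgeSub U (k + 1) => (y : ExteriorAlgebra S V)) hx)
    exact Subtype.ext (congrArg (fun y : W => (y : ExteriorAlgebra S V))
      ((smul_eq_zero.mp h1).resolve_left (pow_ne_zero _ hQ0)))
  · rintro ⟨x, hx⟩
    obtain ⟨y, hy⟩ : ∃ y : W, (⟨x, wedgeSub_le U _ hx⟩ : W) = (∏ c ∈ I, α c ^ k) • y := by
      refine exists_eq_prod_smul (W := W) (q := fun c => α c ^ k)
        (fun c hc c' hc' h => (hα hc hc' h).pow) fun c hc => ?_
      obtain ⟨a, ha, b, hb, rfl⟩ := exists_eq_of_mem_wedgeSub hc hx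
      refine ⟨⟨ι S (γ c) * a, ι_mul_mem_exteriorPower _ ha⟩ + α c • ⟨b, hb⟩, Subtype.ext ?_⟩
      change α c ^ k • (ι S (γ c) * a) + α c ^ (k + 1) • b = α c ^ k • (ι S (γ c) * a + α c • b)
      rw [smul_add, smul_smul, pow_succ]
    rw [Finset.prod_pow] at hy
    have hy' : x = Q ^ k • (y : ExteriorAlgebra S V) := congrArg Subtype.val hy
    refine ⟨⟨y, mem_wedgeLog.mpr ⟨y.2, fun c hc => ?_⟩⟩, Subtype.ext hy'.symm⟩
    obtain ⟨a, ha, b, hb, hab⟩ := exists_eq_of_mem_wedgeSub hc hx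
    let z : ⋀[S]^(k + 2) V := ⟨ι S (γ c) * y, ι_mul_mem_exteriorPower _ y.2⟩
    have h1 : α c ^ k • (q ⟨c, hc⟩ ^ k • z) =
        α c ^ k • (α c • ⟨ι S (γ c) * b, ι_mul_mem_exteriorPower _ hb⟩) := by
      refine Subtype.ext ?_
      change α c ^ k • (q ⟨c, hc⟩ ^ k • (ι S (γ c) * y)) = α c ^ k • (α c • (ι S (γ c) * b))
      rw [smul_smul, smul_smul, ← mul_pow, hqQ ⟨c, hc⟩, ← mul_smul_comm, ← hy', hab, mul_add,
        mul_smul_comm, ι_mul_ι_mul_self, smul_zero, zero_add, mul_smul_comm, pow_succ]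
    have h2 := smul_right_injective (⋀[S]^(k + 2) V) (pow_ne_zero k (hα0 c hc)) h1
    obtain ⟨w, hw⟩ := exists_eq_smul_of_isRelPrime (W := ⋀[S]^(k + 2) V) (x := z)
      ((hrel c hc).pow_right (n := k)) ⟨⟨ι S (γ c) * b, ι_mul_mem_exteriorPower _ hb⟩, h2⟩
    exact ⟨w, w.2, (congrArg Subtype.val hw).symm⟩

end LogForms

section LogFormsExtreme

open ExteriorAlgebra

variable {S V J : Type} [CommRing S] [AddCommGroup V] [Module S V]
variable {I : Finset J} {γ : J → V} {α : J → S}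

theorem PD.ker_of_global {k : ℕ} (hgl : ∀ (M : Type) [AddCommGroup M] [Module S M], PD S (k + 2) M)
    {F G : Type} [AddCommGroup F] [Module S F] [AddCommGroup G] [Module S G]
    [Module.Projective S F] [Module.Projective S G] (f : F →ₗ[S] G) :
    PD S k (LinearMap.ker f) := by
  have h1 : PD S (k + 1) (LinearMap.range f) :=
    PD.left (f := (LinearMap.range f).subtype) (g := (LinearMap.range f).mkQ)
      (LinearMap.range f).injective_subtype (LinearMap.exact_subtype_mkQ _)
      (Submodule.mkQ_surjective _) (PD.of_projective _) (hgl _)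
  exact PD.left (f := (LinearMap.ker f).subtype) (g := f.rangeRestrict)
    (LinearMap.ker f).injective_subtype
    (fun x => by simp [Subtype.ext_iff]) f.surjective_rangeRestrict
    (PD.of_projective _) h1

theorem PD_wedgeLog_of_global [IsDomain S] [Module.Free S V] {k : ℕ}
    (hgl : ∀ (M : Type) [AddCommGroup M] [Module S M], PD S (k + 2) M)
    (hα0 : ∀ c ∈ I, α c ≠ 0) (p : ℕ) : PD S k (wedgeLog I γ α p) := by
  let D (c : J) : ⋀[S]^p V →ₗ[S] ⋀[S]^(p + 1) V :=
    (LinearMap.mulLeft S (ι S (γ c))).restrict fun x hx => ι_mul_mem_exteriorPower _ hx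
  let f : (⋀[S]^p V × (I → ⋀[S]^(p + 1) V)) →ₗ[S] (I → ⋀[S]^(p + 1) V) :=
    LinearMap.pi fun c => D c ∘ₗ LinearMap.fst S _ _ -
      α c • LinearMap.proj c ∘ₗ LinearMap.snd S _ _
  have hf : ∀ x, f x = 0 ↔ ∀ c : I, D c x.1 = α c • x.2 c := fun x => by
    rw [funext_iff]
    exact forall_congr' fun c => sub_eq_zero
  have hmem : ∀ x : LinearMap.ker f, (x.1.1 : ExteriorAlgebra S V) ∈ wedgeLog I γ α p := fun x =>
    mem_wedgeLog.mpr ⟨x.1.1.2, fun c hc => ⟨x.1.2 ⟨c, hc⟩, (x.1.2 ⟨c, hc⟩).2,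
      (congrArg Subtype.val ((hf _).mp x.2 ⟨c, hc⟩)).symm⟩⟩
  let θ : LinearMap.ker f →ₗ[S] wedgeLog I γ α p :=
    ((⋀[S]^p V).subtype ∘ₗ LinearMap.fst S _ _ ∘ₗ (LinearMap.ker f).subtype).codRestrict _ hmem
  refine (PD.ker_of_global hgl f).of_equiv (LinearEquiv.ofBijective θ ⟨?_, ?_⟩)
  · intro x y hxy
    have h1 : x.1.1 = y.1.1 :=
      Subtype.ext (congrArg (fun y : wedgeLog I γ α p => (y : ExteriorAlgebra S V)) hxy)
    refine Subtype.ext (Prod.ext h1 (funext fun c => ?_))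
    refine smul_right_injective _ (hα0 c c.2) ?_
    exact ((hf _).mp x.2 c).symm.trans ((congrArg _ h1).trans ((hf _).mp y.2 c))
  · rintro ⟨η, hη⟩
    obtain ⟨hηW, hη'⟩ := mem_wedgeLog.mp hη
    choose ζ hζ h using hη'
    exact ⟨⟨(⟨η, hηW⟩, fun c => ⟨ζ c c.2, hζ c c.2⟩),
      (hf _).mpr fun c => Subtype.ext (h c c.2).symm⟩, rfl⟩

theorem PD_wedgeLog_zero [IsDomain S] [UniqueFactorizationMonoid S]
    (hα0 : ∀ c ∈ I, α c ≠ 0)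
    (hα : (I : Set J).Pairwise (Function.onFun IsRelPrime α))
    (hd : ∀ c ∈ I, ∃ d : Module.Dual S V, d (γ c) = 1) : PD S 0 (wedgeLog I γ α 0) := by
  let Q : S := ∏ c ∈ I, α c
  have hQ0 : Q ≠ 0 := Finset.prod_ne_zero_iff.mpr hα0
  have hmem : ∀ f : S, algebraMap S (ExteriorAlgebra S V) (Q * f) ∈ wedgeLog I γ α 0 := fun f =>
    mem_wedgeLog.mpr ⟨mem_exteriorPower_zero.mpr ⟨_, rfl⟩, fun c hc => by
      obtain ⟨t, ht⟩ : α c ∣ Q := Finset.dvd_prod_of_mem α hc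
      refine ⟨ι S ((t * f) • γ c), exteriorPower_one.ge ⟨_, rfl⟩, ?_⟩
      rw [ht, ← map_smul, smul_smul, ← Algebra.commutes, ← Algebra.smul_def, ← map_smul, mul_assoc]⟩
  let θ : S →ₗ[S] wedgeLog I γ α 0 :=
    (Algebra.linearMap S _ ∘ₗ LinearMap.mulLeft S Q).codRestrict _ hmem
  rw [PD_zero_iff]
  refine Module.Projective.of_equiv (LinearEquiv.ofBijective θ ⟨?_, ?_⟩)
  · refine (injective_iff_map_eq_zero θ).mpr fun x hx => ?_
    have h1 : algebraMap S (ExteriorAlgebra S V) (Q * x) = 0 :=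
      congrArg (fun y : wedgeLog I γ α 0 => (y : ExteriorAlgebra S V)) hx
    rw [ExteriorAlgebra.algebraMap_eq_zero_iff] at h1
    exact (mul_eq_zero.mp h1).resolve_left hQ0
  · rintro ⟨η, hη⟩
    obtain ⟨hη0, h⟩ := mem_wedgeLog.mp hη
    obtain ⟨f, rfl⟩ := mem_exteriorPower_zero.mp hη0
    obtain ⟨g, hg⟩ : Q ∣ f := Finset.prod_dvd_of_isRelPrime hα fun c hc => by
      obtain ⟨d, hd⟩ := hd c hc
      obtain ⟨ζ, hζ, h⟩ := h c hc
      rw [exteriorPower_one] at hζ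
      obtain ⟨w, rfl⟩ := hζ
      rw [← Algebra.commutes, ← Algebra.smul_def, ← map_smul, ← map_smul] at h
      have := congrArg d ((ι_leftInverse (R := S) (M := V)).injective h)
      rw [map_smul, map_smul, hd, smul_eq_mul, smul_eq_mul, mul_one] at this
      exact ⟨_, this.symm⟩
    exact ⟨g, Subtype.ext (congrArg (algebraMap S (ExteriorAlgebra S V)) hg.symm)⟩

end LogFormsExtreme

section LinearForms

theorem linP_smul (s : K) (c : Fin ℓ → K) : linP (s • c) = C s * linP c := by
  simp [linP, Finset.mul_sum, mul_assoc]

/-- The linear form with given coefficients, as a linear map. -/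
def linPLin (K : Type) [Field K] (ℓ : ℕ) : (Fin ℓ → K) →ₗ[K] PS K ℓ where
  toFun := linP
  map_add' c d := by simp [linP, add_mul, Finset.sum_add_distrib]
  map_smul' s c := by rw [linP_smul, RingHom.id_apply, smul_eq_C_mul]

theorem coeff_linP (c : Fin ℓ → K) (i : Fin ℓ) : coeff (Finsupp.single i 1) (linP c) = c i := by
  rw [linP, coeff_sum, Finset.sum_eq_single i]
  · rw [coeff_C_mul, coeff_X, if_pos rfl, mul_one]
  · intro j _ hj
    rw [coeff_C_mul, coeff_X, if_neg, mul_zero]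
    exact fun h => hj (Finsupp.single_left_injective one_ne_zero h)
  · simp

theorem linP_injective : Function.Injective (linP : (Fin ℓ → K) → PS K ℓ) := fun c d h => by
  ext i
  rw [← coeff_linP c, h, coeff_linP]

theorem linP_single (i : Fin ℓ) : linP (Pi.single i (1 : K)) = X i := by
  rw [linP, Finset.sum_eq_single i]
  · simp
  · intro j _ hj; simp [hj]
  · simp

theorem linP_ne_zero {c : Fin ℓ → K} (hc : c ≠ 0) : linP c ≠ 0 := fun h =>
  hc (linP_injective (h.trans (map_zero (linPLin K ℓ)).symm))

theorem linP_isHomogeneous (c : Fin ℓ → K) : (linP c).IsHomogeneous 1 := by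
  refine IsHomogeneous.sum _ _ _ fun i _ => ?_
  have := (isHomogeneous_C (Fin ℓ) (c i)).mul (isHomogeneous_X K i)
  rwa [zero_add] at this

theorem totalDegree_linP {c : Fin ℓ → K} (hc : c ≠ 0) : (linP c).totalDegree = 1 :=
  (linP_isHomogeneous c).totalDegree (linP_ne_zero hc)

theorem linP_irreducible {c : Fin ℓ → K} (hc : c ≠ 0) : Irreducible (linP c) := by
  refine irreducible_of_totalDegree_eq_one (totalDegree_linP hc) fun x hx => ?_
  rw [isUnit_iff_ne_zero]
  rintro rfl
  obtain ⟨i, hi⟩ := Function.ne_iff.mp hc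
  have := zero_dvd_iff.mp (hx (Finsupp.single i 1))
  rw [coeff_linP] at this
  exact hi this

theorem isRelPrime_linP {c c' : Fin ℓ → K} (hc : c ≠ 0) (hc' : c' ≠ 0)
    (h : ∀ t : K, c ≠ t • c') : IsRelPrime (linP c) (linP c') := by
  refine IsRelPrime.symm ((linP_irreducible hc').isRelPrime_iff_not_dvd.mpr ?_)
  rintro ⟨q, hq⟩
  have hq0 : q ≠ 0 := by rintro rfl; exact linP_ne_zero hc (by rw [hq, mul_zero])
  have hdeg := congrArg totalDegree hq
  rw [totalDegree_mul_of_isDomain (linP_ne_zero hc') hq0, totalDegree_linP hc,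
    totalDegree_linP hc'] at hdeg
  have hq1 := totalDegree_eq_zero_iff_eq_C.mp (by omega : q.totalDegree = 0)
  rw [hq1, mul_comm, ← linP_smul] at hq
  exact h _ (linP_injective hq)

end LinearForms

section Minors

variable {S J : Type} [CommRing S] [Algebra K S] {n : ℕ}

theorem exists_smul_add_smul_iff_minors {g : Fin n → K} (hg : g ≠ 0) (α : S) (u : Fin n → S) :
    (∃ (a : S) (w : Fin n → S), a • (fun i => algebraMap K S (g i)) + α • w = u) ↔
      ∀ i j, α ∣ algebraMap K S (g i) * u j - algebraMap K S (g j) * u i := by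
  constructor
  · rintro ⟨a, w, rfl⟩ i j
    refine ⟨algebraMap K S (g i) * w j - algebraMap K S (g j) * w i, ?_⟩
    simp only [Pi.add_apply, Pi.smul_apply, smul_eq_mul]
    ring
  · intro h
    obtain ⟨k, hk⟩ := Function.ne_iff.mp hg
    choose q hq using h
    have hk' : algebraMap K S (g k)⁻¹ * algebraMap K S (g k) = 1 := by
      rw [← map_mul, inv_mul_cancel₀ hk, map_one]
    refine ⟨algebraMap K S (g k)⁻¹ * u k, fun j => algebraMap K S (g k)⁻¹ * q k j, ?_⟩
    ext j
    simp only [Pi.add_apply, Pi.smul_apply, smul_eq_mul]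
    linear_combination (-algebraMap K S (g k)⁻¹) * hq k j + u j * hk'

theorem exists_dual_eq_one {g : Fin n → K} (hg : g ≠ 0) :
    ∃ d : Module.Dual S (Fin n → S), d (fun i => algebraMap K S (g i)) = 1 := by
  obtain ⟨k, hk⟩ := Function.ne_iff.mp hg
  refine ⟨algebraMap K S (g k)⁻¹ • LinearMap.proj k, ?_⟩
  rw [LinearMap.smul_apply, LinearMap.proj_apply, smul_eq_mul, ← map_mul, inv_mul_cancel₀ hk,
    map_one]

theorem mem_oneLog_iff_minors {I : Finset J} {t : J → Fin n → K}
    (ht : ∀ c ∈ I, t c ≠ 0)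
    {α : J → S} {u : Fin n → S} :
    u ∈ oneLog I (fun c i => algebraMap K S (t c i)) α ↔
      ∀ c ∈ I, ∀ i j, α c ∣ algebraMap K S (t c i) * u j - algebraMap K S (t c j) * u i := by
  rw [mem_oneLog]
  exact forall₂_congr fun c hc => exists_smul_add_smul_iff_minors (ht c hc) (α c) u

end Minors

section OneLogFunctorial

variable {S J V : Type} [CommRing S] [AddCommGroup V] [Module S V] {I : Finset J} {γ : J → V}
  {α : J → S}

theorem linearMap_pi_apply_eq_sum {n : ℕ} (L : (Fin n → S) →ₗ[S] S) (u : Fin n → S) :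
    L u = ∑ k, u k * L (Pi.single k 1) := by
  conv_lhs => rw [pi_eq_sum_univ' u]
  simp only [map_sum, map_smul, smul_eq_mul]

theorem prod_smul_mem_oneLog (I' : Finset J) {u : V} (hu : u ∈ oneLog I' γ α) :
    (∏ c ∈ I \ I', α c) • u ∈ oneLog I γ α := by
  rw [mem_oneLog] at hu ⊢
  intro c hc
  by_cases hc' : c ∈ I'
  · obtain ⟨a, w, rfl⟩ := hu c hc'
    refine ⟨(∏ c ∈ I \ I', α c) * a, (∏ c ∈ I \ I', α c) • w, ?_⟩
    rw [smul_add, mul_smul, smul_comm (α c)]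
  · obtain ⟨t, ht⟩ := Finset.dvd_prod_of_mem α (Finset.mem_sdiff.mpr ⟨hc, hc'⟩)
    exact ⟨0, t • u, by rw [ht, zero_smul, zero_add, smul_smul]⟩

theorem oneLog_mono {I' : Finset J}
    (hI' : I' ⊆ I) : oneLog I γ α ≤ oneLog I' γ α := fun u hu => by
  rw [mem_oneLog] at hu ⊢
  exact fun c hc => hu c (hI' hc)

end OneLogFunctorial

section OneLogModule

variable {S J : Type} [CommRing S] [IsDomain S] {n : ℕ}

/-- A submodule of a free module which is cut out by divisibility of linear forms and which has
full rank is reflexive. -/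
theorem isReflexive_of_dvd {X : Type} (M : Submodule S (Fin n → S)) {Q : S} (hQ : Q ≠ 0)
    (hQM : ∀ u, Q • u ∈ M) (lam : X → (Fin n → S) →ₗ[S] S) (al : X → S) (hal : ∀ x, al x ≠ 0)
    (hM : ∀ u, u ∈ M ↔ ∀ x, al x ∣ lam x u) : Module.IsReflexive S M := by
  refine ⟨?_, ?_⟩
  · rw [injective_iff_map_eq_zero]
    intro m hm
    refine Subtype.ext (funext fun k => ?_)
    exact LinearMap.congr_fun hm (LinearMap.proj k ∘ₗ M.subtype)
  · intro E
    let x : Fin n → Module.Dual S M := fun k => LinearMap.proj k ∘ₗ M.subtype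
    let ξ : Fin n → S := fun k => E (x k)
    have hlin : ∀ L : (Fin n → S) →ₗ[S] S, E (L ∘ₗ M.subtype) = L ξ := by
      intro L
      have h1 : L ∘ₗ M.subtype = ∑ k, L (Pi.single k 1) • x k := by
        ext m
        rw [LinearMap.comp_apply, linearMap_pi_apply_eq_sum L]
        simp [x, mul_comm]
      rw [h1, map_sum, linearMap_pi_apply_eq_sum L]
      refine Finset.sum_congr rfl fun k _ => ?_
      rw [map_smul, smul_eq_mul, mul_comm]
    have hξ : ξ ∈ M := (hM ξ).mpr fun i => by
      choose q hq using fun m : M => (hM m).mp m.2 i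
      let μ : Module.Dual S M :=
        { toFun := q
          map_add' := fun m m' => mul_left_cancel₀ (hal i) (by
            rw [mul_add, ← hq, ← hq, ← hq, Submodule.coe_add, map_add])
          map_smul' := fun r m => mul_left_cancel₀ (hal i) (by
            rw [← hq, Submodule.coe_smul, map_smul, hq, RingHom.id_apply, smul_eq_mul, smul_eq_mul]
            ring) }
      refine ⟨E μ, ?_⟩
      rw [← hlin, ← smul_eq_mul, ← map_smul]
      congr 1
      ext m
      exact hq m
    refine ⟨⟨ξ, hξ⟩, LinearMap.ext fun θ => ?_⟩
    let q : (Fin n → S) →ₗ[S] M := LinearMap.codRestrict M (Q • LinearMap.id) hQM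
    have h1 : Q • θ = (θ ∘ₗ q) ∘ₗ M.subtype := by
      ext m
      have : q m = Q • m := Subtype.ext rfl
      change Q • θ m = θ (q m)
      rw [this, map_smul]
    have h2 := hlin (θ ∘ₗ q)
    rw [← h1, map_smul] at h2
    refine mul_left_cancel₀ hQ ?_
    have h3 : q ξ = Q • ⟨ξ, hξ⟩ := Subtype.ext rfl
    rw [LinearMap.comp_apply, h3, map_smul] at h2
    exact h2.symm

variable {I : Finset J} {α : J → S}

variable [Algebra K S]

theorem isReflexive_oneLog {t : J → Fin n → K} (ht : ∀ c ∈ I, t c ≠ 0) (hα : ∀ c ∈ I, α c ≠ 0) :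
    Module.IsReflexive S (oneLog I (fun c i => algebraMap K S (t c i)) α) := by
  refine isReflexive_of_dvd (X := I × Fin n × Fin n) (Q := ∏ c ∈ I, α c) _
    (Finset.prod_ne_zero_iff.mpr hα) (fun u => ?_)
    (fun x => algebraMap K S (t x.1 x.2.1) • LinearMap.proj x.2.2 -
      algebraMap K S (t x.1 x.2.2) • LinearMap.proj x.2.1) (fun x => α x.1)
    (fun x => hα _ x.1.2) fun u => ?_
  · have := prod_smul_mem_oneLog (I := I) (α := α)
      (γ := fun c i => algebraMap K S (t c i)) (u := u) ∅
      (mem_oneLog.mpr (by simp))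
    rwa [Finset.sdiff_empty] at this
  · rw [mem_oneLog_iff_minors ht]
    exact ⟨fun h x => h _ x.1.2 _ _, fun h c hc i j => h ⟨⟨c, hc⟩, i, j⟩⟩

end OneLogModule

theorem isHomogSub_oneLog {J : Type} {n : ℕ} {I : Finset J} {t : J → Fin n → K}
    (ht : ∀ c ∈ I, t c ≠ 0)
    {α : J → PS K ℓ} (hα : ∀ c ∈ I, (α c).IsHomogeneous 1) :
    IsHomogSub (fun _ => 0) (oneLog I (fun c i => C (t c i)) α) := by
  intro e a ha
  rw [← algebraMap_eq, mem_oneLog_iff_minors ht] at ha ⊢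
  intro c hc i j
  obtain ⟨q, hq⟩ := ha c hc i j
  have h := congrArg (homogeneousComponent e) hq
  rw [mul_comm (α c), homogeneousComponent_mul_isHomogeneous q (α c) (hα c hc), map_sub,
    algebraMap_eq,
    homogeneousComponent_C_mul, homogeneousComponent_C_mul] at h
  simp only [vecComponent_apply, Nat.zero_le, if_true, Nat.sub_zero, algebraMap_eq]
  rw [h]
  split_ifs
  · exact Dvd.intro_left _ rfl
  · exact dvd_zero _

section FactorsFreeIdeal

variable {S : Type} [CommRing S] {M M' : Type} [AddCommGroup M] [Module S M] [AddCommGroup M']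
  [Module S M']

theorem FactorsFree.mul_left {h : S} (H : FactorsFree S M h) (r : S) : FactorsFree S M (r * h) := by
  obtain ⟨k, f, g, hfg⟩ := H
  exact ⟨k, f, r • g, fun m => by rw [LinearMap.smul_apply, hfg, mul_smul]⟩

theorem FactorsFree.add {h h' : S} (H : FactorsFree S M h) (H' : FactorsFree S M h') :
    FactorsFree S M (h + h') := by
  obtain ⟨k, f, g, hfg⟩ := H
  obtain ⟨k', f', g', hfg'⟩ := H'
  exact .of_free (F := (Fin k → S) × (Fin k' → S)) (f.prod f') (g.coprod g')
    fun m => by simp [hfg, hfg', add_smul]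

theorem FactorsFree.comp {h : S} (H : FactorsFree S M h) {r : S} (i : M' →ₗ[S] M) (j : M →ₗ[S] M')
    (hij : ∀ m, j (i m) = r • m) : FactorsFree S M' (h * r) := by
  obtain ⟨k, f, g, hfg⟩ := H
  exact ⟨k, f ∘ₗ i, j ∘ₗ g, fun m => by
    simp [hfg, hij, mul_smul]⟩

theorem FactorsFree.prod_self {h : S} (H : FactorsFree S M h) : FactorsFree S (M × S) h := by
  obtain ⟨k, f, g, hfg⟩ := H
  exact .of_free (F := (Fin k → S) × S) (f.prodMap LinearMap.id) (g.prodMap (h • LinearMap.id))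
    fun m => by ext <;> simp [hfg]

theorem FactorsFree.of_equiv {h : S} (H : FactorsFree S M h) (e : M ≃ₗ[S] M') :
    FactorsFree S M' h := by
  obtain ⟨k, f, g, hfg⟩ := H
  exact ⟨k, f ∘ₗ e.symm.toLinearMap, e.toLinearMap ∘ₗ g, fun m => by simp [hfg]⟩

theorem HasShortFreeRes.of_equiv (H : HasShortFreeRes S M) (e : M ≃ₗ[S] M') :
    HasShortFreeRes S M' := by
  obtain ⟨r, s, φ, π, hφ, hφπ, hπ⟩ := H
  exact ⟨r, s, φ, e.toLinearMap ∘ₗ π, hφ, fun x => by simpa using hφπ x, e.surjective.comp hπ⟩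

theorem HasShortFreeRes.prod_self (H : HasShortFreeRes S M) : HasShortFreeRes S (M × S) := by
  obtain ⟨r, s, φ, π, hφ, hφπ, hπ⟩ := H
  let e : (Fin (r + 1) → S) ≃ₗ[S] (Fin r → S) × S :=
    (Fin.consLinearEquiv S fun _ => S).symm.trans (LinearEquiv.prodComm S _ _)
  refine ⟨r + 1, s, e.symm.toLinearMap ∘ₗ LinearMap.inl S _ _ ∘ₗ φ,
    π.prodMap LinearMap.id ∘ₗ e.toLinearMap,
    e.symm.injective.comp (LinearMap.inl_injective.comp hφ), fun x => ?_,
    (hπ.prodMap Function.surjective_id).comp e.surjective⟩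
  obtain ⟨⟨x, y⟩, rfl⟩ := e.symm.surjective x
  have h := hφπ x
  simp only [LinearMap.comp_apply, LinearEquiv.coe_coe, LinearEquiv.apply_symm_apply,
    LinearMap.prodMap_apply, LinearMap.id_apply, Prod.mk_eq_zero, h, Set.mem_range,
    EmbeddingLike.apply_eq_iff_eq, LinearMap.inl_apply, Prod.mk.injEq]
  constructor
  · rintro ⟨⟨a, rfl⟩, rfl⟩
    exact ⟨a, rfl, rfl⟩
  · rintro ⟨a, rfl, rfl⟩
    exact ⟨⟨a, rfl⟩, rfl⟩

end FactorsFreeIdeal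

/-- Coordinates on `S` adapted to the restriction to `z = 0`, together with a family of linear
forms in these coordinates. -/
structure SlicedForms (K : Type) [Field K] (S J : Type) [CommRing S] [Algebra K S] (n : ℕ) where
  /-- restriction to `z = 0` -/
  res : S →+* PS K n
  /-- the equation of the slice -/
  z : S
  /-- the remaining coordinates -/
  y : Fin n → S
  /-- the coefficients along `y` -/
  t : J → Fin n → K
  /-- the coefficient along `z` -/
  s : J → K
  res_algebraMap : ∀ a, res (algebraMap K S a) = C a
  res_y : ∀ i, res (y i) = X i
  res_eq_zero : ∀ x, res x = 0 ↔ z ∣ x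

namespace SlicedForms

section

variable {S J : Type} [CommRing S] [Algebra K S] {n : ℕ} (D : SlicedForms K S J n)

/-- The linear forms of the family. -/
def form (c : J) : S := ∑ i, algebraMap K S (D.t c i) * D.y i + algebraMap K S (D.s c) * D.z

theorem res_z : D.res D.z = 0 := (D.res_eq_zero _).mpr dvd_rfl

theorem res_form (c : J) : D.res (D.form c) = linP (D.t c) := by
  simp [form, res_algebraMap, res_y, res_z, linP]

/-- The section of the restriction given by the coordinates. -/
def lift : PS K n →ₐ[K] S := aeval D.y

theorem res_lift (x : PS K n) : D.res (D.lift x) = x := by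
  have h : D.res.comp (D.lift : PS K n →+* S) = RingHom.id _ := by
    refine MvPolynomial.ringHom_ext (fun a => ?_) fun i => ?_
    · change D.res (D.lift (algebraMap K _ a)) = _
      rw [AlgHom.commutes, res_algebraMap]
      rfl
    · change D.res (aeval D.y (X i)) = _
      rw [aeval_X, res_y]
      rfl
  exact RingHom.congr_fun h x

theorem res_surjective : Function.Surjective D.res := fun x => ⟨_, D.res_lift x⟩

/-- The coefficient vectors of the family along `y`, with entries in `R`. -/
def vec (R : Type) [CommRing R] [Algebra K R] (c : J) : Fin n → R :=
  fun i => algebraMap K R (D.t c i)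

/-- The forms of the family which are proportional to a given one on the slice. -/
def cls (G : Finset J) (c : J) : Finset J := G.filter fun c' => ∃ r : K, r ≠ 0 ∧ D.t c' = r • D.t c

/-- Logarithmic vectors along `y` for the family. -/
def logMod (G : Finset J) : Submodule S (Fin n → S) := oneLog G (D.vec S) D.form

/-- Logarithmic vectors for the restricted multiarrangement. -/
def resMod (G : Finset J) : Submodule (PS K n) (Fin n → PS K n) :=
  oneLog G (D.vec (PS K n)) fun c => ∏ b ∈ D.cls G c, linP (D.t b)

/-- The forms vanish nowhere along the slice and are in general position. -/
structure Good (G : Finset J) : Prop where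
  ne_zero : ∀ c ∈ G, D.t c ≠ 0
  pairwise : (G : Set J).Pairwise (Function.onFun IsRelPrime D.form)
  isRelPrime_z : ∀ c ∈ G, IsRelPrime (D.form c) D.z

variable {D}

theorem Good.mono {G G' : Finset J} (h : D.Good G) (hG : G' ⊆ G) : D.Good G' :=
  ⟨fun c hc => h.ne_zero c (hG hc), h.pairwise.mono hG, fun c hc => h.isRelPrime_z c (hG hc)⟩

theorem Good.form_ne_zero {G : Finset J} (h : D.Good G) {c : J} (hc : c ∈ G) : D.form c ≠ 0 :=
  fun h0 => linP_ne_zero (h.ne_zero c hc) (by rw [← D.res_form, h0, map_zero])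

theorem mem_logMod {G : Finset J} (h : D.Good G) {u : Fin n → S} : u ∈ D.logMod G ↔
    ∀ c ∈ G, ∀ i j, D.form c ∣
      algebraMap K S (D.t c i) * u j - algebraMap K S (D.t c j) * u i :=
  mem_oneLog_iff_minors h.ne_zero

theorem mem_resMod {G : Finset J} (h : D.Good G) {u : Fin n → PS K n} : u ∈ D.resMod G ↔
    ∀ c ∈ G, ∀ i j, (∏ c' ∈ D.cls G c, linP (D.t c')) ∣ C (D.t c i) * u j - C (D.t c j) * u i :=
  mem_oneLog_iff_minors h.ne_zero

theorem mem_cls {G : Finset J} {c c' : J} :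
    c' ∈ D.cls G c ↔ c' ∈ G ∧ ∃ r : K, r ≠ 0 ∧ D.t c' = r • D.t c := Finset.mem_filter

theorem cls_subset {G : Finset J} {c : J} : D.cls G c ⊆ G := Finset.filter_subset _ _

theorem not_dvd_of_dvd {G : Finset J} (h : D.Good G) {c : J} (hc : c ∈ G) {p : PS K n}
    (hp : Prime p) (hpc : p ∣ linP (D.t c)) : ¬ p ∣ D.res (∏ c' ∈ G \ D.cls G c, D.form c') := by
  rw [map_prod]
  intro hdvd
  obtain ⟨c', hc', hpc'⟩ := hp.exists_mem_finset_dvd hdvd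
  obtain ⟨hc'G, hcls⟩ := Finset.mem_sdiff.mp hc'
  rw [res_form] at hpc'
  refine hp.not_isUnit (isRelPrime_linP (h.ne_zero c' hc'G) (h.ne_zero c hc)
    (fun r hr => ?_) hpc' hpc)
  refine hcls (mem_cls.mpr ⟨hc'G, r, ?_, hr⟩)
  rintro rfl
  exact h.ne_zero c' hc'G (by rw [hr, zero_smul])

end

section

variable {S J : Type} [CommRing S] [UniqueFactorizationMonoid S] [Algebra K S] {n : ℕ}
  {D : SlicedForms K S J n} {G : Finset J}

theorem vecRed_mem_resMod (h : D.Good G) {u : Fin n → S} (hu : u ∈ D.logMod G) :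
    vecRed D.res n u ∈ D.resMod G := by
  rw [mem_logMod h] at hu
  rw [mem_resMod h]
  intro c hc i j
  have h1 : (∏ c' ∈ D.cls G c, D.form c') ∣
      algebraMap K S (D.t c i) * u j - algebraMap K S (D.t c j) * u i := by
    refine Finset.prod_dvd_of_isRelPrime (h.pairwise.mono cls_subset) fun c' hc' => ?_
    obtain ⟨hc'G, r, hr, hrt⟩ := mem_cls.mp hc'
    have h2 := (hu c' hc'G i j).mul_left (algebraMap K S r⁻¹)
    have h3 : algebraMap K S r⁻¹ * algebraMap K S r = 1 := by
      rw [← map_mul, inv_mul_cancel₀ hr, map_one]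
    convert h2 using 1
    simp only [hrt, Pi.smul_apply, smul_eq_mul, map_mul]
    linear_combination (-algebraMap K S (D.t c i) * u j + algebraMap K S (D.t c j) * u i) * h3
  have h4 := map_dvd D.res h1
  simp only [map_prod, res_form, map_sub, map_mul, res_algebraMap] at h4
  exact h4

/-- Restriction of logarithmic vectors. -/
def red (h : D.Good G) : D.logMod G →ₛₗ[D.res] D.resMod G where
  toFun u := ⟨vecRed D.res n u, vecRed_mem_resMod h u.2⟩
  map_add' u v := Subtype.ext (by simp)
  map_smul' c v := Subtype.ext (by simp)

theorem coe_red (h : D.Good G) (u : D.logMod G) : (red h u : Fin n → PS K n) = vecRed D.res n u :=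
  rfl

theorem exists_smul_of_red_eq_zero (h : D.Good G) {m : D.logMod G} (hm : red h m = 0) :
    ∃ m', m = D.z • m' := by
  obtain ⟨u, hu⟩ := exists_smul_of_vecRed_eq_zero D.res_eq_zero (congrArg Subtype.val hm)
  have hmm := m.2
  rw [hu, mem_logMod h] at hmm
  refine ⟨⟨u, (mem_logMod h).mpr fun c hc i j => ?_⟩, Subtype.ext hu⟩
  refine (h.isRelPrime_z c hc).dvd_of_dvd_mul_left (z := _) ?_
  convert hmm c hc i j using 1
  simp only [Pi.smul_apply, smul_eq_mul]
  ring

theorem exists_red_eq_smul (h : D.Good G) (ν : D.resMod G) {c : J} (hc : c ∈ G) :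
    ∃ m : D.logMod G, red h m = D.res (∏ c' ∈ G \ D.cls G c, D.form c') • ν := by
  obtain ⟨a, w, haw⟩ := mem_oneLog.mp ν.2 c hc
  let u : Fin n → S := D.lift a • D.vec S c + (∏ c' ∈ D.cls G c, D.form c') • fun i => D.lift (w i)
  have hu : u ∈ oneLog (D.cls G c) (D.vec S) D.form := by
    rw [mem_oneLog]
    intro c' hc'
    obtain ⟨hc'G, r, hr, hrt⟩ := mem_cls.mp hc'
    obtain ⟨q, hq⟩ := Finset.dvd_prod_of_mem D.form hc'
    refine ⟨algebraMap K S r⁻¹ * D.lift a, q • fun i => D.lift (w i), ?_⟩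
    have h3 : algebraMap K S r⁻¹ * algebraMap K S r = 1 := by
      rw [← map_mul, inv_mul_cancel₀ hr, map_one]
    ext i
    simp only [u, vec, hq, hrt, Pi.add_apply, Pi.smul_apply, smul_eq_mul, map_mul]
    linear_combination D.lift a * algebraMap K S (D.t c i) * h3
  refine ⟨⟨_, prod_smul_mem_oneLog _ hu⟩, Subtype.ext ?_⟩
  rw [coe_red, Submodule.coe_smul, ← haw]
  funext i
  simp [vecRed, u, vec, res_lift, res_algebraMap, res_form, mul_add]

theorem red_surjective_of_factorsFree (h : D.Good G) (hM : FactorsFree S (D.logMod G) 1) :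
    Function.Surjective (red h) := by
  intro ν
  rcases G.eq_empty_or_nonempty with rfl | ⟨b, hb⟩
  · obtain ⟨u, hu⟩ := vecRed_surjective D.res D.res_surjective n ν
    exact ⟨⟨u, by simp [logMod, mem_oneLog]⟩, Subtype.ext hu⟩
  obtain ⟨k, f, g, hgf⟩ := hM
  choose m hm using fun c : G => exists_red_eq_smul h ν c.2
  let F : G → S := fun c => ∏ c' ∈ G \ D.cls G c, D.form c'
  have hFne : ∀ c, D.res (F c) ≠ 0 := fun c => by
    simp only [F, map_prod, res_form]
    exact Finset.prod_ne_zero_iff.mpr fun c' hc' =>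
      linP_ne_zero (h.ne_zero c' (Finset.mem_sdiff.mp hc').1)
  have hz : ∀ m' : D.logMod G, red h m' = 0 → vecRed D.res k (f m') = 0 := by
    intro m' hm'
    obtain ⟨m'', rfl⟩ := exists_smul_of_red_eq_zero h hm'
    rw [map_smul, LinearMap.map_smulₛₗ, res_z, zero_smul]
  have hcomm : ∀ c c', D.res (F c') • vecRed D.res k (f (m c)) =
      D.res (F c) • vecRed D.res k (f (m c')) := by
    intro c c'
    have h1 : red h (F c' • m c - F c • m c') = 0 := by
      rw [map_sub, LinearMap.map_smulₛₗ, LinearMap.map_smulₛₗ, hm, hm, smul_smul, smul_smul,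
        mul_comm, sub_self]
    have h2 := hz _ h1
    rwa [map_sub, map_sub, LinearMap.map_smul f, LinearMap.map_smul f, LinearMap.map_smulₛₗ,
      LinearMap.map_smulₛₗ, sub_eq_zero] at h2
  have hdvd : ∀ j, D.res (F ⟨b, hb⟩) ∣ vecRed D.res k (f (m ⟨b, hb⟩)) j := by
    intro j
    refine dvd_of_forall_dvd_mul (fun c => D.res (F c)) (fun p hp => ?_) (hFne _) fun c => ?_
    · by_cases hpb : p ∣ D.res (F ⟨b, hb⟩)
      · rw [map_prod] at hpb
        obtain ⟨c', hc', hpc'⟩ := hp.exists_mem_finset_dvd hpb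
        have hc'G := (Finset.mem_sdiff.mp hc').1
        rw [res_form] at hpc'
        exact ⟨⟨c', hc'G⟩, not_dvd_of_dvd h hc'G hp hpc'⟩
      · exact ⟨_, hpb⟩
    · exact ⟨_, congrFun (hcomm ⟨b, hb⟩ c) j⟩
  choose χ hχ using hdvd
  obtain ⟨x, hx⟩ := vecRed_surjective D.res D.res_surjective k χ
  have h1 : vecRed D.res k (f (m ⟨b, hb⟩) - F ⟨b, hb⟩ • x) = 0 := by
    rw [map_sub, LinearMap.map_smulₛₗ, hx, sub_eq_zero]
    exact funext hχ
  obtain ⟨x', hx'⟩ := exists_smul_of_vecRed_eq_zero D.res_eq_zero h1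
  have h2 : m ⟨b, hb⟩ = F ⟨b, hb⟩ • g x + D.z • g x' := by
    rw [← one_smul S (m ⟨b, hb⟩), ← hgf, ← map_smul, ← map_smul, ← map_add, ← hx', add_sub_cancel]
  refine ⟨g x, ?_⟩
  have h3 := hm ⟨b, hb⟩
  rw [h2, map_add, LinearMap.map_smulₛₗ, LinearMap.map_smulₛₗ, res_z, zero_smul, add_zero] at h3
  refine Subtype.ext (funext fun i => mul_left_cancel₀ (hFne ⟨b, hb⟩) ?_)
  exact congrFun (congrArg Subtype.val h3) i

/-- The elements `h` which factor multiplication on logarithmic vectors through a free module and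
whose restriction annihilates the cokernel of restriction. -/
def goodIdeal (h : D.Good G) : Ideal S where
  carrier := {r | FactorsFree S (D.logMod G) r ∧
    ∀ ν : D.resMod G, ∃ m, red h m = D.res r • ν}
  zero_mem' := ⟨⟨0, 0, 0, by simp⟩, fun ν => ⟨0, by simp⟩⟩
  add_mem' := fun {a b} ha hb => ⟨ha.1.add hb.1, fun ν => by
    obtain ⟨m, hm⟩ := ha.2 ν
    obtain ⟨m', hm'⟩ := hb.2 ν
    exact ⟨m + m', by rw [map_add, hm, hm', map_add, add_smul]⟩⟩
  smul_mem' := fun r x hx => ⟨hx.1.mul_left r, fun ν => by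
    obtain ⟨m, hm⟩ := hx.2 ν
    exact ⟨r • m, by rw [LinearMap.map_smulₛₗ, hm, smul_smul, smul_eq_mul, map_mul]⟩⟩

theorem prod_mem_goodIdeal (h : D.Good G) {G' : Finset J} (hG : G' ⊆ G)
    (hG' : ∀ c ∈ G', D.cls G c ⊆ G') (hfree : FactorsFree S (D.logMod G') 1) :
    ∏ c ∈ G \ G', D.form c ∈ goodIdeal h := by
  constructor
  · rw [← one_mul (∏ c ∈ G \ G', D.form c)]
    exact hfree.comp (Submodule.inclusion (oneLog_mono hG))
      (((∏ c ∈ G \ G', D.form c) • (D.logMod G').subtype).codRestrict (D.logMod G)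
        fun u => prod_smul_mem_oneLog G' u.2) fun m => Subtype.ext rfl
  · intro ν
    have hν : (ν : Fin n → PS K n) ∈ D.resMod G' := by
      rw [mem_resMod (h.mono hG)]
      intro c hc i j
      have := (mem_resMod h).mp ν.2 c (hG hc) i j
      have hcls : D.cls G' c = D.cls G c := by
        ext c'
        rw [mem_cls, mem_cls]
        exact ⟨fun hh => ⟨hG hh.1, hh.2⟩, fun hh => ⟨hG' c hc (mem_cls.mpr hh), hh.2⟩⟩
      rwa [hcls]
    obtain ⟨m, hm⟩ := red_surjective_of_factorsFree (h.mono hG) hfree ⟨ν, hν⟩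
    refine ⟨⟨_, prod_smul_mem_oneLog (I := G) G' m.2⟩, Subtype.ext ?_⟩
    rw [coe_red, Submodule.coe_smul, LinearMap.map_smulₛₗ]
    congr 1
    exact congrArg Subtype.val hm

/-- Some powers of suitable products of translates of the coordinates are good. -/
theorem exists_pow_mem_goodIdeal (h : D.Good G)
    (hfree : ∀ a : Fin n → K, a ≠ 0 →
      FactorsFree S (D.logMod (G.filter fun c => D.t c ⬝ᵥ a = 0)) 1) :
    ∃ (r : Fin n → Finset J → K) (N : ℕ), 0 < N ∧ ∀ i,
      (∏ G' ∈ G.powerset, (D.y i + algebraMap K S (r i G') * D.z)) ^ N ∈ goodIdeal h := by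
  have hr : ∀ (i : Fin n) (G' : Finset J), ∃ r : K,
      Submodule.span K (D.t '' G') = ⊤ →
        D.y i + algebraMap K S r * D.z ∈ Ideal.span (D.form '' G') := by
    intro i G'
    by_cases hG' : Submodule.span K (D.t '' G') = ⊤
    · have hi : (Pi.single i 1 : Fin n → K) ∈ Submodule.span K (D.t '' G') := by
        rw [hG']; trivial
      obtain ⟨a, ha⟩ := (Submodule.mem_span_image_finset_iff_exists_fun K).mp hi
      refine ⟨∑ c : G', a c * D.s c, fun _ => ?_⟩
      have key : D.y i + algebraMap K S (∑ c : G', a c * D.s c) * D.z =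
          ∑ c : G', algebraMap K S (a c) * D.form c := by
        have h1 : D.y i = ∑ j, algebraMap K S ((Pi.single i 1 : Fin n → K) j) * D.y j := by
          rw [Finset.sum_eq_single i]
          · simp
          · intro j _ hj; simp [hj]
          · simp
        rw [h1, ← ha]
        simp only [form, Finset.sum_apply, Pi.smul_apply, smul_eq_mul, map_sum, map_mul,
          Finset.sum_mul, mul_add, Finset.mul_sum, Finset.sum_add_distrib, mul_assoc]
        rw [Finset.sum_comm]
      rw [key]
      exact Ideal.sum_mem _ fun c _ => Ideal.mul_mem_left _ _
        (Ideal.subset_span (Set.mem_image_of_mem _ c.2))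
    · exact ⟨0, fun h => absurd h hG'⟩
  choose r hr using hr
  have hrad : ∀ i, ∏ G' ∈ G.powerset, (D.y i + algebraMap K S (r i G') * D.z) ∈
      (goodIdeal h).radical := by
    intro i
    rw [Ideal.radical_eq_sInf, Ideal.mem_sInf]
    rintro P ⟨hP, hprime⟩
    let B : Finset J := G.filter fun c => D.form c ∈ P
    have hspan : Submodule.span K (D.t '' B) = ⊤ := by
      by_contra hne
      obtain ⟨φ, hφ, hφB⟩ := Submodule.exists_le_ker_of_lt_top _ (lt_top_iff_ne_top.mpr hne)
      let a : Fin n → K := fun j => φ (Pi.single j 1)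
      have hφa : ∀ v, φ v = v ⬝ᵥ a := fun v => linearMap_pi_apply_eq_sum φ v
      have ha : a ≠ 0 := by
        rintro ha
        exact hφ (LinearMap.ext fun v => by rw [hφa, ha, dotProduct_zero]; rfl)
      have hmem := hP (prod_mem_goodIdeal h (Finset.filter_subset _ _) (fun c hc c' hc' => by
        obtain ⟨hc'G, r, -, hr⟩ := mem_cls.mp hc'
        rw [Finset.mem_filter] at hc ⊢
        exact ⟨hc'G, by rw [hr, smul_dotProduct, hc.2, smul_zero]⟩) (hfree a ha))
      obtain ⟨c, hc, hcP⟩ := hprime.prod_mem_iff.mp hmem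
      obtain ⟨hcG, hca⟩ := Finset.mem_sdiff.mp hc
      refine hca (Finset.mem_filter.mpr ⟨hcG, ?_⟩)
      rw [← hφa]
      exact hφB (Submodule.subset_span (Set.mem_image_of_mem _
        (Finset.mem_coe.mpr (Finset.mem_filter.mpr ⟨hcG, hcP⟩))))
    refine hprime.prod_mem_iff.mpr ⟨B, Finset.mem_powerset.mpr (Finset.filter_subset _ _), ?_⟩
    refine Ideal.span_le.mpr ?_ (hr i B hspan)
    rintro _ ⟨c, hc, rfl⟩
    exact (Finset.mem_filter.mp hc).2
  choose N hN using hrad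
  refine ⟨r, ∑ i, N i + 1, Nat.succ_pos _, fun i => Ideal.pow_mem_of_pow_mem _ (hN i) ?_⟩
  exact (Finset.single_le_sum (fun _ _ => Nat.zero_le _) (Finset.mem_univ i)).trans (Nat.le_succ _)

end

end SlicedForms

namespace SlicedForms

variable {S J : Type} [CommRing S] [IsDomain S] [UniqueFactorizationMonoid S] [Algebra K S] {n : ℕ}
  {D : SlicedForms K S J n} {G : Finset J}

/-- Logarithmic vectors for the family together with the slice itself split off a free summand. -/
theorem nonempty_equiv_logMod_prod (h : D.Good G) (hz : D.z ≠ 0)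
    (W : Submodule S (Fin (n + 1) → S))
    (hW : ∀ u, u ∈ W ↔ (∀ j : Fin n, D.z ∣ u j.succ) ∧ (∀ c ∈ G,
      (∀ i j : Fin n, D.form c ∣
        algebraMap K S (D.t c i) * u j.succ - algebraMap K S (D.t c j) * u i.succ) ∧
      ∀ j : Fin n, D.form c ∣ algebraMap K S (D.s c) * u j.succ - algebraMap K S (D.t c j) * u 0)) :
    Nonempty ((D.logMod G × S) ≃ₗ[S] W) := by
  let Q : S := ∏ c ∈ G, D.form c
  have hQ : Q ≠ 0 := Finset.prod_ne_zero_iff.mpr fun c hc => h.form_ne_zero hc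
  let E : (Fin n → S) →ₗ[S] S := ∑ i, D.y i • LinearMap.proj i
  have hE : ∀ ξ, E ξ = ∑ i, D.y i * ξ i := fun ξ => by simp [E]
  let Φ : (D.logMod G × S) →ₗ[S] (Fin (n + 1) → S) := LinearMap.pi (Fin.cons
    (Q • LinearMap.snd S _ _ - E ∘ₗ (D.logMod G).subtype ∘ₗ LinearMap.fst S _ _)
    fun j => D.z • LinearMap.proj j ∘ₗ (D.logMod G).subtype ∘ₗ LinearMap.fst S _ _)
  have hΦ0 : ∀ x, Φ x 0 = Q * x.2 - ∑ i, D.y i * (x.1 : Fin n → S) i := fun x => by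
    rw [← hE]; rfl
  have hΦs : ∀ x (j : Fin n), Φ x j.succ = D.z * (x.1 : Fin n → S) j := fun x j => rfl
  have hdiff : ∀ (ξ : Fin n → S) (c : J) (j : Fin n), ∑ i, D.y i * ξ i * algebraMap K S (D.t c j) -
      ∑ i, algebraMap K S (D.t c i) * D.y i * ξ j =
      ∑ i, (-D.y i) * (algebraMap K S (D.t c i) * ξ j - algebraMap K S (D.t c j) * ξ i) := by
    intro ξ c j
    rw [← Finset.sum_sub_distrib]
    exact Finset.sum_congr rfl fun i _ => by ring
  have hkey : ∀ ξ ∈ D.logMod G, ∀ (u0 : S), ∀ c ∈ G, ∀ j,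
      D.form c ∣ (algebraMap K S (D.s c) * (D.z * ξ j) - algebraMap K S (D.t c j) * u0) +
        algebraMap K S (D.t c j) * (u0 + ∑ i, D.y i * ξ i) := by
    intro ξ hξ u0 c hc j
    have h1 : D.form c ∣ ∑ i, (-D.y i) * (algebraMap K S (D.t c i) * ξ j -
        algebraMap K S (D.t c j) * ξ i) :=
      Finset.dvd_sum fun i _ => ((mem_logMod h).mp hξ c hc i j).mul_left _
    rw [← hdiff] at h1
    have h2 := dvd_add h1 (Dvd.intro (ξ j) (rfl : D.form c * ξ j = _))
    convert h2 using 1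
    rw [form, ← Finset.sum_mul, ← Finset.sum_mul]
    ring
  have hmem : ∀ x, Φ x ∈ W := fun x => by
    rw [hW]
    refine ⟨fun j => ⟨_, hΦs x j⟩, fun c hc => ⟨fun i j => ?_, fun j => ?_⟩⟩
    · have h1 := ((mem_logMod h).mp x.1.2 c hc i j).mul_left D.z
      convert h1 using 1
      rw [hΦs, hΦs]
      ring
    · have h1 := hkey _ x.1.2 (Φ x 0) c hc j
      rw [hΦs]
      refine (dvd_add_left ?_).mp h1
      rw [hΦ0, sub_add_cancel]
      exact ((Finset.dvd_prod_of_mem D.form hc).mul_right _).mul_left _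
  refine ⟨LinearEquiv.ofBijective (Φ.codRestrict W hmem) ⟨?_, ?_⟩⟩
  · rw [injective_iff_map_eq_zero]
    rintro ⟨ξ, f⟩ hx
    have hx' : Φ (ξ, f) = 0 := congrArg Subtype.val hx
    have hξ : ξ = 0 := by
      refine Subtype.ext (funext fun j => mul_left_cancel₀ hz ?_)
      have := congrFun hx' j.succ
      rw [hΦs] at this
      simpa using this
    subst hξ
    have := congrFun hx' 0
    rw [hΦ0] at this
    have hf : f = 0 := by simpa [hQ] using this
    rw [hf]
    rfl
  · rintro ⟨u, hu⟩
    obtain ⟨hu1, hu2⟩ := (hW u).mp hu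
    choose ξ hξ using hu1
    have hξM : ξ ∈ D.logMod G := (mem_logMod h).mpr fun c hc i j => by
      refine (h.isRelPrime_z c hc).dvd_of_dvd_mul_left ?_
      convert (hu2 c hc).1 i j using 1
      rw [hξ, hξ]
      ring
    have hdvd : Q ∣ u 0 + ∑ i, D.y i * ξ i := by
      refine Finset.prod_dvd_of_isRelPrime h.pairwise fun c hc => ?_
      obtain ⟨j, hj⟩ := Function.ne_iff.mp (h.ne_zero c hc)
      have h1 := hkey ξ hξM (u 0) c hc j
      rw [← hξ] at h1
      have h2 := ((dvd_add_right ((hu2 c hc).2 j)).mp h1).mul_left (algebraMap K S (D.t c j)⁻¹)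
      rwa [← mul_assoc, ← map_mul, inv_mul_cancel₀ hj, map_one, one_mul] at h2
    obtain ⟨f, hf⟩ := hdvd
    refine ⟨(⟨ξ, hξM⟩, f), Subtype.ext (funext fun k => ?_)⟩
    change Φ _ k = u k
    refine Fin.cases ?_ (fun j => ?_) k
    · rw [hΦ0, ← hf]; simp
    · rw [hΦs, hξ]

end SlicedForms

section Coordinates

variable {n m : ℕ}

theorem aeval_linP (M : Matrix (Fin m) (Fin n) K) (c : Fin n → K) :
    aeval (fun j => linP fun i => M i j) (linP c) = linP (M.mulVec c) := by
  have h : M.mulVec c = ∑ j, c j • fun i => M i j := by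
    ext i
    simp [Matrix.mulVec, dotProduct, mul_comm]
  have h2 : linP (M.mulVec c) = ∑ j, linP (c j • fun i => M i j) := by
    rw [h]
    exact map_sum (linPLin K m) _ _
  rw [h2, linP, map_sum]
  refine Finset.sum_congr rfl fun j _ => ?_
  rw [map_mul, aeval_X, linP_smul]
  congr 1
  exact AlgHom.commutes _ _

theorem linP_eq_sum {B B' : Matrix (Fin m) (Fin m) K} (h : B' * B = 1) (c : Fin m → K) :
    linP c = ∑ k, C (B.mulVec c k) * linP fun j => B' j k := by
  have h1 : c = ∑ k, B.mulVec c k • fun j => B' j k := by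
    conv_lhs => rw [← Matrix.one_mulVec c, ← h, ← Matrix.mulVec_mulVec]
    ext i
    simp [Matrix.mulVec, dotProduct, mul_comm]
  conv_lhs => rw [h1]
  refine (map_sum (linPLin K m) _ _).trans (Finset.sum_congr rfl fun k _ => ?_)
  exact linP_smul _ _

/-- The automorphism of the polynomial ring given by a linear change of coordinates. -/
def linearAut (B B' : Matrix (Fin m) (Fin m) K) (h : B * B' = 1) (h' : B' * B = 1) :
    PS K m ≃ₐ[K] PS K m :=
  AlgEquiv.ofAlgHom (aeval fun k => linP fun j => B' j k) (aeval fun k => linP fun j => B j k)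
    (MvPolynomial.algHom_ext fun i => by
      rw [AlgHom.comp_apply, AlgHom.id_apply, aeval_X, aeval_linP, ← linP_single]
      congr 1
      ext j
      have := congrFun (congrFun h' j) i
      simpa [Matrix.mulVec, dotProduct, Matrix.mul_apply, Matrix.one_apply, Pi.single_apply]
        using this)
    (MvPolynomial.algHom_ext fun i => by
      rw [AlgHom.comp_apply, AlgHom.id_apply, aeval_X, aeval_linP, ← linP_single]
      congr 1
      ext j
      have := congrFun (congrFun h j) i
      simpa [Matrix.mulVec, dotProduct, Matrix.mul_apply, Matrix.one_apply, Pi.single_apply]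
        using this)

theorem linearAut_X (B B' : Matrix (Fin m) (Fin m) K) (h : B * B' = 1) (h' : B' * B = 1)
    (k : Fin m) : linearAut B B' h h' (X k) = linP fun j => B' j k := aeval_X _ _

/-- The slice of affine space along the first of a system of linear coordinates, with the family
of all linear forms. -/
def sliceOfMatrix (B B' : Matrix (Fin (n + 1)) (Fin (n + 1)) K) (h : B * B' = 1)
    (h' : B' * B = 1) : SlicedForms K (PS K (n + 1)) (Fin (n + 1) → K) n where
  res := (aeval fun j => linP fun i : Fin n => B i.succ j : PS K (n + 1) →ₐ[K] PS K n)
  z := linP fun j => B' j 0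
  y i := linP fun j => B' j i.succ
  t c i := B.mulVec c i.succ
  s c := B.mulVec c 0
  res_algebraMap a :=
    (aeval fun j => linP fun i : Fin n => B i.succ j : PS K (n + 1) →ₐ[K] PS K n).commutes a
  res_y i := by
    refine (aeval_linP (fun (i : Fin n) j => B i.succ j) _).trans ?_
    rw [← linP_single]
    congr 1
    ext k
    have := congrFun (congrFun h k.succ) i.succ
    simpa [Matrix.mulVec, dotProduct, Matrix.mul_apply, Matrix.one_apply, Pi.single_apply]
      using this
  res_eq_zero x := by
    have hz : aeval (fun j => linP fun i : Fin n => B i.succ j) (linP fun j => B' j 0) =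
        (0 : PS K n) := by
      refine (aeval_linP (fun (i : Fin n) j => B i.succ j) _).trans ?_
      have : Matrix.mulVec (fun (i : Fin n) j => B i.succ j) (fun j => B' j 0) = 0 := by
        ext k
        have := congrFun (congrFun h k.succ) 0
        simpa [Matrix.mulVec, dotProduct, Matrix.mul_apply, Matrix.one_apply] using this
      rw [this]
      exact map_zero (linPLin K n)
    refine ⟨fun hx => ?_, fun ⟨q, hq⟩ => ?_⟩
    · let π := Ideal.Quotient.mkₐ K (Ideal.span {(linP fun j => B' j 0 : PS K (n + 1))})
      have key : (π.comp (aeval fun i : Fin n => (linP fun j => B' j i.succ : PS K (n + 1)))).comp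
          (aeval fun j => linP fun i : Fin n => B i.succ j) = π := by
        refine MvPolynomial.algHom_ext fun j => ?_
        have hj := linP_eq_sum h' (Pi.single j 1)
        rw [linP_single, Fin.sum_univ_succ] at hj
        rw [AlgHom.comp_apply, AlgHom.comp_apply, aeval_X]
        refine Eq.trans ?_ (congrArg π hj).symm
        rw [map_add, map_mul]
        have h0 : π (linP fun j => B' j 0) = 0 :=
          Ideal.Quotient.eq_zero_iff_mem.mpr (Ideal.mem_span_singleton_self _)
        rw [h0, mul_zero, zero_add]
        congr 1
        rw [linP, map_sum]
        refine Finset.sum_congr rfl fun i _ => ?_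
        rw [map_mul, aeval_X]
        congr 1
        rw [Matrix.mulVec_single_one]
        exact AlgHom.commutes _ _
      have h1 := AlgHom.congr_fun key x
      rw [AlgHom.comp_apply] at h1
      have h2 : π x = 0 := by
        rw [← h1]
        have : (aeval fun j => linP fun i : Fin n => B i.succ j) x = (0 : PS K n) := hx
        rw [this, map_zero]
      exact Ideal.mem_span_singleton.mp (Ideal.Quotient.eq_zero_iff_mem.mp h2)
    · rw [hq, map_mul]
      exact (congrArg (· * _) hz).trans (zero_mul _)

variable (B B' : Matrix (Fin (n + 1)) (Fin (n + 1)) K) (h : B * B' = 1) (h' : B' * B = 1)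

theorem sliceOfMatrix_form (c : Fin (n + 1) → K) : (sliceOfMatrix B B' h h').form c = linP c := by
  rw [linP_eq_sum h' c, Fin.sum_univ_succ]
  exact add_comm _ _

theorem constantCoeff_linP (c : Fin m → K) : constantCoeff (linP c) = 0 := by
  simp [linP]

theorem constantCoeff_sliceOfMatrix_res (x : PS K (n + 1)) :
    constantCoeff ((sliceOfMatrix B B' h h').res x) = constantCoeff x := by
  have : (constantCoeff (σ := Fin n) (R := K)).comp (sliceOfMatrix B B' h h').res =
      constantCoeff := by
    refine MvPolynomial.ringHom_ext (fun a => ?_) fun i => ?_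
    · change constantCoeff ((sliceOfMatrix B B' h h').res (algebraMap K (PS K (n + 1)) a)) = _
      rw [SlicedForms.res_algebraMap, constantCoeff_C, constantCoeff_C]
    · change constantCoeff (aeval (fun j => linP fun i : Fin n => B i.succ j) (X i) : PS K n) = _
      rw [aeval_X, constantCoeff_linP, constantCoeff_X]
  exact RingHom.congr_fun this x

end Coordinates

section OneLogTransport

variable {S J V V' : Type} [CommRing S] [AddCommGroup V] [Module S V] [AddCommGroup V']
  [Module S V']

theorem oneLog_equiv_map (L : V ≃ₗ[S] V') (I : Finset J) (γ : J → V) (α : J → S) :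
    (oneLog I γ α).map L.toLinearMap = oneLog I (fun c => L (γ c)) α := by
  ext u
  rw [Submodule.mem_map_equiv, mem_oneLog, mem_oneLog]
  refine forall₂_congr fun c _ => exists_congr fun a => ?_
  constructor
  · rintro ⟨w, hw⟩
    exact ⟨L w, by rw [← map_smul, ← map_smul, ← map_add, hw, LinearEquiv.apply_symm_apply]⟩
  · rintro ⟨w, hw⟩
    exact ⟨L.symm w, by rw [← hw]; simp⟩

end OneLogTransport

section Coordinates

variable {n : ℕ}

theorem exists_adapted_coordinates {c0 : Fin (n + 1) → K} (hc0 : c0 ≠ 0)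
    (e : (Fin n → K) →ₗ[K] (Fin (n + 1) → K)) (he : IsHypEmbedding c0 e) :
    ∃ B B' : Matrix (Fin (n + 1)) (Fin (n + 1)) K, B * B' = 1 ∧ B' * B = 1 ∧
      (∀ c i, B.mulVec c (Fin.succ i) = restrictForm e c i) ∧ B.mulVec c0 = Pi.single 0 1 := by
  obtain ⟨k, hk⟩ := Function.ne_iff.mp hc0
  have hdot : ∀ x, dotLin c0 x = c0 ⬝ᵥ x := fun x => by simp [dotLin, dotProduct]
  have he0 : ∀ a, c0 ⬝ᵥ e a = 0 := fun a => by
    rw [← hdot]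
    have : e a ∈ LinearMap.range e := ⟨a, rfl⟩
    rwa [he.2] at this
  let v : Fin (n + 1) → K := Pi.single k (c0 k)⁻¹
  have hv : c0 ⬝ᵥ v = 1 := by simp [v, mul_inv_cancel₀ hk]
  let T : (Fin (n + 1) → K) →ₗ[K] (Fin (n + 1) → K) :=
    (LinearMap.proj 0).smulRight v + e ∘ₗ LinearMap.funLeft K K Fin.succ
  have hT : ∀ w, T w = w 0 • v + e (fun i => w i.succ) := fun w => rfl
  have hTinj : Function.Injective T := by
    rw [injective_iff_map_eq_zero]
    intro w hw
    rw [hT] at hw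
    have h0 : w 0 = 0 := by
      have := congrArg (c0 ⬝ᵥ ·) hw
      simpa [dotProduct_add, he0, hv] using this
    rw [h0, zero_smul, zero_add] at hw
    have h1 := he.1 (hw.trans (map_zero e).symm)
    exact funext (Fin.cases h0 (congrFun h1))
  let E := LinearEquiv.ofInjectiveEndo T hTinj
  have hE : ∀ w, E w = T w := fun w => rfl
  have h1 : LinearMap.toMatrix' T * LinearMap.toMatrix' E.symm.toLinearMap = 1 := by
    rw [← LinearMap.toMatrix'_comp, ← LinearMap.toMatrix'_id]
    congr 1
    ext1 x
    exact LinearMap.ext fun _ => E.apply_symm_apply _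
  have h2 : LinearMap.toMatrix' E.symm.toLinearMap * LinearMap.toMatrix' T = 1 := by
    rw [← LinearMap.toMatrix'_comp, ← LinearMap.toMatrix'_id]
    congr 1
    ext1 x
    exact LinearMap.ext fun _ => E.symm_apply_apply _
  have hB : ∀ c k, (LinearMap.toMatrix' T).transpose.mulVec c k = c ⬝ᵥ T (Pi.single k 1) := by
    intro c k
    simp [Matrix.mulVec, dotProduct, LinearMap.toMatrix'_apply, mul_comm]
  refine ⟨(LinearMap.toMatrix' T).transpose, (LinearMap.toMatrix' E.symm.toLinearMap).transpose,
    by rw [← Matrix.transpose_mul, h2, Matrix.transpose_one],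
    by rw [← Matrix.transpose_mul, h1, Matrix.transpose_one], fun c i => ?_, funext fun k => ?_⟩
  · rw [hB, hT]
    have : (fun j : Fin n => (Pi.single i.succ 1 : Fin (n + 1) → K) j.succ) = Pi.single i 1 := by
      ext j
      simp [Pi.single_apply, Fin.succ_inj]
    rw [this]
    simp [restrictForm, dotProduct]
  · rw [hB, hT, dotProduct_add, he0, add_zero, dotProduct_smul, hv, smul_eq_mul, mul_one]
    simp [Pi.single_apply, eq_comm]

variable {B B' : Matrix (Fin (n + 1)) (Fin (n + 1)) K} {h : B * B' = 1} {h' : B' * B = 1}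
  {c0 : Fin (n + 1) → K}

theorem sliceOfMatrix_z (hB : B.mulVec c0 = Pi.single 0 1) :
    (sliceOfMatrix B B' h h').z = linP c0 := by
  have h1 := linP_eq_sum h' c0
  rw [hB, Finset.sum_eq_single 0] at h1
  · rw [Pi.single_eq_same, C_1, one_mul] at h1
    exact h1.symm
  · intro j _ hj; simp [hj]
  · simp

theorem sliceOfMatrix_good (hB : B.mulVec c0 = Pi.single 0 1) (A : Arrangement K (n + 1))
    (hc0 : c0 ∈ A.hyps) : (sliceOfMatrix B B' h h').Good (A.hyps.erase c0) := by
  refine ⟨fun c hc ht => ?_, fun c hc c' hc' hcc => ?_, fun c hc => ?_⟩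
  · refine A.nonprop c (Finset.mem_of_mem_erase hc) c0 hc0 (Finset.ne_of_mem_erase hc)
      (B.mulVec c 0) ?_
    have h1 : B.mulVec c = B.mulVec (B.mulVec c 0 • c0) := by
      rw [Matrix.mulVec_smul, hB]
      refine funext (Fin.cases (by simp) fun i => ?_)
      rw [Pi.smul_apply, Pi.single_eq_of_ne (Fin.succ_ne_zero i), smul_zero]
      exact congrFun ht i
    have h2 := congrArg B'.mulVec h1
    rwa [Matrix.mulVec_mulVec, Matrix.mulVec_mulVec, h', Matrix.one_mulVec, Matrix.one_mulVec]
      at h2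
  · have hcA := Finset.mem_of_mem_erase (Finset.mem_coe.mp hc)
    have hcA' := Finset.mem_of_mem_erase (Finset.mem_coe.mp hc')
    change IsRelPrime _ _
    rw [sliceOfMatrix_form, sliceOfMatrix_form]
    exact isRelPrime_linP (A.ne_zero _ hcA) (A.ne_zero _ hcA') (A.nonprop _ hcA _ hcA' hcc)
  · have hcA := Finset.mem_of_mem_erase hc
    rw [sliceOfMatrix_form, sliceOfMatrix_z hB]
    exact isRelPrime_linP (A.ne_zero _ hcA) (A.ne_zero _ hc0)
      (A.nonprop _ hcA _ hc0 (Finset.ne_of_mem_erase hc))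

theorem nonempty_equiv_oneLog (hB : B.mulVec c0 = Pi.single 0 1) {G : Finset (Fin (n + 1) → K)}
    (hG : (sliceOfMatrix B B' h h').Good G) (hc0 : c0 ≠ 0) :
    Nonempty (((sliceOfMatrix B B' h h').logMod G × PS K (n + 1)) ≃ₗ[PS K (n + 1)]
      oneLog (insert c0 G) (fun c i => (C (c i) : PS K (n + 1))) linP) := by
  let Bm : Matrix (Fin (n + 1)) (Fin (n + 1)) (PS K (n + 1)) := B.map C
  let Bm' : Matrix (Fin (n + 1)) (Fin (n + 1)) (PS K (n + 1)) := B'.map C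
  have hm : Bm * Bm' = 1 := by
    rw [← Matrix.map_mul, h, Matrix.map_one _ (map_zero _) (map_one _)]
  have hm' : Bm' * Bm = 1 := by
    rw [← Matrix.map_mul, h', Matrix.map_one _ (map_zero _) (map_one _)]
  let L : (Fin (n + 1) → PS K (n + 1)) ≃ₗ[PS K (n + 1)] (Fin (n + 1) → PS K (n + 1)) :=
    LinearEquiv.ofLinearMap Bm.mulVecLin Bm'.mulVecLin
      (by rw [← Matrix.mulVecLin_mul, hm, Matrix.mulVecLin_one])
      (by rw [← Matrix.mulVecLin_mul, hm', Matrix.mulVecLin_one])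
  have hL : ∀ c : Fin (n + 1) → K, L (fun i => C (c i)) = fun i =>
      algebraMap K _ (B.mulVec c i) := by
    intro c
    ext1 i
    change Bm.mulVec _ i = C _
    simp [Bm, Matrix.mulVec, dotProduct]
  have hne : ∀ c ∈ insert c0 G, B.mulVec c ≠ 0 := by
    intro c hc hc'
    rcases Finset.mem_insert.mp hc with rfl | hc
    · rw [hB] at hc'
      have := congrFun hc' 0
      simp at this
    · exact hG.ne_zero c hc (funext fun i => congrFun hc' i.succ)
  have hW := oneLog_equiv_map L (insert c0 G) (fun c i => (C (c i) : PS K (n + 1))) linP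
  simp only [hL] at hW
  obtain ⟨E⟩ := SlicedForms.nonempty_equiv_logMod_prod hG
    (by rw [sliceOfMatrix_z hB]; exact linP_ne_zero hc0) _ (fun u => by
      rw [mem_oneLog_iff_minors (α := linP) hne, Finset.forall_mem_insert, hB,
        sliceOfMatrix_z hB]
      simp only [sliceOfMatrix_form]
      refine and_congr ⟨fun H j => ?_, fun H i j => ?_⟩ (forall₂_congr fun c _ =>
        ⟨fun H => ⟨fun i j => H i.succ j.succ, fun j => H 0 j.succ⟩, fun H i j => ?_⟩)
      · simpa using H 0 j.succ
      · refine Fin.cases ?_ (fun i => ?_) i <;> refine Fin.cases ?_ (fun j => ?_) j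
        · simp
        · simpa using H j
        · simpa using H i
        · simp
      · refine Fin.cases ?_ (fun i => ?_) i <;> refine Fin.cases ?_ (fun j => ?_) j
        · simp
        · exact H.2 j
        · rw [← dvd_neg, neg_sub]; exact H.2 i
        · exact H.1 i j)
  exact ⟨(E.trans (LinearEquiv.ofEq _ _ hW.symm)).trans
    (L.submoduleMap (oneLog (insert c0 G) (fun c i => (C (c i) : PS K (n + 1))) linP)).symm⟩

end Coordinates

section LogarithmicReduction

variable {n : ℕ} {B B' : Matrix (Fin (n + 1)) (Fin (n + 1)) K} {h : B * B' = 1} {h' : B' * B = 1}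
  {G : Finset (Fin (n + 1) → K)}

theorem isWeaklyRegular_prod_translates (B B' : Matrix (Fin (n + 1)) (Fin (n + 1)) K)
    (h : B * B' = 1) (h' : B' * B = 1) {I : Type} (s : Finset I) (r : Fin n → I → K) (N : ℕ) :
    RingTheory.Sequence.IsWeaklyRegular (PS K (n + 1)) (List.ofFn fun i =>
      (∏ a ∈ s, ((sliceOfMatrix B B' h h').y i + algebraMap K _ (r i a) *
        (sliceOfMatrix B B' h h').z)) ^ N) := by
  have h1 := isWeaklyRegular_ringEquiv (linearAut B B' h h').toRingEquiv
    (isWeaklyRegular_monic_two (K := K) n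
      (fun i => (∏ a ∈ s, (Polynomial.X + Polynomial.C (Polynomial.C (r i a) * Polynomial.X))) ^ N)
      fun i => (Polynomial.monic_prod_of_monic _ _ fun a _ => Polynomial.monic_X_add_C _).pow N)
  rw [List.map_ofFn] at h1
  refine (congrArg (fun f => RingTheory.Sequence.IsWeaklyRegular (PS K (n + 1)) (List.ofFn f))
    (funext fun i => ?_)).mpr h1
  have hX : ∀ k, (linearAut B B' h h').toRingEquiv (X k) = linP fun j => B' j k :=
    linearAut_X B B' h h'
  have hC : ∀ a : K, (linearAut B B' h h').toRingEquiv (C a) = C a :=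
    (linearAut B B' h h').commutes
  simp only [Function.comp_apply, Polynomial.eval₂_pow, Polynomial.eval₂_finsetProd,
    Polynomial.eval₂_add, Polynomial.eval₂_X, Polynomial.eval₂_C]
  simp only [map_pow, map_prod, map_add, map_mul, hX, AlgHom.toRingHom_eq_coe, RingHom.coe_coe,
    Polynomial.aeval_X, Polynomial.aeval_C, algebraMap_eq, hC]
  rfl

theorem isWeaklyRegular_pow_X (n : ℕ) (k : ℕ) :
    RingTheory.Sequence.IsWeaklyRegular (PS K n) (List.ofFn fun i => (X i : PS K n) ^ k) := by
  simpa using isWeaklyRegular_monic (R := K) n (fun _ => Polynomial.X ^ k)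
    fun _ => Polynomial.monic_X_pow k

/-- Restriction of logarithmic vectors is surjective when the restricted module has projective
dimension at most one and the arrangement is locally free along the slice. -/
theorem logMod_of_projectiveDimension_resMod (hn : 4 ≤ n) (hG : (sliceOfMatrix B B' h h').Good G)
    (hz : (sliceOfMatrix B B' h h').z ≠ 0)
    (hfree : ∀ a : Fin n → K, a ≠ 0 → FactorsFree (PS K (n + 1)) ((sliceOfMatrix B B' h h').logMod
      (G.filter fun c => (sliceOfMatrix B B' h h').t c ⬝ᵥ a = 0)) 1)
    (hN : PD (PS K n) 1 ((sliceOfMatrix B B' h h').resMod G)) :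
    HasShortFreeRes (PS K (n + 1)) ((sliceOfMatrix B B' h h').logMod G) ∧
    ∃ H : List (PS K (n + 1)), H.length = n ∧
      (∀ N : ℕ, 0 < N → RingTheory.Sequence.IsWeaklyRegular (PS K (n + 1)) (H.map (· ^ N))) ∧
      (∀ x ∈ H, x ≠ 0) ∧
      ∀ x ∈ H, FactorsFree (PS K (n + 1)) ((sliceOfMatrix B B' h h').logMod G) x := by
  set D := sliceOfMatrix B B' h h' with hD
  obtain ⟨r, N, hNpos, hr⟩ := SlicedForms.exists_pow_mem_goodIdeal hG hfree
  let x : Fin n → PS K (n + 1) := fun i =>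
    ∏ G' ∈ G.powerset, (D.y i + algebraMap K (PS K (n + 1)) (r i G') * D.z)
  have hx : ∀ i, D.res (x i ^ N) = X i ^ (G.powerset.card * N) := fun i => by
    simp only [x, map_pow, map_prod, map_add, map_mul, D.res_y, D.res_z, mul_zero, add_zero,
      Finset.prod_const, pow_mul]
  have hreg : ∀ M : ℕ, RingTheory.Sequence.IsWeaklyRegular (PS K (n + 1))
      (List.ofFn fun i => x i ^ M) := isWeaklyRegular_prod_translates B B' h h' _ r
  have hmem : ∀ w ∈ List.ofFn fun i => x i ^ N, ∃ i, x i ^ N = w := fun w hw => by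
    simpa [List.mem_ofFn] using hw
  have hgood : ∀ w ∈ List.ofFn fun i => x i ^ N, w ∈ SlicedForms.goodIdeal hG := by
    intro w hw
    obtain ⟨i, rfl⟩ := hmem w hw
    exact hr i
  refine ⟨?_, List.ofFn fun i => x i ^ N, List.length_ofFn, fun M _ => ?_, fun w hw => ?_,
    fun w hw => (hgood w hw).1⟩
  · have : Module.IsReflexive (PS K (n + 1)) (D.logMod G) :=
      isReflexive_oneLog hG.ne_zero fun c hc => hG.form_ne_zero hc
    have hregσ : RingTheory.Sequence.IsWeaklyRegular (PS K n)
        ((List.ofFn fun i => x i ^ N).map D.res) := by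
      rw [List.map_ofFn]
      have : (D.res ∘ fun i => x i ^ N) = fun i => X i ^ (G.powerset.card * N) := funext hx
      rw [this]
      exact isWeaklyRegular_pow_X n _
    have hsurj : Function.Surjective (SlicedForms.red hG) :=
      surjective_of_depth D.res D.res_surjective D.z hz D.res_eq_zero hN (SlicedForms.red hG)
        (fun m hm => SlicedForms.exists_smul_of_red_eq_zero hG hm) hregσ (by simpa using hn)
        (fun w hw => (hgood w hw).2) (fun w hw => (hgood w hw).1)
    refine hasShortFreeRes_of_graded D.res D.res_surjective D.z hz D.res_eq_zero
      (constantCoeff_sliceOfMatrix_res B B' h h') (D.logMod G) ?_ hN (SlicedForms.red hG) hsurj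
      fun m hm => SlicedForms.exists_smul_of_red_eq_zero hG hm
    refine isHomogSub_oneLog hG.ne_zero fun c _ => ?_
    rw [hD, sliceOfMatrix_form]
    exact linP_isHomogeneous c
  · rw [List.map_ofFn]
    have := hreg (N * M)
    simp only [pow_mul] at this
    exact this
  · obtain ⟨i, rfl⟩ := hmem w hw
    intro h0
    have := hx i
    rw [h0, map_zero] at this
    exact pow_ne_zero _ (X_ne_zero i) this.symm

end LogarithmicReduction

section Arrangements

/-- The one-forms of a multiarrangement as logarithmic vectors. -/
def omegaOneEquiv (A : Arrangement K ℓ) (m : (Fin ℓ → K) → ℕ) :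
    oneLog A.hyps (fun c i => algebraMap K (PS K ℓ) (c i)) (fun c => linP c ^ m c) ≃ₗ[PS K ℓ]
      Omega A m 1 :=
  wedgeLogOneEquiv fun c hc => exists_dual_eq_one (A.ne_zero c hc)

variable {n : ℕ} {B B' : Matrix (Fin (n + 1)) (Fin (n + 1)) K} {h : B * B' = 1} {h' : B' * B = 1}
  {c0 : Fin (n + 1) → K}

theorem factorsFree_logMod_of_free (hB : B.mulVec c0 = Pi.single 0 1) (hc0 : c0 ≠ 0)
    {G : Finset (Fin (n + 1) → K)} (hG : (sliceOfMatrix B B' h h').Good G)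
    (A : Arrangement K (n + 1)) (hA : A.hyps = insert c0 G) (hfree : FreeM A fun _ => 1) :
    FactorsFree (PS K (n + 1)) ((sliceOfMatrix B B' h h').logMod G) 1 := by
  obtain ⟨E⟩ := nonempty_equiv_oneLog hB hG hc0
  have hone : oneLog (insert c0 G) (fun c i => (C (c i) : PS K (n + 1))) linP =
      oneLog A.hyps (fun c i => algebraMap K (PS K (n + 1)) (c i)) fun c => linP c ^ 1 := by
    simp only [pow_one, hA]
    rfl
  let e1 := (LinearEquiv.ofEq _ _ hone).trans (omegaOneEquiv A fun _ => 1)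
  let F := E.trans e1
  have : Module.Free (PS K (n + 1)) (Omega A (fun _ => 1) 1) := hfree
  have : Module.Finite (PS K (n + 1)) (Omega A (fun _ => 1) 1) := Module.Finite.equiv e1
  exact .of_free (F.toLinearMap ∘ₗ LinearMap.inl _ _ _)
    (LinearMap.fst _ _ _ ∘ₗ F.symm.toLinearMap) fun m => by simp

theorem resMod_eq_oneLog {A : Arrangement K (n + 1)}
    {e : (Fin n → K) →ₗ[K] (Fin (n + 1) → K)}
    (he : ∀ c i, B.mulVec c (Fin.succ i) = restrictForm e c i)
    (hG : (sliceOfMatrix B B' h h').Good (A.hyps.erase c0)) (R : Arrangement K n)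
    (hR : IsRestrictionOf R A c0 e) :
    (sliceOfMatrix B B' h h').resMod (A.hyps.erase c0) =
      oneLog R.hyps (fun c i => algebraMap K (PS K n) (c i))
        (fun c => linP c ^ zieglerMult A c0 e c) := by
  have ht : ∀ c, (sliceOfMatrix B B' h h').t c = restrictForm e c := fun c => funext (he c)
  have key : ∀ c ∈ A.hyps.erase c0, ∀ c' ∈ R.hyps, ∀ r : K, r ≠ 0 →
      restrictForm e c = r • c' → ∀ (u : Fin n → PS K n) (i j : Fin n),
      ((∏ c2 ∈ (sliceOfMatrix B B' h h').cls (A.hyps.erase c0) c,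
        linP ((sliceOfMatrix B B' h h').t c2)) ∣
        C ((sliceOfMatrix B B' h h').t c i) * u j - C ((sliceOfMatrix B B' h h').t c j) * u i ↔
      linP c' ^ zieglerMult A c0 e c' ∣
        algebraMap K (PS K n) (c' i) * u j - algebraMap K (PS K n) (c' j) * u i) := by
    intro c hc c' hc' r hr hrc u i j
    have hCr : ∀ {a : K}, a ≠ 0 → IsUnit (C a : PS K n) := fun ha =>
      (isUnit_iff_ne_zero.mpr ha).map C
    have hcls : (sliceOfMatrix B B' h h').cls (A.hyps.erase c0) c =
        A.hyps.filter fun c2 => c2 ≠ c0 ∧ ∃ t : K, t ≠ 0 ∧ restrictForm e c2 = t • c' := by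
      ext c2
      rw [SlicedForms.mem_cls, Finset.mem_erase, Finset.mem_filter, ht, ht, hrc]
      constructor
      · rintro ⟨⟨h1, h2⟩, a, ha, h3⟩
        exact ⟨h2, h1, a * r, mul_ne_zero ha hr, by rw [h3, smul_smul]⟩
      · rintro ⟨h2, h1, a, ha, h3⟩
        exact ⟨⟨h1, h2⟩, a * r⁻¹, mul_ne_zero ha (inv_ne_zero hr), by
          rw [h3, smul_smul, mul_assoc, inv_mul_cancel₀ hr, mul_one]⟩
    have hassoc : Associated (∏ c2 ∈ (sliceOfMatrix B B' h h').cls (A.hyps.erase c0) c,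
        linP ((sliceOfMatrix B B' h h').t c2)) (linP c' ^ zieglerMult A c0 e c') := by
      rw [hcls, zieglerMult, ← Finset.prod_const]
      refine Associated.prod _ _ _ fun c2 hc2 => ?_
      obtain ⟨-, -, a, ha, h3⟩ := Finset.mem_filter.mp hc2
      rw [ht, h3, linP_smul]
      exact associated_unit_mul_left _ _ (hCr ha)
    rw [hassoc.dvd_iff_dvd_left, ht, hrc]
    have : C ((r • c') i) * u j - C ((r • c') j) * u i =
        C r * (algebraMap K (PS K n) (c' i) * u j - algebraMap K (PS K n) (c' j) * u i) := by
      simp only [Pi.smul_apply, smul_eq_mul, map_mul, algebraMap_eq]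
      ring
    rw [this, (hCr hr).dvd_mul_left]
  ext u
  rw [SlicedForms.mem_resMod hG, mem_oneLog_iff_minors R.ne_zero]
  constructor
  · intro H c' hc' i j
    obtain ⟨c, hc, hne, r, hr, hrc⟩ := hR.2 c' hc'
    have hcG := Finset.mem_erase.mpr ⟨hne, hc⟩
    exact (key c hcG c' hc' r hr hrc u i j).mp (H c hcG i j)
  · intro H c hcG i j
    obtain ⟨hne, hc⟩ := Finset.mem_erase.mp hcG
    obtain ⟨c', hc', r, hr, hrc⟩ := hR.1 c hc hne
    exact (key c hcG c' hc' r hr hrc u i j).mpr (H c' hc' i j)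

theorem tame_of_ziegler_restriction_tame_succ (hn : 4 ≤ n) (A : Arrangement K (n + 1))
    (hc0 : c0 ∈ A.hyps) (e : (Fin n → K) →ₗ[K] (Fin (n + 1) → K)) (R : Arrangement K n)
    (he : IsHypEmbedding c0 e) (hR : IsRestrictionOf R A c0 e)
    (htame : TameM R (zieglerMult A c0 e)) (hlf : LocallyFreeAlong A (fun _ => 1) c0) :
    Tame A := by
  have hc0' := A.ne_zero c0 hc0
  obtain ⟨B, B', h, h', hBe, hB⟩ := exists_adapted_coordinates hc0' e he
  have hG := sliceOfMatrix_good (h := h) (h' := h') hB A hc0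
  have hN : PD (PS K n) 1 ((sliceOfMatrix B B' h h').resMod (A.hyps.erase c0)) := by
    rw [resMod_eq_oneLog hBe hG R hR]
    exact PD.of_equiv (pdLE_iff_PD.mp (htame 1 (by omega))) (omegaOneEquiv R _).symm
  have hdot : ∀ c a, (sliceOfMatrix B B' h h').t c ⬝ᵥ a = ∑ j, c j * e a j := by
    intro c a
    have h1 : ∀ j, e a j = ∑ i, a i * e (Pi.single i 1) j := fun j =>
      linearMap_pi_apply_eq_sum (LinearMap.proj j ∘ₗ e) a
    have h2 : (sliceOfMatrix B B' h h').t c = restrictForm e c := funext (hBe c)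
    simp only [h2, dotProduct, restrictForm, h1, Finset.mul_sum, Finset.sum_mul]
    rw [Finset.sum_comm]
    exact Finset.sum_congr rfl fun j _ => Finset.sum_congr rfl fun i _ => by ring
  have hfree : ∀ a : Fin n → K, a ≠ 0 →
      FactorsFree (PS K (n + 1)) ((sliceOfMatrix B B' h h').logMod ((A.hyps.erase c0).filter
        fun c => (sliceOfMatrix B B' h h').t c ⬝ᵥ a = 0)) 1 := by
    intro a ha
    have hx0 : ∑ j, c0 j * e a j = 0 := by
      have h1 : e a ∈ LinearMap.ker (dotLin c0) := by rw [← he.2]; exact ⟨a, rfl⟩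
      simpa [dotLin] using h1
    refine factorsFree_logMod_of_free hB hc0' (hG.mono (Finset.filter_subset _ _))
      (locArr A (e a)) ?_ (hlf (e a) (fun h0 => ha (he.1 (h0.trans (map_zero e).symm))) hx0)
    ext c
    simp only [locArr, Finset.mem_filter, Finset.mem_insert, Finset.mem_erase, hdot]
    by_cases hc : c = c0
    · subst hc; simp [hc0, hx0]
    · simp [hc]
  have hz : (sliceOfMatrix B B' h h').z ≠ 0 := by
    rw [sliceOfMatrix_z hB]; exact linP_ne_zero hc0'
  obtain ⟨hres, H, hlen, hreg, hH0, hfac⟩ :=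
    logMod_of_projectiveDimension_resMod hn hG hz hfree hN
  obtain ⟨E⟩ := nonempty_equiv_oneLog hB hG hc0'
  rw [Finset.insert_erase hc0] at E
  have hα0 : ∀ c ∈ A.hyps, (linP c : PS K (n + 1)) ≠ 0 := fun c hc => linP_ne_zero (A.ne_zero c hc)
  have hα : (A.hyps : Set (Fin (n + 1) → K)).Pairwise
      (Function.onFun IsRelPrime (linP : _ → PS K (n + 1))) := fun c hc c' hc' hcc =>
    isRelPrime_linP (A.ne_zero _ hc) (A.ne_zero _ hc') (A.nonprop _ hc _ hc' hcc)
  have hd : ∀ c ∈ A.hyps, ∃ d : Module.Dual (PS K (n + 1)) (Fin (n + 1) → PS K (n + 1)),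
      d (fun i => C (c i)) = 1 := fun c hc => exists_dual_eq_one (A.ne_zero c hc)
  intro p hp
  rw [pdLE_iff_PD]
  have hΩ : Omega A (fun _ => 1) p =
      wedgeLog A.hyps (fun c i => (C (c i) : PS K (n + 1))) linP p := by
    have : (linP : (Fin (n + 1) → K) → PS K (n + 1)) = fun c => linP c ^ 1 := by simp
    rw [this]
    rfl
  rw [hΩ]
  rcases Nat.eq_zero_or_pos p with rfl | hp0
  · exact PD_wedgeLog_zero hα0 hα hd
  by_cases hpn : p + 2 ≤ n
  · exact PD_wedgeLog ⟨c0, hc0⟩ hα0 hα hd (hres.prod_self.of_equiv E) hreg hH0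
      (fun x hx => (hfac x hx).prod_self.of_equiv E) hp0 (by rw [hlen]; exact hpn)
  · obtain ⟨k, rfl⟩ : ∃ k, n = k + 1 := ⟨n - 1, by omega⟩
    exact PD.mono (PD_wedgeLog_of_global (k := k) (PD_mvPolynomial (k + 2)) hα0 p) (by omega)

end Arrangements

/-- (Yoshinaga-type criterion, case `ℓ ≥ 5`.)  Let `ℓ ≥ 5` and `H ∈ A`.  If the Ziegler
restriction `(A^H, m^H)` is tame and `A` is locally free along `H`, then `A` is tame. -/
theorem tame_of_ziegler_restriction_tame
    {K : Type} [Field K] {ℓ : ℕ} (hl : 5 ≤ ℓ)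
    (A : Arrangement K ℓ) (hess : Essential A)
    (c0 : Fin ℓ → K) (hc0 : c0 ∈ A.hyps)
    (hZ_tame : ∃ (e : (Fin (ℓ - 1) → K) →ₗ[K] (Fin ℓ → K)) (B : Arrangement K (ℓ - 1)),
      IsHypEmbedding c0 e ∧ IsRestrictionOf B A c0 e ∧ TameM B (zieglerMult A c0 e))
    (hlf : LocallyFreeAlong A (fun _ => 1) c0) :
    Tame A := by
  obtain ⟨n, rfl⟩ : ∃ n, ℓ = n + 1 := ⟨ℓ - 1, by omega⟩
  obtain ⟨e, R, he, hR, ht⟩ := hZ_tame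
  exact tame_of_ziegler_restriction_tame_succ (by omega) A hc0 e R he hR ht hlf
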